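/- (Kostant) Let 𝔤 be a finite-dimensional semisimple Lie algebra over ℂ and (e,h,f) an sl₂-triple with e a regular nilpotent element, i.e. dim 𝔤^e equals the rank of 𝔤 (the dimension of a Cartan subalgebra); for such e the Dynkin grading is even. Set 𝔪 = ⊕_{j ≤ −2} 𝔤_j, χ(x) = κ(x,e), and let I_χ ⊆ U(𝔤) be the left ideal generated by {a − χ(a)·1 : a ∈ 𝔪}. Let π : U(𝔤) → U(𝔤)/I_χ be the quotient map of vector spaces, and let Z(U(𝔤)) be the center of U(𝔤). Then: (1) the restriction of π to Z(U(𝔤)) is injective, and (2) π(Z(U(𝔤))) = {π(y) : y ∈ U(𝔤) such that a·y − y·a ∈ I_χ for every a ∈ 𝔪}; i.e. the finite W-algebra W_χ associated with a regular nilpotent element is isomorphic to the center of U(𝔤). -/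

import Mathlib

set_option linter.unusedSectionVars false
namespace Kos
open MvPolynomial

section det
variable {A R : Type*} [CommRing A] [CommRing R] [Algebra A R] {n : Type*} [Fintype n] [DecidableEq n]

lemma der_prod (D : Derivation A R R) (s : Finset n) (f : n → R) :
    D (∏ i ∈ s, f i) = ∑ i ∈ s, (∏ j ∈ s.erase i, f j) * D (f i) := by
  induction s using Finset.induction_on with
  | empty => simp
  | insert a s ha ih =>
    rw [Finset.prod_insert ha, Derivation.leibniz, ih, Finset.sum_insert ha, Finset.erase_insert ha,
      smul_eq_mul, smul_eq_mul, add_comm, Finset.mul_sum]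
    congr 1
    apply Finset.sum_congr rfl
    intro i hi
    have : i ≠ a := fun h => ha (h ▸ hi)
    rw [Finset.erase_insert_of_ne this.symm, Finset.prod_insert (by simp [ha])]
    ring

lemma der_det (D : Derivation A R R) (N : Matrix n n R) :
    D N.det = ∑ i, (N.updateRow i (fun j => D (N i j))).det := by
  rw [← Matrix.det_transpose, Matrix.det_apply]
  simp_rw [fun i => (Matrix.det_transpose (N.updateRow i (fun j => D (N i j)))).symm, Matrix.det_apply]
  rw [Finset.sum_comm, map_sum]
  apply Finset.sum_congr rfl
  intro σ _
  rw [Units.smul_def, map_zsmul, der_prod, Finset.smul_sum]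
  apply Finset.sum_congr rfl
  intro i _
  rw [← Units.smul_def]
  congr 1
  rw [← Finset.mul_prod_erase _ _ (Finset.mem_univ i), mul_comm]
  congr 1
  · simp
  · apply Finset.prod_congr rfl
    intro j hj
    simp [Matrix.updateRow_ne (Finset.ne_of_mem_erase hj)]

lemma der_det' (D : Derivation A R R) (N : Matrix n n R) :
    D N.det = Matrix.trace (N.map D * N.adjugate) := by
  rw [der_det, Matrix.trace]
  apply Finset.sum_congr rfl
  intro i _
  rw [Matrix.diag_apply, Matrix.mul_apply, Matrix.det_eq_sum_mul_adjugate_row _ i]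
  apply Finset.sum_congr rfl
  intro j _
  simp [Matrix.adjugate_apply]

lemma der_det_mul (D : Derivation A R R) (N a : Matrix n n R) (h : N.map D = a * N) :
    D N.det = a.trace * N.det := by
  rw [der_det', h, Matrix.mul_assoc, Matrix.mul_adjugate]
  simp [mul_comm]

lemma der_det_comm (D : Derivation A R R) (N a : Matrix n n R) (h : N.map D = a * N - N * a) :
    D N.det = 0 := by
  rw [der_det', h, Matrix.sub_mul, Matrix.trace_sub, Matrix.mul_assoc, Matrix.mul_adjugate,
    Matrix.trace_mul_comm (N * a), ← Matrix.mul_assoc, Matrix.adjugate_mul]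
  simp 

end det
end Kos

namespace Kos
open MvPolynomial

section poly
variable {L : Type*} [LieRing L] [LieAlgebra ℂ L] [FiniteDimensional ℂ L]
variable {ι : Type*} [Fintype ι] [DecidableEq ι] (b : Module.Basis ι ℂ L)

lemma kf_inv (x y z : L) : killingForm ℂ L ⁅x, y⁆ z = killingForm ℂ L x ⁅y, z⁆ :=
  LieModule.traceForm_apply_lie_apply ℂ L L x y z

lemma kf_comm (x y : L) : killingForm ℂ L x y = killingForm ℂ L y x :=
  LieModule.traceForm_comm ℂ L L x y

lemma kf_inv' (x y z : L) : killingForm ℂ L ⁅x, y⁆ z = - killingForm ℂ L y ⁅x, z⁆ := by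
  rw [← lie_skew, map_neg, LinearMap.neg_apply, kf_inv]

noncomputable def linP : L →ₗ[ℂ] MvPolynomial ι ℂ := b.constr ℂ (fun i => X i)

lemma linP_b (i : ι) : linP b (b i) = X i := by simp [linP]

noncomputable def evp (v : L) : MvPolynomial ι ℂ →ₐ[ℂ] ℂ := aeval (fun i => killingForm ℂ L (b i) v)

lemma evp_X (v : L) (i : ι) : evp b v (X i) = killingForm ℂ L (b i) v := by simp [evp]

lemma evp_lin (v y : L) : evp b v (linP b y) = killingForm ℂ L y v := by
  have : (evp b v).toLinearMap ∘ₗ linP b = (killingForm ℂ L).flip v := by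
    apply b.ext; intro i; simp [linP_b, evp_X]
  exact LinearMap.congr_fun this y

noncomputable def DP (x : L) : Derivation ℂ (MvPolynomial ι ℂ) (MvPolynomial ι ℂ) :=
  mkDerivation ℂ (fun i => linP b ⁅x, b i⁆)

lemma DP_X (x : L) (i : ι) : DP b x (X i) = linP b ⁅x, b i⁆ := by simp [DP]

lemma DP_lin (x y : L) : DP b x (linP b y) = linP b ⁅x, y⁆ := by
  have : (DP b x).toLinearMap ∘ₗ linP b = linP b ∘ₗ (LieAlgebra.ad ℂ L x : L →ₗ[ℂ] L) := by
    apply b.ext; intro i; simp [linP_b, DP_X]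
  exact LinearMap.congr_fun this y

noncomputable def dP (u : L) : Derivation ℂ (MvPolynomial ι ℂ) (MvPolynomial ι ℂ) :=
  mkDerivation ℂ (fun i => C (killingForm ℂ L (b i) u))

lemma dP_X (x : L) (i : ι) : dP b x (X i) = C (killingForm ℂ L (b i) x) := by simp [dP]

lemma dP_lin (x y : L) : dP b x (linP b y) = C (killingForm ℂ L y x) := by
  have : (dP b x).toLinearMap ∘ₗ linP b = (Algebra.linearMap ℂ (MvPolynomial ι ℂ)) ∘ₗ
    ((killingForm ℂ L).flip x) := by
    apply b.ext; intro i; simp [linP_b, dP_X, algebraMap_eq]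
  exact LinearMap.congr_fun this y

lemma dP_add (u w : L) : dP b (u + w) = dP b u + dP b w := by
  apply derivation_ext; intro i; simp [dP_X]

lemma dP_smul (c : ℂ) (u : L) : dP b (c • u) = c • dP b u := by
  apply derivation_ext; intro i; simp [dP_X, smul_eq_C_mul]

lemma DP_add (u w : L) : DP b (u + w) = DP b u + DP b w := by
  apply derivation_ext; intro i; simp [DP_X]

lemma DP_smul (c : ℂ) (u : L) : DP b (c • u) = c • DP b u := by
  apply derivation_ext; intro i; simp [DP_X]

lemma ev_DP (v a : L) (s : MvPolynomial ι ℂ) :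
    evp b v (DP b a s) = - evp b v (dP b ⁅a, v⁆ s) := by
  induction s using MvPolynomial.induction_on with
  | C c => simp
  | add p q hp hq => simp [hp, hq]; ring
  | mul_X p i hp =>
    simp only [Derivation.leibniz, smul_eq_mul, map_add, map_mul, hp, DP_X, dP_X, evp_lin, evp_X, kf_inv']
    simp; ring

lemma dP_comm (u w : L) (s : MvPolynomial ι ℂ) : dP b u (dP b w s) = dP b w (dP b u s) := by
  have : ⁅dP b u, dP b w⁆ = 0 := by
    apply derivation_ext; intro i; simp [Derivation.commutator_apply, dP_X]
  have h := DFunLike.congr_fun this s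
  rw [Derivation.commutator_apply] at h
  exact sub_eq_zero.1 h

lemma dP_DP (u a : L) (s : MvPolynomial ι ℂ) :
    dP b u (DP b a s) = DP b a (dP b u s) - dP b ⁅a, u⁆ s := by
  have : ⁅dP b u, DP b a⁆ = - dP b ⁅a, u⁆ := by
    apply derivation_ext; intro i
    simp [Derivation.commutator_apply, dP_X, DP_X, dP_lin, kf_inv']
  have h := DFunLike.congr_fun this s
  rw [Derivation.commutator_apply] at h
  simp at h
  linear_combination h

/-- quadratic curve -/
noncomputable def curveP (v0 v1 v2 : L) : MvPolynomial ι ℂ →ₐ[ℂ] Polynomial ℂ :=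
  aeval (fun i => Polynomial.C (killingForm ℂ L (b i) v0) +
    Polynomial.C (killingForm ℂ L (b i) v1) * Polynomial.X +
    Polynomial.C (killingForm ℂ L (b i) v2) * Polynomial.X ^ 2)

lemma curveP_eval (v0 v1 v2 : L) (s : MvPolynomial ι ℂ) (c : ℂ) :
    (curveP b v0 v1 v2 s).eval c = evp b (v0 + c • v1 + c ^ 2 • v2) s := by
  have : (Polynomial.aeval c).comp (curveP b v0 v1 v2) = evp b (v0 + c • v1 + c ^ 2 • v2) := by
    apply MvPolynomial.algHom_ext; intro i
    simp [curveP, evp]; ring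
  have h := DFunLike.congr_fun this s
  simpa [Polynomial.coe_aeval_eq_eval] using h

lemma curveP_deriv (v0 v1 v2 : L) (s : MvPolynomial ι ℂ) (c : ℂ) :
    (Polynomial.derivative (curveP b v0 v1 v2 s)).eval c =
      evp b (v0 + c • v1 + c ^ 2 • v2) (dP b (v1 + (2 * c) • v2) s) := by
  induction s using MvPolynomial.induction_on with
  | C r => simp [curveP]
  | add p q hp hq => simp [hp, hq]
  | mul_X p i hp =>
    have h1 : (curveP b v0 v1 v2 (X i)) = Polynomial.C (killingForm ℂ L (b i) v0) +
    Polynomial.C (killingForm ℂ L (b i) v1) * Polynomial.X +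
    Polynomial.C (killingForm ℂ L (b i) v2) * Polynomial.X ^ 2 := by simp [curveP]
    simp only [Derivation.leibniz, smul_eq_mul, map_add, map_mul, evp_X, dP_X, Polynomial.derivative_mul,
      Polynomial.eval_add, Polynomial.eval_mul, hp, curveP_eval, h1]
    simp [evp]; ring

lemma line_deriv (v u : L) (s : MvPolynomial ι ℂ) :
    Polynomial.derivative (curveP b v u 0 s) = curveP b v u 0 (dP b u s) := by
  apply Polynomial.funext; intro c
  rw [curveP_deriv, curveP_eval]; simp

lemma line_zero (v u : L) (s : MvPolynomial ι ℂ)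
    (h : {t : ℂ | evp b (v + t • u) s ≠ 0}.Finite) : curveP b v u 0 s = 0 := by
  apply Polynomial.eq_zero_of_infinite_isRoot
  have : {x | (curveP b v u 0 s).IsRoot x} = {t : ℂ | evp b (v + t • u) s ≠ 0}ᶜ := by
    ext t; simp [Polynomial.IsRoot, curveP_eval]
  rw [this]
  exact h.infinite_compl

lemma line_d_zero (v u : L) (s : MvPolynomial ι ℂ)
    (h : {t : ℂ | evp b (v + t • u) s ≠ 0}.Finite) : evp b v (dP b u s) = 0 := by
  have h1 := line_deriv b v u s
  rw [line_zero b v u s h] at h1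
  have := curveP_eval b v u 0 (dP b u s) 0
  rw [← h1] at this
  simpa using this.symm

lemma taylor_zero (v u : L) (s : MvPolynomial ι ℂ)
    (h : ∀ k : ℕ, evp b v ((dP b u)^[k] s) = 0) : evp b (v + u) s = 0 := by
  have h1 : ∀ k : ℕ, Polynomial.derivative^[k] (curveP b v u 0 s) = curveP b v u 0 ((dP b u)^[k] s) := by
    intro k
    induction k with
    | zero => rfl
    | succ k ih => rw [Function.iterate_succ_apply', ih, line_deriv, Function.iterate_succ_apply']
  have h2 : curveP b v u 0 s = 0 := by
    ext k
    have h3 := curveP_eval b v u 0 ((dP b u)^[k] s) 0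
    rw [← h1] at h3
    simp [h] at h3
    rw [← Polynomial.coeff_zero_eq_eval_zero, Polynomial.coeff_iterate_derivative] at h3
    simp at h3
    simpa [Nat.descFactorial_self, Nat.factorial_ne_zero] using h3
  have h3 := curveP_eval b v u 0 s 1
  rw [h2] at h3
  simpa using h3.symm

lemma fold_span (T : Submodule ℂ L) (a : L) (hA : ∀ u ∈ T, ⁅a, u⁆ ∈ T) (s : MvPolynomial ι ℂ) (l : List L)
    (hl : ∀ u ∈ l, u ∈ T) :
    DP b a (l.foldr (fun u p => dP b u p) s) - l.foldr (fun u p => dP b u p) (DP b a s) ∈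
      Submodule.span ℂ {p | ∃ l' : List L, l'.length = l.length ∧ (∀ u ∈ l', u ∈ T) ∧
        p = l'.foldr (fun u p => dP b u p) s} := by
  induction l with
  | nil => simp
  | cons u l ih =>
    simp only [List.foldr_cons]
    have hu : u ∈ T := hl u (by simp)
    have hl' : ∀ u ∈ l, u ∈ T := fun w hw => hl w (by simp [hw])
    have h1 := ih hl'
    have h2 : DP b a (dP b u (l.foldr (fun u p => dP b u p) s)) -
        dP b u (l.foldr (fun u p => dP b u p) (DP b a s)) =
        dP b u (DP b a (l.foldr (fun u p => dP b u p) s) - l.foldr (fun u p => dP b u p) (DP b a s))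
        + dP b ⁅a, u⁆ (l.foldr (fun u p => dP b u p) s) := by
      rw [map_sub, dP_DP]; ring
    rw [h2]
    apply Submodule.add_mem
    · have h3 := Submodule.mem_map_of_mem (f := (dP b u).toLinearMap) h1
      rw [Submodule.map_span] at h3
      refine Submodule.span_mono ?_ h3
      rintro _ ⟨_, ⟨l', h4, h5, rfl⟩, rfl⟩
      refine ⟨u :: l', by simp [h4], ?_, rfl⟩
      intro w hw; rcases List.mem_cons.1 hw with rfl | hw
      · exact hu
      · exact h5 w hw
    · apply Submodule.subset_span
      refine ⟨⁅a, u⁆ :: l, by simp, ?_, rfl⟩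
      intro w hw; rcases List.mem_cons.1 hw with rfl | hw
      · exact hA u hu
      · exact hl' w hw

theorem lemV (T T0 A : Submodule ℂ L) (Y E : Set L) (hYE : Y ⊆ E)
    (hE : ∀ v ∈ E, ∀ u ∈ T, v + u ∈ E)
    (hA : ∀ a ∈ A, ∀ u ∈ T, ⁅a, u⁆ ∈ T)
    (hreg : ∀ y ∈ Y, ∀ u ∈ T, ∃ u0 ∈ T0, ∃ a ∈ A, u = u0 + ⁅a, y⁆)
    (hT0 : ∀ y ∈ Y, ∀ u ∈ T0, {t : ℂ | y + t • u ∉ Y}.Finite)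
    (s : MvPolynomial ι ℂ) (hD : ∀ a ∈ A, ∀ v ∈ E, evp b v (DP b a s) = 0)
    (h0 : ∀ y ∈ Y, evp b y s = 0) : ∀ y ∈ Y, ∀ u ∈ T, evp b (y + u) s = 0 := by
  have hEz : ∀ (p : MvPolynomial ι ℂ), (∀ v ∈ E, evp b v p = 0) → ∀ l : List L, (∀ u ∈ l, u ∈ T) →
      ∀ v ∈ E, evp b v (l.foldr (fun u p => dP b u p) p) = 0 := by
    intro p hp l
    induction l with
    | nil => intro _ v hv; exact hp v hv
    | cons u l ih =>
      intro hl v hv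
      simp only [List.foldr_cons]
      apply line_d_zero
      have ih' := ih (fun w hw => hl w (by simp [hw]))
      convert Set.finite_empty
      ext t
      simp only [ne_eq, Set.mem_setOf_eq, Set.mem_empty_iff_false, iff_false, not_not]
      exact ih' _ (hE v hv _ (T.smul_mem _ (hl u (by simp))))
  have key : ∀ k : ℕ, ∀ l : List L, l.length = k → (∀ u ∈ l, u ∈ T) → ∀ y ∈ Y,
      evp b y (l.foldr (fun u p => dP b u p) s) = 0 := by
    intro k
    induction k with
    | zero =>
      intro l hl _ y hy
      rw [List.length_eq_zero_iff.1 hl]; exact h0 y hy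
    | succ k ih =>
      intro l hl hlT y hy
      rcases l with _ | ⟨u, l⟩
      · simp at hl
      have hl' : l.length = k := by simpa using hl
      have hlT' : ∀ u ∈ l, u ∈ T := fun w hw => hlT w (by simp [hw])
      obtain ⟨u0, hu0, a, ha, hu⟩ := hreg y hy u (hlT u (by simp))
      simp only [List.foldr_cons]
      rw [hu, dP_add, Derivation.add_apply, map_add]
      have e1 : evp b y (dP b u0 (l.foldr (fun u p => dP b u p) s)) = 0 := by
        apply line_d_zero
        refine (hT0 y hy u0 hu0).subset ?_
        intro t ht ht'
        exact ht (ih l hl' hlT' _ ht')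
      have e2 : evp b y (DP b a (l.foldr (fun u p => dP b u p) s)) = 0 := by
        have h1 := fold_span b T a (hA a ha) s l hlT'
        have h2 : evp b y (DP b a (l.foldr (fun u p => dP b u p) s) -
            l.foldr (fun u p => dP b u p) (DP b a s)) = 0 := by
          have : Submodule.span ℂ {p | ∃ l' : List L, l'.length = l.length ∧ (∀ u ∈ l', u ∈ T) ∧
            p = l'.foldr (fun u p => dP b u p) s} ≤ LinearMap.ker (evp b y).toLinearMap := by
            rw [Submodule.span_le]
            rintro _ ⟨l', h3, h4, rfl⟩
            exact ih l' (h3.trans hl') h4 y hy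
          exact this h1
        rw [map_sub, hEz _ (hD a ha) l hlT' y (hYE hy), sub_zero] at h2
        exact h2
      rw [ev_DP, neg_eq_zero] at e2
      rw [e1, e2, add_zero]
  intro y hy u hu
  apply taylor_zero
  intro k
  have := key k (List.replicate k u) (by simp) (fun w hw => (List.eq_of_mem_replicate hw) ▸ hu) y hy
  have e : ∀ k : ℕ, (List.replicate k u).foldr (fun u p => dP b u p) s = (dP b u)^[k] s := by
    intro k
    induction k with
    | zero => rfl
    | succ k ih => rw [List.replicate_succ, List.foldr_cons, ih, Function.iterate_succ_apply']
  rw [← e]; exact this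

end poly
end Kos

namespace Kos
open MvPolynomial

section inv
variable {L : Type*} [LieRing L] [LieAlgebra ℂ L] [FiniteDimensional ℂ L]
variable {ι : Type*} [Fintype ι] [DecidableEq ι] (b : Module.Basis ι ℂ L)

def Inv : Subalgebra ℂ (MvPolynomial ι ℂ) where
  carrier := {p | ∀ x, DP b x p = 0}
  mul_mem' := by
    intro p q hp hq x
    simp [Derivation.leibniz, hp x, hq x]
  add_mem' := by
    intro p q hp hq x
    simp [hp x, hq x]
  algebraMap_mem' := by
    intro r x
    simp

lemma mem_Inv {p : MvPolynomial ι ℂ} : p ∈ Inv b ↔ ∀ x, DP b x p = 0 := Iff.rfl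

variable [LieAlgebra.IsKilling ℂ L]

lemma kf_nd : (killingForm ℂ L).Nondegenerate := LieAlgebra.IsKilling.killingForm_nondegenerate ℂ L

lemma kf_surj (φ : L →ₗ[ℂ] ℂ) : ∃ v : L, ∀ x, killingForm ℂ L v x = φ x := by
  have := (LinearMap.BilinForm.toDual (killingForm ℂ L) (kf_nd)).surjective φ
  obtain ⟨v, hv⟩ := this
  refine ⟨v, fun x => ?_⟩
  rw [← hv]; rfl

lemma evp_ext (s : MvPolynomial ι ℂ) (h : ∀ v, evp b v s = 0) : s = 0 := by
  apply MvPolynomial.funext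
  intro c
  obtain ⟨v, hv⟩ := kf_surj (b.constr ℂ c)
  have := h v
  have h2 : (fun i => killingForm ℂ L (b i) v) = c := by
    ext i; rw [kf_comm, hv]; simp
  rw [evp, h2] at this
  simpa [MvPolynomial.coe_aeval_eq_eval] using this

lemma exists_inv {N : Type*} [Fintype N] [DecidableEq N] (ρ : L →ₗ[ℂ] Matrix N N ℂ)
    (hρ : ∀ x y, ρ ⁅x, y⁆ = ρ x * ρ y - ρ y * ρ x) (k : ℕ) :
    ∃ p ∈ Inv b, ∀ v, evp b v p = (ρ v).charpoly.coeff k := by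
  have h1 : ∀ i j : N, ∃ θ : L, ∀ v, killingForm ℂ L θ v = ρ v i j := by
    intro i j
    obtain ⟨θ, hθ⟩ := kf_surj (Matrix.entryLinearMap ℂ ℂ i j ∘ₗ ρ)
    exact ⟨θ, fun v => by rw [hθ]; rfl⟩
  choose θ hθ using h1
  let M : Matrix N N (MvPolynomial ι ℂ) := Matrix.of fun i j => linP b (θ i j)
  have hM : ∀ v, M.map (evp b v) = ρ v := by
    intro v; ext i j; simp [M, evp_lin, hθ]
  have hMD : ∀ (x : L), M.map (DP b x) = - ((ρ x).map C * M - M * (ρ x).map C) := by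
    intro x; ext1 i j
    rw [← sub_eq_zero]
    apply evp_ext b
    intro v
    have e1 : evp b v ((((ρ x).map C * M - M * (ρ x).map C : Matrix N N (MvPolynomial ι ℂ))) i j) = (ρ x * ρ v - ρ v * ρ x) i j := by
      rw [← hM v]
      simp [Matrix.sub_apply, Matrix.mul_apply, map_sub, map_sum, evp]
    rw [map_sub, Matrix.neg_apply, map_neg, e1, ← hρ, Matrix.map_apply, ev_DP]
    simp [M, dP_lin, hθ, evp]
  refine ⟨M.charpoly.coeff k, ?_, ?_⟩
  · intro x
    have h2 : ∀ c : ℂ, DP b x (M.charpoly.eval (C c)) = 0 := by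
      intro c
      rw [Matrix.eval_charpoly]
      apply der_det_comm (DP b x) _ (-(ρ x).map C)
      have : (Matrix.scalar N (C c : MvPolynomial ι ℂ) - M).map (DP b x) = - M.map (DP b x) := by
        ext1 i j
        simp [Matrix.scalar_apply, Matrix.diagonal_apply, apply_ite]
      rw [this, hMD]
      have hc : (ρ x).map C * Matrix.scalar N (C c : MvPolynomial ι ℂ) = Matrix.scalar N (C c : MvPolynomial ι ℂ) * (ρ x).map C := by
        exact (Matrix.scalar_commute _ (fun _ => Commute.all _ _) _).eq.symm
      simp only [neg_mul, mul_neg, mul_sub, sub_mul, hc]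
      abel
    let Q : Polynomial (MvPolynomial ι ℂ) := ∑ j ∈ Finset.range (M.charpoly.natDegree + 1 + k),
      Polynomial.monomial j (DP b x (M.charpoly.coeff j))
    have hQ : Q = 0 := by
      apply Polynomial.eq_zero_of_infinite_isRoot
      apply (Set.infinite_range_of_injective (C_injective ι ℂ)).mono
      rintro _ ⟨c, rfl⟩
      have h3 := h2 c
      rw [Polynomial.eval_eq_sum_range' (n := M.charpoly.natDegree + 1 + k) (by omega)] at h3
      simp only [Set.mem_ofPred_eq, Polynomial.IsRoot, Q, Polynomial.eval_finsetSum, Polynomial.eval_monomial]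
      rw [← h3, map_sum]
      apply Finset.sum_congr rfl; intro j _
      rw [Derivation.leibniz, ← map_pow]; simp [mul_comm]
    have := congrArg (fun q => Polynomial.coeff q k) hQ
    simpa [Q, Polynomial.finsetSum_coeff, Polynomial.coeff_monomial] using this
  · intro v
    rw [← hM v]
    have := Matrix.charpoly_map M (evp b v : MvPolynomial ι ℂ →+* ℂ)
    have h2 : M.map (evp b v) = M.map ((evp b v : MvPolynomial ι ℂ →+* ℂ)) := rfl
    rw [h2, this, Polynomial.coeff_map]; rfl

noncomputable def adM : L →ₗ[ℂ] Matrix ι ι ℂ :=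
  (LinearMap.toMatrix b b).toLinearMap ∘ₗ (LieAlgebra.ad ℂ L : L →ₗ[ℂ] Module.End ℂ L)

lemma adM_lie (x y : L) : adM b ⁅x, y⁆ = adM b x * adM b y - adM b y * adM b x := by
  have h : LieAlgebra.ad ℂ L ⁅x, y⁆ = LieAlgebra.ad ℂ L x * LieAlgebra.ad ℂ L y -
      LieAlgebra.ad ℂ L y * LieAlgebra.ad ℂ L x := by
    ext z; simp
  have h2 : ∀ z, adM b z = LinearMap.toMatrix b b (LieAlgebra.ad ℂ L z) := fun z => rfl
  rw [h2, h2, h2, h, map_sub, LinearMap.toMatrix_mul, LinearMap.toMatrix_mul]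

lemma adM_charpoly (x : L) : (adM b x).charpoly = (LieAlgebra.ad ℂ L x).charpoly :=
  LinearMap.charpoly_toMatrix _ _

lemma chev_inj (H : LieSubalgebra ℂ L) [H.IsCartanSubalgebra] (p : MvPolynomial ι ℂ)
    (hp : p ∈ Inv b) (h : ∀ x ∈ H, evp b x p = 0) : p = 0 := by
  let Y : Set L := {x | ∃ hx : x ∈ H, ∀ α : LieModule.Weight ℂ H L, α.IsNonZero → α ⟨x, hx⟩ ≠ 0}
  have hY : Y.Nonempty := by
    obtain ⟨x, hx⟩ := Module.Dual.exists_forall_ne_zero_of_forall_exists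
      (fun α : {α : LieModule.Weight ℂ H L // α.IsNonZero} => (LieModule.Weight.toLinear ℂ H L α.1))
      (by
        rintro ⟨α, hα⟩
        by_contra hc
        push Not at hc
        exact hα (funext hc))
    exact ⟨x, x.2, fun α hα => hx ⟨α, hα⟩⟩
  obtain ⟨y, hy⟩ := hY
  have key := lemV b ⊤ H.toSubmodule ⊤ Y Set.univ (Set.subset_univ _) (fun _ _ _ _ => Set.mem_univ _)
    (fun _ _ _ _ => Submodule.mem_top) ?_ ?_ p (fun a _ v _ => by rw [hp a, map_zero])
    (fun y hy => h y hy.1)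
  · apply evp_ext b
    intro v
    have := key y hy (v - y) Submodule.mem_top
    simpa using this
  · rintro x ⟨hxH, hx⟩ u -
    have hu : u ∈ (⨆ χ : LieModule.Weight ℂ H L, LieModule.genWeightSpace L χ : LieSubmodule ℂ H L) := by
      rw [LieModule.iSup_genWeightSpace_eq_top']; trivial
    induction hu using LieSubmodule.iSup_induction' with
    | mem α u hu =>
      by_cases hα : α.IsZero
      · refine ⟨u, ?_, 0, trivial, by simp⟩
        rw [hα.eq] at hu
        have := LieAlgebra.rootSpace_zero_eq ℂ L H
        rw [show (LieModule.genWeightSpace L (0 : H → ℂ)) = LieAlgebra.rootSpace H 0 from rfl, this] at hu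
        exact hu
      · refine ⟨0, H.zero_mem, -((α ⟨x, hxH⟩)⁻¹ • u), trivial, ?_⟩
        have := LieAlgebra.IsKilling.lie_eq_smul_of_mem_rootSpace hu ⟨x, hxH⟩
        have h2 : ⁅x, u⁆ = α ⟨x, hxH⟩ • u := this
        rw [zero_add, neg_lie, lie_skew, lie_smul, h2, smul_smul, inv_mul_cancel₀ (hx α hα), one_smul]
    | zero => exact ⟨0, H.zero_mem, 0, trivial, by simp⟩
    | add u w _ _ hu hw =>
      obtain ⟨u0, h1, a, -, h2⟩ := hu
      obtain ⟨w0, h3, c, -, h4⟩ := hw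
      exact ⟨u0 + w0, H.add_mem h1 h3, a + c, trivial, by rw [h2, h4, add_lie]; abel⟩
  · rintro x ⟨hxH, hx⟩ u hu
    have : {t : ℂ | x + t • u ∉ Y} ⊆ ⋃ α : LieModule.Weight ℂ H L,
      {t : ℂ | α.IsNonZero ∧ α ⟨x, hxH⟩ + t * α ⟨u, hu⟩ = 0} := by
      intro t ht
      by_contra hc
      apply ht
      refine ⟨H.add_mem hxH (H.smul_mem _ hu), fun α hα h0 => hc ?_⟩
      simp only [Set.mem_iUnion]
      refine ⟨α, hα, ?_⟩
      have e1 : (⟨x + t • u, H.add_mem hxH (H.smul_mem _ hu)⟩ : H) = ⟨x, hxH⟩ + t • ⟨u, hu⟩ := rfl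
      rw [e1] at h0
      have h5 := map_add (LieModule.Weight.toLinear ℂ H L α) ⟨x, hxH⟩ (t • ⟨u, hu⟩)
      rw [map_smul] at h5
      exact h5.symm.trans h0
    refine (Set.finite_iUnion fun α => ?_).subset this
    apply Set.Subsingleton.finite
    rintro t ⟨hα, ht⟩ t' ⟨-, ht'⟩
    have hxα := hx α hα
    have hz : α ⟨u, hu⟩ ≠ 0 := by
      intro hz; rw [hz] at ht; simp at ht; exact hxα ht
    have : t * α ⟨u, hu⟩ = t' * α ⟨u, hu⟩ := by linear_combination ht - ht'
    exact mul_right_cancel₀ hz this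

lemma cartan_le_rank (H : LieSubalgebra ℂ L) [H.IsCartanSubalgebra] :
    Module.finrank ℂ H ≤ LieAlgebra.rank ℂ L := by
  by_contra hlt
  push Not at hlt
  let b := Module.finBasis ℂ L
  obtain ⟨p, hp, hpv⟩ := exists_inv b (adM b) (adM_lie b) (LieAlgebra.rank ℂ L)
  have h0 : p = 0 := by
    apply chev_inj b H p hp
    intro x hx
    rw [hpv, adM_charpoly]
    apply Polynomial.coeff_eq_zero_of_lt_natTrailingDegree
    rw [← LieAlgebra.finrank_engel]
    refine hlt.trans_le ?_
    apply Submodule.finrank_mono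
    intro y hy
    change y ∈ LieSubalgebra.engel ℂ x
    rw [LieSubalgebra.mem_engel_iff]
    refine ⟨1, ?_⟩
    have : ⁅(⟨x, hx⟩ : H), (⟨y, hy⟩ : H)⁆ = 0 := trivial_lie_zero _ _ _ _
    simpa using congrArg Subtype.val this
  obtain ⟨v, hv⟩ := LieAlgebra.exists_isRegular ℂ L
  rw [LieAlgebra.isRegular_iff_natTrailingDegree_charpoly_eq_rank] at hv
  have h1 := hpv v
  rw [h0, map_zero, adM_charpoly, ← hv] at h1
  have := Polynomial.trailingCoeff_nonzero_iff_nonzero.2 (LinearMap.charpoly_monic (LieAlgebra.ad ℂ L v)).ne_zero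
  exact this h1.symm
end inv
end Kos

namespace Kos
open MvPolynomial

section str
variable {L : Type*} [LieRing L] [LieAlgebra ℂ L] [FiniteDimensional ℂ L]

local notation "GE" => fun (h : L) (c : ℂ) => Module.End.maxGenEigenspace (LieAlgebra.ad ℂ L h) c

lemma ge_e {e h : L} (hhe : ⁅h, e⁆ = (2 : ℂ) • e) (c : ℂ) (x : L) (hx : x ∈ GE h c) :
    ⁅e, x⁆ ∈ GE h (c + 2) := by
  have key : ∀ k : ℕ, ∀ y : L, ((LieAlgebra.ad ℂ L h - algebraMap ℂ (Module.End ℂ L) (c + 2)) ^ k) ⁅e, y⁆ =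
      ⁅e, ((LieAlgebra.ad ℂ L h - algebraMap ℂ (Module.End ℂ L) c) ^ k) y⁆ := by
    intro k
    induction k with
    | zero => intro y; simp
    | succ k ih =>
      intro y
      rw [pow_succ, pow_succ, Module.End.mul_apply, Module.End.mul_apply, ← ih]
      congr 1
      simp only [LinearMap.sub_apply, LieAlgebra.ad_apply, Module.algebraMap_end_apply, lie_sub, lie_smul]
      rw [leibniz_lie h e y, hhe, smul_lie, add_smul]
      abel
  simp only [Module.End.mem_maxGenEigenspace] at hx ⊢
  obtain ⟨k, hk⟩ := hx
  refine ⟨k, ?_⟩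
  have := key k x
  simp only [Algebra.algebraMap_eq_smul_one] at this
  rw [this, hk, lie_zero]

lemma ker_ge {e h : L} (hhe : ⁅h, e⁆ = (2 : ℂ) • e) :
    Module.finrank ℂ (GE h 0) + Module.finrank ℂ (GE h 1) ≤
      Module.finrank ℂ (LinearMap.ker (LieAlgebra.ad ℂ L e)) := by
  set B : Submodule ℂ L := ⨆ j : ℕ, GE h ((j : ℂ) + 2) with hB
  have ind := Module.End.independent_maxGenEigenspace (LieAlgebra.ad ℂ L h)
  have d01 : Disjoint (GE h 0) (GE h 1) := ind.pairwiseDisjoint (by norm_num)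
  have dB : Disjoint (GE h 0 ⊔ GE h 1) B := by
    have := ind.disjoint_biSup_biSup (s := {0, 1}) (t := Set.range fun j : ℕ => (j : ℂ) + 2) ?_
    · rw [iSup_range] at this
      rw [iSup_insert, iSup_singleton] at this
      exact this
    · rw [Set.disjoint_left]
      rintro x hx ⟨j, rfl⟩
      rcases hx with hx | hx
      · have : ((j + 2 : ℕ) : ℂ) = ((0 : ℕ) : ℂ) := by push_cast; exact hx
        have := Nat.cast_injective this
        omega
      · have : ((j + 2 : ℕ) : ℂ) = ((1 : ℕ) : ℂ) := by push_cast; exact hx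
        have := Nat.cast_injective this
        omega
  let A : Submodule ℂ L := (GE h 0 ⊔ GE h 1) ⊔ B
  have hmap : ∀ x ∈ A, LieAlgebra.ad ℂ L e x ∈ B := by
    intro x hx
    have hle : A ≤ B.comap (LieAlgebra.ad ℂ L e) := by
      refine sup_le (sup_le ?_ ?_) (iSup_le fun j => ?_)
      · intro x hx
        exact Submodule.mem_iSup_of_mem 0 (by simpa using ge_e hhe 0 x hx)
      · intro x hx
        exact Submodule.mem_iSup_of_mem 1 (by simpa using ge_e hhe 1 x hx)
      · intro x hx
        refine Submodule.mem_iSup_of_mem (j + 2) ?_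
        have := ge_e hhe _ x hx
        simpa using this
    exact hle hx
  let g : A →ₗ[ℂ] B := (LieAlgebra.ad ℂ L e : L →ₗ[ℂ] L).restrict hmap
  have h1 := LinearMap.finrank_range_add_finrank_ker g
  have h2 : Module.finrank ℂ (LinearMap.range g) ≤ Module.finrank ℂ B := Submodule.finrank_le _
  have h3 : Module.finrank ℂ A = Module.finrank ℂ (GE h 0) + Module.finrank ℂ (GE h 1) + Module.finrank ℂ B := by
    have e1 := Submodule.finrank_sup_add_finrank_inf_eq (GE h 0 ⊔ GE h 1) B
    have e2 := Submodule.finrank_sup_add_finrank_inf_eq (GE h 0) (GE h 1)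
    rw [dB.eq_bot] at e1
    rw [d01.eq_bot] at e2
    simp at e1 e2
    simp only [A]
    omega
  have h4 : Module.finrank ℂ (LinearMap.ker g) ≤ Module.finrank ℂ (LinearMap.ker (LieAlgebra.ad ℂ L e)) := by
    have : (LinearMap.ker g).map A.subtype ≤ LinearMap.ker (LieAlgebra.ad ℂ L e) := by
      rintro _ ⟨x, hx, rfl⟩
      have : g x = 0 := hx
      simpa [g] using congrArg Subtype.val this
    rw [← Submodule.finrank_map_subtype_eq A (LinearMap.ker g)]
    exact Submodule.finrank_mono this
  omega

lemma reg_cartan [LieAlgebra.IsKilling ℂ L] {e h : L} (hhe : ⁅h, e⁆ = (2 : ℂ) • e)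
    (H : LieSubalgebra ℂ L) [H.IsCartanSubalgebra]
    (hreg : Module.finrank ℂ (LinearMap.ker (LieAlgebra.ad ℂ L e)) = Module.finrank ℂ H) :
    (LieSubalgebra.engel ℂ h).IsCartanSubalgebra ∧ ∀ x : L, ⁅h, x⁆ = x → x = 0 := by
  have h1 := ker_ge hhe
  have h2 := cartan_le_rank H
  have h3 := LieAlgebra.rank_le_finrank_engel ℂ h
  have h4 : Module.finrank ℂ (LieSubalgebra.engel ℂ h) = Module.finrank ℂ (GE h 0) := rfl
  simp only at h1 h4
  constructor
  · have hr : Module.finrank ℂ (LieSubalgebra.engel ℂ h) = LieAlgebra.rank ℂ L := by omega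
    refine ⟨?_, LieSubalgebra.normalizer_engel _ _⟩
    apply LieSubalgebra.isNilpotent_of_forall_le_engel
    intro y hy
    set Ex : {LieSubalgebra.engel ℂ z | z ∈ LieSubalgebra.engel ℂ h} :=
      ⟨LieSubalgebra.engel ℂ h, h, LieSubalgebra.self_mem_engel _ _, rfl⟩
    suffices IsBot Ex from @this ⟨LieSubalgebra.engel ℂ y, y, hy, rfl⟩
    apply LieAlgebra.engel_isBot_of_isMin (Cardinal.natCast_le_aleph0.trans <| Cardinal.infinite_iff.mp inferInstance)
      (LieSubalgebra.engel ℂ h) Ex le_rfl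
    rintro ⟨_, y, hy, rfl⟩ hyx
    suffices Module.finrank ℂ (LieSubalgebra.engel ℂ h) ≤ Module.finrank ℂ (LieSubalgebra.engel ℂ y) by
      suffices LieSubalgebra.engel ℂ y = LieSubalgebra.engel ℂ h from this.ge
      apply LieSubalgebra.toSubmodule_injective
      exact Submodule.eq_of_le_of_finrank_le hyx this
    rw [hr]
    apply LieAlgebra.rank_le_finrank_engel
  · intro x hx
    have h5 : Module.finrank ℂ (Module.End.maxGenEigenspace (LieAlgebra.ad ℂ L h) 1) = 0 := by omega
    rw [Submodule.finrank_eq_zero] at h5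
    have : x ∈ Module.End.maxGenEigenspace (LieAlgebra.ad ℂ L h) 1 := by
      rw [Module.End.mem_maxGenEigenspace]
      exact ⟨1, by simp [hx]⟩
    rw [h5] at this
    exact this

lemma eig_even {e h f : L} (t : IsSl2Triple h e f) (hnil : IsNilpotent (LieAlgebra.ad ℂ L e))
    (h1 : ∀ x : L, ⁅h, x⁆ = x → x = 0) (c : ℂ) (x : L) (hx0 : x ≠ 0) (hx : ⁅h, x⁆ = c • x) :
    ∃ n : ℤ, c = 2 * n := by
  obtain ⟨N, hN⟩ := hnil
  have hex : ∃ k : ℕ, ((LieModule.toEnd ℂ L L e) ^ k) x = 0 := ⟨N, by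
    change ((LieAlgebra.ad ℂ L e) ^ N) x = 0
    rw [hN]; rfl⟩
  obtain ⟨k, hk1, hk2⟩ := Nat.exists_not_and_succ_of_not_zero_of_exists (p := fun k =>
    ((LieModule.toEnd ℂ L L e) ^ k) x = 0) (by simpa using hx0) hex
  have P : t.HasPrimitiveVectorWith (((LieModule.toEnd ℂ L L e) ^ k) x) (c + 2 * k) :=
    { ne_zero := hk1
      lie_h := t.lie_h_pow_toEnd_e hx k
      lie_e := by rwa [IsSl2Triple.lie_e_pow_toEnd_e k] }
  obtain ⟨r, hr⟩ := P.exists_nat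
  rcases Nat.even_or_odd' r with ⟨q, hq | hq⟩
  · refine ⟨(q : ℤ) - k, ?_⟩
    rw [hq] at hr
    push_cast at hr ⊢
    linear_combination hr
  · exfalso
    have hne := P.pow_toEnd_f_ne_zero_of_eq_nat hr (i := q) (by omega)
    apply hne
    apply h1
    rw [P.lie_h_pow_toEnd_f, hr, hq]
    have : (((2 * q + 1 : ℕ) : ℂ) - 2 * q) = 1 := by push_cast; ring
    rw [this, one_smul]

lemma eig_inj {e h f : L} (t : IsSl2Triple h e f) (n : ℤ) (hn : n < 0)
    (x : L) (hx : ⁅h, x⁆ = (2 * n : ℂ) • x) (hex : ⁅e, x⁆ = 0) : x = 0 := by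
  by_contra hx0
  have P : t.HasPrimitiveVectorWith x (2 * n : ℂ) := ⟨hx0, hx, hex⟩
  obtain ⟨r, hr⟩ := P.exists_nat
  have : 2 * n = r := by exact_mod_cast hr
  omega
end str
end Kos

namespace Kos
open MvPolynomial

section str
variable {L : Type*} [LieRing L] [LieAlgebra ℂ L] [FiniteDimensional ℂ L] [LieAlgebra.IsKilling ℂ L]

lemma exists_wbasis (T : LieSubalgebra ℂ L) [T.IsCartanSubalgebra] (δ : LieModule.Weight ℂ T L → ℤ) :
    ∃ (n : ℕ) (b : Module.Basis (Fin n) ℂ L) (α : Fin n → LieModule.Weight ℂ T L),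
      (∀ i, b i ∈ LieAlgebra.rootSpace T (α i)) ∧
      (∀ i j, α i = α j → (α i).IsNonZero → i = j) ∧ Antitone (fun i => δ (α i)) := by
  classical
  have hint : DirectSum.IsInternal (fun α : LieModule.Weight ℂ T L => (LieAlgebra.rootSpace T α).toSubmodule) := by
    apply DirectSum.isInternal_submodule_of_iSupIndep_of_iSup_eq_top
    · exact LieSubmodule.iSupIndep_toSubmodule.2 (LieModule.iSupIndep_genWeightSpace' ℂ T L)
    · have := LieModule.iSup_genWeightSpace_eq_top' ℂ T L
      rw [← LieSubmodule.toSubmodule_inj, LieSubmodule.iSup_toSubmodule] at this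
      exact this
  let b0 := hint.collectedBasis (fun α => Module.finBasis ℂ (LieAlgebra.rootSpace T α).toSubmodule)
  let κ := (Σ α : LieModule.Weight ℂ T L, Fin (Module.finrank ℂ (LieAlgebra.rootSpace T α).toSubmodule))
  let e0 := Fintype.equivFin κ
  let g : Fin (Fintype.card κ) → ℤ := fun i => - δ (e0.symm i).1
  let σ := Tuple.sort g
  let e1 : κ ≃ Fin (Fintype.card κ) := e0.trans σ.symm
  refine ⟨Fintype.card κ, b0.reindex e1, fun i => (e1.symm i).1, ?_, ?_, ?_⟩
  · intro i
    rw [Module.Basis.reindex_apply]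
    exact hint.collectedBasis_mem _ _
  · have key : ∀ p q : κ, p.1 = q.1 → p.1.IsNonZero → p = q := by
      rintro ⟨a, x⟩ ⟨a', y⟩ hij hnz
      dsimp only at hij hnz
      subst hij
      have h1 : Module.finrank ℂ (LieAlgebra.rootSpace T a).toSubmodule = 1 :=
        LieAlgebra.IsKilling.finrank_rootSpace_eq_one a hnz
      have : x = y := by
        have hx := x.2; have hy := y.2
        apply Fin.ext; omega
      rw [this]
    intro i j hij hnz
    exact e1.symm.injective (key _ _ hij hnz)
  · intro i j hij
    have := Tuple.monotone_sort g hij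
    simp only [Function.comp, g] at this
    simpa [e1, σ, g] using this

structure RD (L : Type*) [LieRing L] [LieAlgebra ℂ L] [FiniteDimensional ℂ L] [LieAlgebra.IsKilling ℂ L]
    (e h : L) where
  n : ℕ
  b : Module.Basis (Fin n) ℂ L
  T : LieSubalgebra ℂ L
  cart : T.IsCartanSubalgebra
  wt : Fin n → Module.Dual ℂ T
  d : Fin n → ℤ
  anti : Antitone d
  hT : h ∈ T
  bT : ∀ i, d i = 0 → b i ∈ T
  lieT : ∀ (x : T) i, ⁅(x : L), b i⁆ = wt i x • b i
  wth : ∀ i, wt i ⟨h, hT⟩ = 2 * (d i : ℂ)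
  wt0 : ∀ i, d i = 0 → wt i = 0
  sep : ∀ x : T, (∀ i, wt i x = 0) → x = 0
  hhe : ⁅h, e⁆ = (2 : ℂ) • e
  simple : ∀ i, d i = 1 → ∃ (f : L) (hi : T), (∀ x : T, ⁅(x : L), f⁆ = -(wt i x • f)) ∧ ⁅f, e⁆ = -(hi : L) ∧ wt i hi = 2
  decomp : ∀ i, 2 ≤ d i → ∃ j k, d j = 1 ∧ d k = d i - 1 ∧ wt i = wt j + wt k
  neg : ∀ i, ∃ k, wt k = - wt i ∧ d k = - d i


theorem exists_RD {e h f : L} (t : IsSl2Triple h e f) (hnil : IsNilpotent (LieAlgebra.ad ℂ L e))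
    (hc : (LieSubalgebra.engel ℂ h).IsCartanSubalgebra) (h1 : ∀ x : L, ⁅h, x⁆ = x → x = 0) :
    Nonempty (RD L e h) := by
  classical
  obtain ⟨T, hTdef⟩ : ∃ T, T = LieSubalgebra.engel ℂ h := ⟨_, rfl⟩
  rw [← hTdef] at hc
  have hT : h ∈ T := hTdef ▸ LieSubalgebra.self_mem_engel ℂ h
  have hTe : ∀ x : L, ⁅h, x⁆ = 0 → x ∈ T := by
    intro x hx
    rw [hTdef, LieSubalgebra.mem_engel_iff]
    exact ⟨1, by simpa using hx⟩
  have habel : ∀ x y : L, x ∈ T → y ∈ T → ⁅x, y⁆ = 0 := by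
    intro x y hx hy
    have : ⁅(⟨x, hx⟩ : T), (⟨y, hy⟩ : T)⁆ = 0 := trivial_lie_zero _ _ _ _
    simpa using congrArg Subtype.val this
  have hδ : ∀ α : LieModule.Weight ℂ T L, ∃ n : ℤ, α ⟨h, hT⟩ = 2 * n := by
    intro α
    obtain ⟨x, hx, hx0⟩ := α.exists_ne_zero
    exact eig_even t hnil h1 _ x hx0 (LieAlgebra.IsKilling.lie_eq_smul_of_mem_rootSpace hx ⟨h, hT⟩)
  choose δ hδ using hδ
  obtain ⟨n, b, α, hb, hinj, hanti⟩ := exists_wbasis T δ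
  let wt : Fin n → Module.Dual ℂ T := fun i => LieModule.Weight.toLinear ℂ T L (α i)
  let d : Fin n → ℤ := fun i => δ (α i)
  have lieT : ∀ (x : T) i, ⁅(x : L), b i⁆ = wt i x • b i := fun x i =>
    LieAlgebra.IsKilling.lie_eq_smul_of_mem_rootSpace (hb i) x
  have wth : ∀ i, wt i ⟨h, hT⟩ = 2 * (d i : ℂ) := fun i => hδ (α i)
  have bT : ∀ i, d i = 0 → b i ∈ T := by
    intro i hi
    apply hTe
    have := lieT ⟨h, hT⟩ i
    rw [wth, hi] at this
    simpa using this
  have wt0 : ∀ i, d i = 0 → wt i = 0 := by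
    intro i hi
    ext x
    have := lieT x i
    rw [habel x (b i) x.2 (bT i hi)] at this
    simpa [b.ne_zero i] using this.symm
  have wtd : ∀ i j, wt i = wt j → d i = d j := by
    intro i j hij
    have h2 := wth i
    rw [hij, wth j] at h2
    have : (d j : ℂ) = d i := mul_left_cancel₀ two_ne_zero h2
    exact_mod_cast this.symm
  have wtinj : ∀ i j, wt i = wt j → d i ≠ 0 → i = j := by
    intro i j hij hdi
    apply hinj
    · apply LieModule.Weight.ext
      intro x; exact LinearMap.congr_fun hij x
    · intro h0
      apply hdi
      have h2 := wth i
      have h3 : wt i ⟨h, hT⟩ = 0 := by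
        change α i ⟨h, hT⟩ = 0
        rw [h0.eq]; rfl
      rw [h3] at h2
      have : (d i : ℂ) = 0 := by simpa using h2.symm
      exact_mod_cast this
  have reprT : ∀ (x : T) (y : L) i, b.repr ⁅(x : L), y⁆ i = wt i x * b.repr y i := by
    intro x y i
    conv_lhs => rw [← b.sum_repr y]
    simp only [lie_sum, lie_smul, lieT, map_sum, map_smul, Finsupp.coe_finsetSum, Finset.sum_apply,
      Finsupp.smul_apply, b.repr_self, smul_eq_mul, Finsupp.single_apply]
    rw [Finset.sum_eq_single i]
    · simp; ring
    · intro j _ hj; simp [hj]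
    · simp
  have reprW : ∀ (φ : Module.Dual ℂ T) (y : L), (∀ x : T, ⁅(x : L), y⁆ = φ x • y) → ∀ i, b.repr y i ≠ 0 → wt i = φ := by
    intro φ y hy i hi
    ext x
    have := reprT x y i
    rw [hy x] at this
    simp only [map_smul, Finsupp.smul_apply, smul_eq_mul] at this
    exact (mul_right_cancel₀ hi this).symm
  have reprh : ∀ (m : ℤ) (y : L), ⁅h, y⁆ = (2 * m : ℂ) • y → ∀ i, b.repr y i ≠ 0 → d i = m := by
    intro m y hy i hi
    have := reprT ⟨h, hT⟩ y i
    simp only at this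
    rw [hy] at this
    simp only [map_smul, Finsupp.smul_apply, smul_eq_mul, wth] at this
    have h2 := mul_right_cancel₀ hi this
    have : (m : ℂ) = d i := mul_left_cancel₀ two_ne_zero h2
    exact_mod_cast this.symm
  have lieh : ∀ i, ⁅h, b i⁆ = (2 * (d i : ℂ)) • b i := by
    intro i; rw [← wth]; exact lieT ⟨h, hT⟩ i
  have hhe : ⁅h, e⁆ = (2 : ℂ) • e := t.lie_h_e_smul ℂ
  have reprE : ∀ i, b.repr e i ≠ 0 → d i = 1 := reprh 1 e (by rw [hhe]; simp)
  have reprEb : ∀ k i, b.repr ⁅e, b k⁆ i ≠ 0 → d i = d k + 1 := by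
    intro k
    apply reprh
    rw [leibniz_lie, hhe, lieh, smul_lie, lie_smul, ← add_smul]
    push_cast; ring_nf
  have hbe : ∀ j k i, b.repr ⁅b j, b k⁆ i ≠ 0 → wt i = wt j + wt k := by
    intro j k
    apply reprW
    intro x
    rw [leibniz_lie, lieT, lieT, smul_lie, lie_smul, ← add_smul]; rfl
  have key : ∀ i, 1 ≤ d i → ∃ j k, d j = 1 ∧ b.repr e j ≠ 0 ∧ wt i = wt j + wt k := by
    intro i hi
    have hmem : b i ∈ LinearMap.range (LieAlgebra.ad ℂ L e) := by
      by_contra hmem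
      obtain ⟨φ, hφ, hφ2⟩ := Submodule.exists_le_ker_of_notMem hmem
      obtain ⟨v, hv⟩ := kf_surj φ
      have hev : ⁅e, v⁆ = 0 := by
        have : ∀ y, killingForm ℂ L ⁅e, v⁆ y = 0 := by
          intro y
          rw [kf_inv', hv]
          have : φ ⁅e, y⁆ = 0 := hφ2 ⟨y, rfl⟩
          rw [this, neg_zero]
        exact kf_nd.1 _ this
      let v' := ∑ k ∈ Finset.univ.filter (fun k => d k = - d i), b.repr v k • b k
      have hv' : v' = 0 := by
        apply eig_inj t (- d i) (by omega)
        · simp only [v', lie_sum, lie_smul, lieh, Finset.smul_sum]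
          apply Finset.sum_congr rfl
          intro k hk
          rw [(Finset.mem_filter.1 hk).2, smul_comm]
        · apply b.repr.injective
          ext l
          rw [map_zero, Finsupp.zero_apply]
          simp only [v', lie_sum, lie_smul, map_sum, map_smul, Finsupp.coe_finsetSum, Finset.sum_apply,
            Finsupp.smul_apply]
          by_cases hl : d l = - d i + 1
          · have h3 : b.repr ⁅e, v⁆ l = 0 := by rw [hev]; simp
            rw [← b.sum_repr v] at h3
            simp only [lie_sum, lie_smul, map_sum, map_smul, Finsupp.coe_finsetSum, Finset.sum_apply,
              Finsupp.smul_apply] at h3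
            rw [← h3]
            apply Finset.sum_subset (Finset.subset_univ _)
            intro k _ hk
            have hk' : d k ≠ - d i := by simpa using hk
            have : b.repr ⁅e, b k⁆ l = 0 := by
              by_contra hne
              have := reprEb k l hne
              omega
            rw [this, smul_zero]
          · apply Finset.sum_eq_zero
            intro k hk
            have hk' := (Finset.mem_filter.1 hk).2
            have : b.repr ⁅e, b k⁆ l = 0 := by
              by_contra hne
              have := reprEb k l hne
              omega
            rw [this, smul_zero]
      apply hφ
      rw [← hv]
      have hκ : ∀ k, d k ≠ - d i → killingForm ℂ L (b k) (b i) = 0 := by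
        intro k hk
        have h4 := kf_inv' h (b k) (b i)
        rw [lieh, lieh, map_smul, map_smul, LinearMap.smul_apply] at h4
        have h5 : (2 * ((d k + d i : ℤ) : ℂ)) * killingForm ℂ L (b k) (b i) = 0 := by
          simp only [smul_eq_mul] at h4
          push_cast; linear_combination h4
        have h6 : (2 * ((d k + d i : ℤ) : ℂ)) ≠ 0 := by
          apply mul_ne_zero two_ne_zero
          exact_mod_cast (by omega : d k + d i ≠ 0)
        exact (mul_eq_zero.1 h5).resolve_left h6
      have : killingForm ℂ L v (b i) = killingForm ℂ L v' (b i) := by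
        conv_lhs => rw [← b.sum_repr v]
        simp only [v', map_sum, map_smul, LinearMap.sum_apply, LinearMap.smul_apply]
        symm
        apply Finset.sum_subset (Finset.subset_univ _)
        intro k _ hk
        rw [hκ k (by simpa using hk), smul_zero]
      rw [this, hv']; simp
    obtain ⟨y, hy⟩ := hmem
    have h2 : b.repr ⁅e, y⁆ i ≠ 0 := by
      rw [show ⁅e, y⁆ = b i from hy]; simp
    rw [← b.sum_repr e, ← b.sum_repr y] at h2
    simp only [lie_sum, sum_lie, lie_smul, smul_lie, map_sum, map_smul, Finsupp.coe_finsetSum, Finset.sum_apply,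
            Finsupp.smul_apply] at h2
    obtain ⟨k, -, hk⟩ := Finset.exists_ne_zero_of_sum_ne_zero h2
    obtain ⟨j, -, hj⟩ := Finset.exists_ne_zero_of_sum_ne_zero (right_ne_zero_of_smul hk)
    have hj1 : b.repr e j ≠ 0 := by intro h0; apply hj; simp [h0]
    refine ⟨j, k, reprE j hj1, hj1, hbe j k i ?_⟩
    intro h0; apply hj; simp [h0]
  have dadd : ∀ i j k, wt i = wt j + wt k → d i = d j + d k := by
    intro i j k hijk
    have h2 := wth i
    rw [hijk, LinearMap.add_apply, wth j, wth k, ← mul_add] at h2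
    have := mul_left_cancel₀ two_ne_zero h2
    exact_mod_cast this.symm
  refine ⟨⟨n, b, T, hc, wt, d, hanti, hT, bT, lieT, wth, wt0, ?_, hhe, ?_, ?_, ?_⟩⟩
  · intro x hx
    have h2 : LieAlgebra.ad ℂ L (x : L) = 0 := by
      apply b.ext; intro i
      rw [LieAlgebra.ad_apply, lieT, hx, zero_smul]; rfl
    apply Subtype.ext
    apply kf_nd.1
    intro y
    rw [killingForm_apply_apply, h2]; simp
  · intro i hi
    have hnz : (α i).IsNonZero := by
      intro h0
      have h2 := wth i
      have h3 : wt i ⟨h, hT⟩ = 0 := by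
        change α i ⟨h, hT⟩ = 0
        rw [h0.eq]; rfl
      rw [h3, hi] at h2
      norm_num at h2
    obtain ⟨h', e', f', t', he', hf'⟩ := LieAlgebra.IsKilling.exists_isSl2Triple_of_weight_isNonZero hnz
    have hh' := t'.h_eq_coroot hnz he' hf'
    have lief : ∀ x : T, ⁅(x : L), f'⁆ = -(wt i x • f') := by
      intro x
      have := LieAlgebra.IsKilling.lie_eq_smul_of_mem_rootSpace hf' x
      rw [← neg_smul]
      exact this
    have he1 : e' = b.repr e' i • b i := by
      conv_lhs => rw [← b.sum_repr e']
      rw [Finset.sum_eq_single i]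
      · intro j _ hj
        have : b.repr e' j = 0 := by
          by_contra hne
          apply hj
          have := reprW (wt i) e' (fun x => LieAlgebra.IsKilling.lie_eq_smul_of_mem_rootSpace he' x) j hne
          exact (wtinj i j this.symm (by omega)).symm
        rw [this, zero_smul]
      · simp
    set c := b.repr e' i with hcdef
    have hc0 : c ≠ 0 := by
      intro h0; rw [h0, zero_smul] at he1; exact t'.e_ne_zero he1
    have hε : b.repr e i ≠ 0 := by
      obtain ⟨j, k, hj, hj2, hjk⟩ := key i (by omega)
      have := dadd _ _ _ hjk
      have hk : wt k = 0 := wt0 k (by omega)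
      rw [hk, add_zero] at hjk
      rw [wtinj i j hjk (by omega)]; exact hj2
    set ε := b.repr e i with hεdef
    refine ⟨(c / ε) • f', LieAlgebra.IsKilling.coroot (α i), ?_, ?_, ?_⟩
    · intro x
      rw [lie_smul, lief, smul_neg, smul_comm]
    · rw [← hh']
      conv_lhs => rw [← b.sum_repr e]
      rw [lie_sum, Finset.sum_eq_single i]
      · rw [← hεdef, lie_smul, smul_lie, smul_smul]
        have h5 : ⁅f', e'⁆ = - h' := by rw [← lie_skew, t'.lie_e_f]
        rw [he1, lie_smul] at h5
        rw [← h5]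
        congr 1
        field_simp
      · intro j _ hj
        by_cases hj0 : b.repr e j = 0
        · simp [hj0]
        have hdj := reprE j hj0
        suffices ⁅f', b j⁆ = 0 by rw [lie_smul, smul_lie, this, smul_zero, smul_zero]
        by_contra hne
        have hz : ∀ x : T, ⁅(x : L), ⁅f', b j⁆⁆ = (wt j x - wt i x) • ⁅f', b j⁆ := by
          intro x
          rw [leibniz_lie, lief, lieT, lie_smul, neg_lie, smul_lie, sub_smul]; abel
        have hzT : ⁅f', b j⁆ ∈ T := by
          apply hTe
          have := hz ⟨h, hT⟩
          rw [wth, wth, hi, hdj, sub_self, zero_smul] at this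
          exact this
        apply hj
        apply wtinj j i _ (by omega)
        ext x
        have h7 := hz x
        rw [habel _ _ x.2 hzT] at h7
        have := (smul_eq_zero.1 h7.symm).resolve_right hne
        exact sub_eq_zero.1 this
      · simp
    · exact LieAlgebra.IsKilling.root_apply_coroot hnz
  · intro i hi
    obtain ⟨j, k, hj, -, hjk⟩ := key i (by omega)
    have := dadd _ _ _ hjk
    exact ⟨j, k, hj, by omega, hjk⟩
  · intro i
    have hex : ∃ k, killingForm ℂ L (b i) (b k) ≠ 0 := by
      by_contra hno
      push Not at hno
      apply b.ne_zero i
      apply kf_nd.1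
      intro y
      rw [← b.sum_repr y, map_sum]
      apply Finset.sum_eq_zero
      intro k _
      rw [map_smul, hno k, smul_zero]
    obtain ⟨k, hk⟩ := hex
    have hw : wt k = - wt i := by
      ext x
      have h4 := kf_inv' (x : L) (b i) (b k)
      rw [lieT, lieT, map_smul, map_smul, LinearMap.smul_apply] at h4
      simp only [smul_eq_mul] at h4
      rw [← neg_mul] at h4
      have := mul_right_cancel₀ hk h4
      rw [LinearMap.neg_apply, this, neg_neg]
    refine ⟨k, hw, ?_⟩
    have h2 := wth k
    rw [hw, LinearMap.neg_apply, wth i, ← mul_neg] at h2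
    have := mul_left_cancel₀ two_ne_zero h2
    exact_mod_cast this.symm

end str
end Kos

namespace Kos
open MvPolynomial

namespace RD
variable {L : Type*} [LieRing L] [LieAlgebra ℂ L] [FiniteDimensional ℂ L] [LieAlgebra.IsKilling ℂ L]
variable {e h : L} (R : RD L e h)

lemma habel (x y : L) (hx : x ∈ R.T) (hy : y ∈ R.T) : ⁅x, y⁆ = 0 := by
  have := R.cart
  have : ⁅(⟨x, hx⟩ : R.T), (⟨y, hy⟩ : R.T)⁆ = 0 := trivial_lie_zero _ _ _ _
  simpa using congrArg Subtype.val this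

lemma reprT (x : R.T) (y : L) (i) : R.b.repr ⁅(x : L), y⁆ i = R.wt i x * R.b.repr y i := by
  conv_lhs => rw [← R.b.sum_repr y]
  simp only [lie_sum, lie_smul, lieT, map_sum, map_smul, Finsupp.coe_finsetSum, Finset.sum_apply,
    Finsupp.smul_apply, R.b.repr_self, smul_eq_mul, Finsupp.single_apply]
  rw [Finset.sum_eq_single i]
  · simp; ring
  · intro j _ hj; simp [hj]
  · simp

lemma reprh (m : ℤ) (y : L) (hy : ⁅h, y⁆ = (2 * m : ℂ) • y) (i) (hi : R.b.repr y i ≠ 0) : R.d i = m := by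
  have := R.reprT ⟨h, R.hT⟩ y i
  simp only at this
  rw [hy] at this
  simp only [map_smul, Finsupp.smul_apply, smul_eq_mul, wth] at this
  have h2 := mul_right_cancel₀ hi this
  have : (m : ℂ) = R.d i := mul_left_cancel₀ two_ne_zero h2
  exact_mod_cast this.symm

lemma lieh (i) : ⁅h, R.b i⁆ = (2 * (R.d i : ℂ)) • R.b i := by
  rw [← wth]; exact R.lieT ⟨h, R.hT⟩ i

lemma repr_bb (j k i) (hi : R.b.repr ⁅R.b j, R.b k⁆ i ≠ 0) : R.d i = R.d j + R.d k := by
  refine R.reprh _ _ ?_ i hi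
  rw [leibniz_lie, lieh, lieh, smul_lie, lie_smul, ← add_smul]
  push_cast; ring_nf

lemma repr_e (i) (hi : R.b.repr e i ≠ 0) : R.d i = 1 := R.reprh 1 e (by rw [R.hhe]; simp) i hi

lemma repr_t (x : L) (hx : x ∈ R.T) (i) (hi : R.b.repr x i ≠ 0) : R.d i = 0 :=
  R.reprh 0 x (by rw [R.habel h x R.hT hx]; simp) i hi

lemma repr_be (k i) (hi : R.b.repr ⁅R.b k, e⁆ i ≠ 0) : R.d i = R.d k + 1 := by
  refine R.reprh _ _ ?_ i hi
  rw [leibniz_lie, lieh, R.hhe, smul_lie, lie_smul, ← add_smul]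
  push_cast; ring_nf

/-- span of graded pieces -/
def gr (P : ℤ → Prop) : Submodule ℂ L := Submodule.span ℂ {x | ∃ i, P (R.d i) ∧ x = R.b i}

lemma b_mem_gr {P : ℤ → Prop} {i} (hi : P (R.d i)) : R.b i ∈ R.gr P :=
  Submodule.subset_span ⟨i, hi, rfl⟩

lemma mem_gr {P : ℤ → Prop} {x : L} : x ∈ R.gr P ↔ ∀ i, R.b.repr x i ≠ 0 → P (R.d i) := by
  constructor
  · intro hx
    induction hx using Submodule.span_induction with
    | mem x hx =>
      obtain ⟨i, hi, rfl⟩ := hx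
      intro j hj
      rw [R.b.repr_self, Finsupp.single_apply] at hj
      split_ifs at hj with hij
      · exact hij ▸ hi
      · exact absurd rfl hj
    | zero => intro i hi; simp at hi
    | add x y _ _ hx hy =>
      intro i hi
      by_cases h1 : R.b.repr x i = 0
      · apply hy; intro h2; apply hi; simp [h1, h2]
      · exact hx i h1
    | smul c x _ hx =>
      intro i hi
      apply hx; intro h2; apply hi; simp [h2]
  · intro hx
    rw [← R.b.sum_repr x]
    apply Submodule.sum_mem
    intro i _
    by_cases h1 : R.b.repr x i = 0
    · simp [h1]
    · exact Submodule.smul_mem _ _ (R.b_mem_gr (hx i h1))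

lemma gr_lie {P Q S : ℤ → Prop} (hPQ : ∀ a c, P a → Q c → S (a + c)) {x y : L}
    (hx : x ∈ R.gr P) (hy : y ∈ R.gr Q) : ⁅x, y⁆ ∈ R.gr S := by
  induction hx using Submodule.span_induction with
  | mem x hx =>
    obtain ⟨i, hi, rfl⟩ := hx
    induction hy using Submodule.span_induction with
    | mem y hy =>
      obtain ⟨j, hj, rfl⟩ := hy
      rw [mem_gr]
      intro k hk
      rw [R.repr_bb i j k hk]; exact hPQ _ _ hi hj
    | zero => simp
    | add x y _ _ hx hy => rw [lie_add]; exact Submodule.add_mem _ hx hy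
    | smul c x _ hx => rw [lie_smul]; exact Submodule.smul_mem _ _ hx
  | zero => simp
  | add x y _ _ hx hy => rw [add_lie]; exact Submodule.add_mem _ hx hy
  | smul c x _ hx => rw [smul_lie]; exact Submodule.smul_mem _ _ hx

def Bm : Submodule ℂ L := R.gr (· ≤ 0)
def mm : Submodule ℂ L := R.gr (· < 0)
def E : Set L := {v | v - e ∈ R.Bm}

lemma T_le_Bm (x : L) (hx : x ∈ R.T) : x ∈ R.Bm :=
  R.mem_gr.2 fun i hi => (R.repr_t x hx i hi).le

lemma mm_le_Bm : R.mm ≤ R.Bm := fun x hx =>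
  R.mem_gr.2 fun i hi => (R.mem_gr.1 hx i hi).le

lemma kf_gr (i k) (hik : R.d i + R.d k ≠ 0) : killingForm ℂ L (R.b i) (R.b k) = 0 := by
  have h4 := kf_inv' h (R.b i) (R.b k)
  rw [lieh, lieh, map_smul, map_smul, LinearMap.smul_apply] at h4
  have h5 : (2 * ((R.d i + R.d k : ℤ) : ℂ)) * killingForm ℂ L (R.b i) (R.b k) = 0 := by
    simp only [smul_eq_mul] at h4
    push_cast; linear_combination h4
  have h6 : (2 * ((R.d i + R.d k : ℤ) : ℂ)) ≠ 0 := by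
    apply mul_ne_zero two_ne_zero
    exact_mod_cast hik
  exact (mul_eq_zero.1 h5).resolve_left h6

lemma kf_grx (i) (P : ℤ → Prop) (x : L) (hx : x ∈ R.gr P) (hP : ∀ a, P a → R.d i + a ≠ 0) :
    killingForm ℂ L (R.b i) x = 0 := by
  rw [← R.b.sum_repr x, map_sum]
  apply Finset.sum_eq_zero
  intro k _
  by_cases h1 : R.b.repr x k = 0
  · simp [h1]
  · rw [map_smul, R.kf_gr i k (hP _ (R.mem_gr.1 hx k h1)), smul_zero]

lemma mem_Bm {u : L} : u ∈ R.Bm ↔ ∀ i, R.d i < 0 → killingForm ℂ L (R.b i) u = 0 := by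
  constructor
  · intro hu i hi
    exact R.kf_grx i _ u hu (fun a ha => by omega)
  · intro hu
    let v := ∑ k ∈ Finset.univ.filter (fun k => 0 < R.d k), R.b.repr u k • R.b k
    let w := ∑ k ∈ Finset.univ.filter (fun k => ¬ 0 < R.d k), R.b.repr u k • R.b k
    have huvw : u = v + w := by
      rw [Finset.sum_filter_add_sum_filter_not, R.b.sum_repr]
    have hw : w ∈ R.Bm := Submodule.sum_mem _ fun k hk => Submodule.smul_mem _ _
      (R.b_mem_gr (by have := (Finset.mem_filter.1 hk).2; omega))
    have hv : v ∈ R.gr (0 < ·) := Submodule.sum_mem _ fun k hk => Submodule.smul_mem _ _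
      (R.b_mem_gr (Finset.mem_filter.1 hk).2)
    have hv0 : v = 0 := by
      apply kf_nd.1
      intro y
      rw [← R.b.sum_repr y, map_sum]
      apply Finset.sum_eq_zero
      intro i _
      rw [map_smul, kf_comm]
      have : killingForm ℂ L (R.b i) v = 0 := by
        by_cases hi : R.d i < 0
        · have h1 := hu i hi
          rw [huvw, map_add, R.kf_grx i _ w hw (fun a ha => by omega), add_zero] at h1
          exact h1
        · exact R.kf_grx i _ v hv (fun a ha => by omega)
      rw [this, smul_zero]
    rw [huvw, hv0, zero_add]; exact hw

lemma mem_E {v : L} : v ∈ R.E ↔ ∀ i, R.d i < 0 → killingForm ℂ L (R.b i) v = killingForm ℂ L (R.b i) e := by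
  change v - e ∈ R.Bm ↔ _
  rw [mem_Bm]
  simp only [map_sub, sub_eq_zero]

def KilledOn (s : MvPolynomial (Fin R.n) ℂ) : Prop := ∀ a ∈ R.mm, ∀ v ∈ R.E, evp R.b v (DP R.b a s) = 0

lemma e_add_mem (u : L) (hu : u ∈ R.Bm) : e + u ∈ R.E := by
  change e + u - e ∈ R.Bm
  simpa using hu

theorem miura (s : MvPolynomial (Fin R.n) ℂ) (hs : R.KilledOn s)
    (h0 : ∀ x ∈ R.T, evp R.b (e + x) s = 0) : ∀ v ∈ R.E, evp R.b v s = 0 := by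
  let Y : Set L := {y | ∃ x : R.T, (∀ i, R.d i ≠ 0 → R.wt i x ≠ 0) ∧ y = e + x}
  have key := lemV R.b R.Bm R.T.toSubmodule R.mm Y R.E ?_ ?_ ?_ ?_ ?_ s hs ?_
  · intro v hv
    have hYh : e + h ∈ Y := by
      refine ⟨⟨h, R.hT⟩, fun i hi => ?_, rfl⟩
      rw [R.wth]
      exact mul_ne_zero two_ne_zero (by exact_mod_cast hi)
    have := key (e + h) hYh ((v - e) - h) (Submodule.sub_mem _ hv (R.T_le_Bm h R.hT))
    convert this using 2
    simp
  · rintro y ⟨x, -, rfl⟩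
    exact R.e_add_mem _ (R.T_le_Bm x x.2)
  · intro v hv u hu
    change v + u - e ∈ R.Bm
    rw [add_sub_right_comm]
    exact Submodule.add_mem _ hv hu
  · intro a ha u hu
    exact R.gr_lie (fun p q hp hq => by omega) ha hu
  · rintro y ⟨x, hx, rfl⟩ u hu
    let S : Submodule ℂ L := R.T.toSubmodule ⊔ R.mm.map ((LieAlgebra.ad ℂ L : L →ₗ[ℂ] Module.End ℂ L).flip (e + x))
    have hS : ∀ k : ℕ, ∀ i, R.d i = - (k : ℤ) → R.b i ∈ S := by
      intro k
      induction k with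
      | zero =>
        intro i hi
        exact Submodule.mem_sup_left (R.bT i (by simpa using hi))
      | succ k ih =>
        intro i hi
        have hwx := hx i (by rw [hi]; push_cast; omega)
        have h1 : ⁅R.b i, e⁆ ∈ S := by
          rw [← R.b.sum_repr ⁅R.b i, e⁆]
          apply Submodule.sum_mem
          intro l _
          by_cases hl : R.b.repr ⁅R.b i, e⁆ l = 0
          · simp [hl]
          · apply Submodule.smul_mem
            apply ih
            rw [R.repr_be i l hl, hi]; push_cast; ring
        have h2 : ⁅R.b i, e + x⁆ ∈ S := by
          apply Submodule.mem_sup_right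
          exact ⟨R.b i, R.b_mem_gr (by change R.d i < 0; rw [hi]; push_cast; omega), rfl⟩
        have h3 : R.b i = (R.wt i x)⁻¹ • (⁅R.b i, e⁆ - ⁅R.b i, e + x⁆) := by
          rw [lie_add, ← lie_skew (R.b i) (x : L), R.lieT]
          simp [smul_smul, inv_mul_cancel₀ hwx]
        rw [h3]
        exact Submodule.smul_mem _ _ (Submodule.sub_mem _ h1 h2)
    have huS : u ∈ S := by
      have : R.Bm ≤ S := by
        apply Submodule.span_le.2
        rintro _ ⟨i, hi, rfl⟩
        apply hS (R.d i).natAbs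
        omega
      exact this hu
    obtain ⟨u0, hu0, _, ⟨a, ha, rfl⟩, rfl⟩ := Submodule.mem_sup.1 huS
    exact ⟨u0, hu0, a, ha, rfl⟩
  · rintro y ⟨x, hx, rfl⟩ u hu
    have : {t : ℂ | e + x + t • u ∉ Y} ⊆ ⋃ i,
      {t : ℂ | R.d i ≠ 0 ∧ R.wt i x + t * R.wt i ⟨u, hu⟩ = 0} := by
      intro t ht
      by_contra hc
      apply ht
      refine ⟨x + t • ⟨u, hu⟩, fun i hi h0 => hc ?_, by simp [add_assoc]⟩
      simp only [Set.mem_iUnion]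
      refine ⟨i, hi, ?_⟩
      rw [map_add, map_smul, smul_eq_mul] at h0
      exact h0
    refine (Set.finite_iUnion fun i => ?_).subset this
    apply Set.Subsingleton.finite
    rintro t ⟨hi, ht⟩ t' ⟨-, ht'⟩
    have hxα := hx i hi
    have hz : R.wt i ⟨u, hu⟩ ≠ 0 := by
      intro hz; rw [hz] at ht; simp at ht; exact hxα ht
    have : t * R.wt i ⟨u, hu⟩ = t' * R.wt i ⟨u, hu⟩ := by linear_combination ht - ht'
    exact mul_right_cancel₀ hz this
  · rintro y ⟨x, -, rfl⟩
    exact h0 x x.2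

lemma inv_shift (p : MvPolynomial (Fin R.n) ℂ) (hp : p ∈ Inv R.b) (x : L) (hx : x ∈ R.T) :
    evp R.b (e + x) p = evp R.b x p := by
  have hd : Polynomial.X * Polynomial.derivative (curveP R.b x e 0 p) = 0 := by
    apply Polynomial.funext
    intro c
    rw [Polynomial.eval_mul, curveP_deriv, Polynomial.eval_X, Polynomial.eval_zero]
    simp only [smul_zero, add_zero]
    have h1 := ev_DP R.b (x + c • e) h p
    rw [hp h, map_zero, lie_add, R.habel h x R.hT hx, zero_add, lie_smul, R.hhe, dP_smul, dP_smul] at h1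
    simp only [Derivation.smul_apply, map_smul, smul_eq_mul] at h1
    have h2 : (2 : ℂ) * (c * evp R.b (x + c • e) (dP R.b e p)) = 0 := by linear_combination h1
    exact (mul_eq_zero.1 h2).resolve_left two_ne_zero
  have hd2 := (mul_eq_zero.1 hd).resolve_left Polynomial.X_ne_zero
  obtain ⟨c, hc⟩ : ∃ c, curveP R.b x e 0 p = Polynomial.C c :=
    ⟨_, Polynomial.eq_C_of_derivative_eq_zero hd2⟩
  have h0 := curveP_eval R.b x e 0 p 0
  have h1 := curveP_eval R.b x e 0 p 1
  rw [hc, Polynomial.eval_C] at h0 h1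
  simp at h0 h1
  rw [add_comm, ← h0, ← h1]

theorem C1 (p : MvPolynomial (Fin R.n) ℂ) (hp : p ∈ Inv R.b) (h0 : ∀ v ∈ R.E, evp R.b v p = 0) : p = 0 := by
  have := R.cart
  apply chev_inj R.b R.T p hp
  intro x hx
  rw [← R.inv_shift p hp x hx]
  exact h0 _ (R.e_add_mem _ (R.T_le_Bm x hx))

lemma inv_killed (p : MvPolynomial (Fin R.n) ℂ) (hp : p ∈ Inv R.b) : R.KilledOn p := by
  intro a _ v _
  rw [hp a, map_zero]

lemma refl_inv (i) (hi : R.d i = 1) : ∃ hi : R.T, R.wt i hi = 2 ∧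
    (∀ s, R.KilledOn s → ∀ x : R.T, evp R.b (e + x) s = evp R.b (e + (x - R.wt i x • hi : R.T)) s) := by
  obtain ⟨f, c, hf, hfe, hc⟩ := R.simple i hi
  refine ⟨c, hc, ?_⟩
  intro s hs x
  have hfm : f ∈ R.gr (· < 0) := by
    rw [mem_gr]
    intro j hj
    have : R.d j = -1 := by
      refine R.reprh (-1) f ?_ j hj
      have := hf ⟨h, R.hT⟩
      rw [R.wth, hi] at this
      rw [this]; simp
    omega
  have hfc : ⁅f, (c : L)⁆ = (2 : ℂ) • f := by
    rw [← lie_skew, hf, hc, neg_neg]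
  have hfx : ⁅f, (x : L)⁆ = R.wt i x • f := by
    rw [← lie_skew, hf, neg_neg]
  set w := R.wt i x
  have hd : Polynomial.derivative (curveP R.b (e + x) (-(c : L) + w • f) (-f) s) = 0 := by
    apply Polynomial.funext
    intro r
    rw [curveP_deriv, Polynomial.eval_zero]
    have hv : e + (x : L) + r • (-(c : L) + w • f) + r ^ 2 • (-f) ∈ R.E := by
      rw [add_assoc, add_assoc]
      apply R.e_add_mem
      refine Submodule.add_mem _ (R.T_le_Bm _ x.2) (Submodule.add_mem _ (Submodule.smul_mem _ _
        (Submodule.add_mem _ (Submodule.neg_mem _ (R.T_le_Bm _ c.2)) (Submodule.smul_mem _ _ (R.mm_le_Bm hfm))))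
        (Submodule.smul_mem _ _ (Submodule.neg_mem _ (R.mm_le_Bm hfm))))
    have h1 := ev_DP R.b (e + (x : L) + r • (-(c : L) + w • f) + r ^ 2 • (-f)) f s
    rw [hs f hfm _ hv] at h1
    have h2 : ⁅f, e + (x : L) + r • (-(c : L) + w • f) + r ^ 2 • (-f)⁆ = -(c : L) + w • f + (2 * r) • (-f) := by
      simp only [lie_add, lie_smul, lie_neg, lie_self, hfc, hfx, hfe]
      module
    rw [h2] at h1
    exact neg_eq_zero.1 h1.symm
  obtain ⟨k, hk⟩ : ∃ k, curveP R.b (e + x) (-(c : L) + w • f) (-f) s = Polynomial.C k :=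
    ⟨_, Polynomial.eq_C_of_derivative_eq_zero hd⟩
  have h0 := curveP_eval R.b (e + x) (-(c : L) + w • f) (-f) s 0
  have h1 := curveP_eval R.b (e + x) (-(c : L) + w • f) (-f) s w
  rw [hk, Polynomial.eval_C] at h0 h1
  have e1 : e + (x : L) + w • (-(c : L) + w • f) + w ^ 2 • (-f) = e + ((x - w • c : R.T) : L) := by
    push_cast
    module
  rw [e1] at h1
  simp at h0
  rw [← h0]; exact h1

end RD
end Kos

namespace Kos
open MvPolynomial

section Fil
variable {σ : Type*} (w : σ → ℤ)

def Fil (n : ℤ) : Submodule ℂ (MvPolynomial σ ℂ) where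
  carrier := {p | ∀ s ∈ p.support, Finsupp.weight w s ≤ n}
  zero_mem' := by simp
  add_mem' := by
    classical
    intro p q hp hq s hs
    rcases Finset.mem_union.1 (support_add hs) with h | h
    · exact hp s h
    · exact hq s h
  smul_mem' := by
    intro c p hp s hs
    exact hp s (support_smul hs)

lemma Fil_monomial {n : ℤ} {s : σ →₀ ℕ} (c : ℂ) (h : Finsupp.weight w s ≤ n) : monomial s c ∈ Fil w n := by
  classical
  intro t ht
  have := support_monomial_subset ht
  rw [Finset.mem_singleton] at this
  rwa [this]

lemma Fil_le {m n : ℤ} (h : m ≤ n) : Fil w m ≤ Fil w n := fun _ hp s hs => (hp s hs).trans h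

lemma Fil_mul {m n : ℤ} {p q : MvPolynomial σ ℂ} (hp : p ∈ Fil w m) (hq : q ∈ Fil w n) : p * q ∈ Fil w (m + n) := by
  classical
  intro s hs
  obtain ⟨a, ha, b, hb, rfl⟩ := Finset.mem_add.1 (support_mul p q hs)
  rw [map_add]
  exact add_le_add (hp a ha) (hq b hb)

lemma Fil_X (i : σ) : X i ∈ Fil w (w i) := by
  apply Fil_monomial
  simp [Finsupp.weight_single]

lemma Fil_C (c : ℂ) : C c ∈ Fil w 0 := by
  apply Fil_monomial; simp

lemma Fil_ind {n : ℤ} (M : Submodule ℂ (MvPolynomial σ ℂ)) (h : ∀ s : σ →₀ ℕ, Finsupp.weight w s ≤ n → monomial s (1:ℂ) ∈ M) :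
    Fil w n ≤ M := by
  intro p hp
  rw [p.as_sum]
  refine Submodule.sum_mem _ fun s hs => ?_
  have : monomial s (coeff s p) = coeff s p • monomial s (1:ℂ) := by rw [smul_monomial]; simp
  rw [this]
  exact Submodule.smul_mem _ _ (h s (hp s hs))

lemma fs_ind {P : (σ →₀ ℕ) → Prop} (h0 : P 0) (hs : ∀ s i, P s → P (Finsupp.single i 1 + s)) (s : σ →₀ ℕ) : P s := by
  classical
  obtain ⟨m, rfl⟩ : ∃ m : Multiset σ, Multiset.toFinsupp m = s := ⟨_, Multiset.toFinsupp.apply_symm_apply s⟩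
  induction m using Multiset.induction_on with
  | empty => simpa using h0
  | cons a m ih =>
    rw [← Multiset.singleton_add, map_add, Multiset.toFinsupp_singleton]
    exact hs _ _ ih

lemma mon_cons (s : σ →₀ ℕ) (i : σ) : monomial (Finsupp.single i 1 + s) (1:ℂ) = X i * monomial s 1 := by
  rw [X, monomial_mul, mul_one]

lemma weight_cons (s : σ →₀ ℕ) (i : σ) : Finsupp.weight w (Finsupp.single i 1 + s) = w i + Finsupp.weight w s := by
  rw [map_add, Finsupp.weight_single, one_smul]

lemma Fil_der_mon (D : Derivation ℂ (MvPolynomial σ ℂ) (MvPolynomial σ ℂ)) (c : ℤ)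
    (hD : ∀ i, D (X i) ∈ Fil w (w i + c)) (s : σ →₀ ℕ) : D (monomial s 1) ∈ Fil w (Finsupp.weight w s + c) := by
  induction s using fs_ind with
  | h0 => simp
  | hs s i ih =>
    rw [mon_cons, weight_cons, Derivation.leibniz, smul_eq_mul, smul_eq_mul]
    refine Submodule.add_mem _ ?_ ?_
    · rw [add_assoc]; exact Fil_mul w (Fil_X w i) ih
    · rw [show w i + Finsupp.weight w s + c = Finsupp.weight w s + (w i + c) by ring]
      exact Fil_mul w (Fil_monomial w 1 le_rfl) (hD i)

lemma Fil_der (D : Derivation ℂ (MvPolynomial σ ℂ) (MvPolynomial σ ℂ)) (c : ℤ)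
    (hD : ∀ i, D (X i) ∈ Fil w (w i + c)) {n : ℤ} {p} (hp : p ∈ Fil w n) : D p ∈ Fil w (n + c) := by
  refine (Fil_ind w ((Fil w (n+c)).comap D.toLinearMap) ?_) hp
  intro s hs
  exact Fil_le w (by omega) (Fil_der_mon w D c hD s)

lemma Fil_fd [Finite σ] (n : ℤ) : FiniteDimensional ℂ (Fil (fun _ : σ => (1:ℤ)) n) := by
  classical
  have hfin : {s : σ →₀ ℕ | Finsupp.weight (fun _ : σ => (1:ℤ)) s ≤ n}.Finite := by
    refine (Finsupp.finite_of_degree_le (σ := σ) n.toNat).subset ?_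
    intro s hs
    have h1 : Finsupp.weight (fun _ : σ => (1:ℤ)) s = (s.degree : ℤ) := by
      rw [Finsupp.weight_apply, Finsupp.degree_apply, Finsupp.sum]
      simp
    rw [Set.mem_ofPred_eq, h1] at hs
    change s.degree ≤ n.toNat
    omega
  have hle : Fil (fun _ : σ => (1:ℤ)) n ≤ Submodule.span ℂ ((fun s => monomial s (1:ℂ)) '' {s : σ →₀ ℕ | Finsupp.weight (fun _ : σ => (1:ℤ)) s ≤ n}) :=
    Fil_ind _ _ fun s hs => Submodule.subset_span ⟨s, hs, rfl⟩
  have : FiniteDimensional ℂ (Submodule.span ℂ ((fun s => monomial s (1:ℂ)) '' {s : σ →₀ ℕ | Finsupp.weight (fun _ : σ => (1:ℤ)) s ≤ n})) :=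
    FiniteDimensional.span_of_finite ℂ (hfin.image _)
  exact Submodule.finiteDimensional_of_le hle

end Fil

section LS
variable {L : Type*} [LieRing L] [LieAlgebra ℂ L] [FiniteDimensional ℂ L] [LieAlgebra.IsKilling ℂ L]
variable {ι : Type*} [Fintype ι] [DecidableEq ι] (b : Module.Basis ι ℂ L)

noncomputable def LS (x : L) : Derivation ℂ (MvPolynomial (ι × ι) ℂ) (MvPolynomial (ι × ι) ℂ) :=
  mkDerivation ℂ (fun q => ∑ k, adM b x k q.1 • X (k, q.2))

lemma LS_X (x : L) (i j : ι) : LS b x (X (i, j)) = ∑ k, adM b x k i • X (k, j) := by simp [LS]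

lemma LS_add (x y : L) : LS b (x + y) = LS b x + LS b y := by
  apply MvPolynomial.derivation_ext
  rintro ⟨i, j⟩
  rw [Derivation.add_apply, LS_X, LS_X, LS_X, map_add]
  simp [add_smul, Finset.sum_add_distrib]

lemma LS_smul (c : ℂ) (x : L) : LS b (c • x) = c • LS b x := by
  apply MvPolynomial.derivation_ext
  rintro ⟨i, j⟩
  rw [Derivation.smul_apply, LS_X, LS_X, map_smul]
  simp [mul_smul, Finset.smul_sum]

lemma LS_lie (x y : L) (s) : LS b ⁅x, y⁆ s = LS b x (LS b y s) - LS b y (LS b x s) := by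
  have : LS b ⁅x, y⁆ = ⁅LS b x, LS b y⁆ := by
    apply MvPolynomial.derivation_ext
    rintro ⟨i, j⟩
    rw [Derivation.commutator_apply, LS_X, LS_X, LS_X, adM_lie, map_sum, map_sum]
    simp only [Derivation.map_smul, LS_X, Matrix.sub_apply, Matrix.mul_apply, sub_smul, Finset.sum_sub_distrib, Finset.sum_smul, Finset.smul_sum, smul_smul]
    congr 1 <;> rw [Finset.sum_comm] <;>
    exact Finset.sum_congr rfl fun _ _ => Finset.sum_congr rfl fun _ _ => by rw [mul_comm]
  rw [this, Derivation.commutator_apply]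

lemma LS_Fil1 (x : L) {n : ℤ} {p} (hp : p ∈ Fil (fun _ : ι × ι => (1:ℤ)) n) : LS b x p ∈ Fil (fun _ : ι × ι => (1:ℤ)) n := by
  have := Fil_der (fun _ : ι × ι => (1:ℤ)) (LS b x) 0 (fun ⟨i, j⟩ => by
    rw [LS_X]
    exact Submodule.sum_mem _ fun k _ => Submodule.smul_mem _ _ (Fil_X (fun _ : ι × ι => (1:ℤ)) (k, j))) hp
  rwa [add_zero] at this

end LS
end Kos

namespace Kos
open MvPolynomial
namespace RD
variable {L : Type*} [LieRing L] [LieAlgebra ℂ L] [FiniteDimensional ℂ L] [LieAlgebra.IsKilling ℂ L]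
variable {e h : L} (R : RD L e h)

lemma adM_b (x : L) (k i) : adM R.b x k i = R.b.repr ⁅x, R.b i⁆ k := by
  simp [adM, LinearMap.toMatrix_apply]

noncomputable def mn (q : Fin R.n) : Matrix {i : Fin R.n // i ≤ q} {i : Fin R.n // i ≤ q} (MvPolynomial (Fin R.n × Fin R.n) ℂ) :=
  Matrix.of fun i j => X (i.1, j.1)

lemma mn_der (q : Fin R.n) (x : L) (hx : ∀ k i : Fin R.n, i ≤ q → ¬ k ≤ q → adM R.b x k i = 0) :
    LS R.b x (R.mn q).det = C (∑ i : {i : Fin R.n // i ≤ q}, adM R.b x i i) * (R.mn q).det := by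
  rw [der_det_mul _ _ (Matrix.of fun i k => C (adM R.b x k.1 i.1))]
  · simp [Matrix.trace]
  · ext1 i j
    simp only [Matrix.map_apply, Matrix.mul_apply, mn, Matrix.of_apply, LS_X]
    simp only [← smul_eq_C_mul]
    symm
    refine Finset.sum_of_injOn Subtype.val Subtype.val_injective.injOn (by simp) ?_ (fun _ _ => rfl)
    intro k _ hk
    rw [hx k i.1 i.2 (fun hkq => hk ⟨⟨k, hkq⟩, by simp, rfl⟩), zero_smul]

noncomputable def La (q : Fin R.n) : Module.Dual ℂ R.T := ∑ i : {i : Fin R.n // i ≤ q}, R.wt i.1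

lemma mn_T (q : Fin R.n) (x : R.T) : LS R.b x (R.mn q).det = C (R.La q x) * (R.mn q).det := by
  rw [mn_der]
  · congr 2
    simp [adM_b, La, R.lieT]
  · intro k i hi hk
    rw [adM_b, R.lieT]
    have : i ≠ k := fun h => hk (h ▸ hi)
    simp [this]

lemma mn_up (q j : Fin R.n) (hj : 0 < R.d j) : LS R.b (R.b j) (R.mn q).det = 0 := by
  have h1 : ∀ k i, adM R.b (R.b j) k i ≠ 0 → k < i := by
    intro k i hki
    rw [adM_b] at hki
    have := R.repr_bb j i k hki
    by_contra hlt
    have := R.anti (not_lt.1 hlt)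
    omega
  rw [mn_der]
  · rw [Finset.sum_eq_zero, map_zero, zero_mul]
    intro i _
    by_contra hne
    exact lt_irrefl _ (h1 _ _ hne)
  · intro k i hi hk
    by_contra hne
    exact hk ((h1 _ _ hne).le.trans hi)

lemma mn_ne (q : Fin R.n) : (R.mn q).det ≠ 0 := by
  intro h0
  have h1 := congrArg (eval (fun p : Fin R.n × Fin R.n => if p.1 = p.2 then (1:ℂ) else 0)) h0
  rw [RingHom.map_det, map_zero] at h1
  have : (RingHom.mapMatrix (eval (fun p : Fin R.n × Fin R.n => if p.1 = p.2 then (1:ℂ) else 0))) (R.mn q) = 1 := by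
    ext i j
    simp [mn, Matrix.one_apply, Subtype.ext_iff]
  rw [this] at h1
  simp at h1

noncomputable def hv (m : Fin R.n → ℕ) : MvPolynomial (Fin R.n × Fin R.n) ℂ := ∏ q, (R.mn q).det ^ m q

lemma hv_ne (m) : R.hv m ≠ 0 := Finset.prod_ne_zero_iff.2 fun q _ => pow_ne_zero _ (R.mn_ne q)

lemma hv_der (m) (x : L) (c : Fin R.n → ℂ) (hx : ∀ q, LS R.b x (R.mn q).det = C (c q) * (R.mn q).det) :
    LS R.b x (R.hv m) = (∑ q, m q * c q) • R.hv m := by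
  rw [hv, der_prod, Finset.sum_smul]
  refine Finset.sum_congr rfl fun q _ => ?_
  rw [← Finset.mul_prod_erase _ _ (Finset.mem_univ q), Derivation.leibniz_pow, hx, smul_eq_C_mul, map_mul]
  rcases Nat.eq_zero_or_pos (m q) with h0 | h0
  · simp [h0]
  · obtain ⟨k, hk⟩ := Nat.exists_eq_succ_of_ne_zero h0.ne'
    rw [hk]
    simp only [smul_eq_mul, nsmul_eq_mul, map_natCast, Nat.succ_sub_one, pow_succ]
    ring

noncomputable def lam (m : Fin R.n → ℕ) : Module.Dual ℂ R.T := ∑ q, (m q : ℂ) • R.La q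

lemma hv_T (m) (x : R.T) : LS R.b x (R.hv m) = R.lam m x • R.hv m := by
  rw [R.hv_der m x _ (fun q => R.mn_T q x)]
  simp [lam]

lemma hv_up (m) (j) (hj : 0 < R.d j) : LS R.b (R.b j) (R.hv m) = 0 := by
  rw [R.hv_der m (R.b j) 0 (fun q => by rw [mn_up _ _ _ hj]; simp)]
  simp

noncomputable def word (v : MvPolynomial (Fin R.n × Fin R.n) ℂ) : List (Fin R.n) → MvPolynomial (Fin R.n × Fin R.n) ℂ
  | [] => v
  | i :: l => LS R.b (R.b i) (word v l)

noncomputable def wspan (v : MvPolynomial (Fin R.n × Fin R.n) ℂ) : Submodule ℂ (MvPolynomial (Fin R.n × Fin R.n) ℂ) :=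
  Submodule.span ℂ {u | ∃ l : List (Fin R.n), (∀ i ∈ l, R.d i < 0) ∧ u = R.word v l}

lemma wspan_low (v) (i) (hi : R.d i < 0) (u) (hu : u ∈ R.wspan v) : LS R.b (R.b i) u ∈ R.wspan v := by
  induction hu using Submodule.span_induction with
  | mem u hu =>
    obtain ⟨l, hl, rfl⟩ := hu
    exact Submodule.subset_span ⟨i :: l, by simpa [hi] using hl, rfl⟩
  | zero => simp
  | add x y _ _ hx hy => rw [map_add]; exact Submodule.add_mem _ hx hy
  | smul c x _ hx => rw [Derivation.map_smul]; exact Submodule.smul_mem _ _ hx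

lemma LS_sum (x : L) (u) : LS R.b x u = ∑ i, R.b.repr x i • LS R.b (R.b i) u := by
  conv_lhs => rw [← R.b.sum_repr x]
  have : ∀ s : Finset (Fin R.n), LS R.b (∑ i ∈ s, R.b.repr x i • R.b i) u = ∑ i ∈ s, R.b.repr x i • LS R.b (R.b i) u := by
    intro s
    induction s using Finset.induction_on with
    | empty =>
      have := LS_smul R.b 0 (0 : L)
      simp only [zero_smul] at this
      simp [this]
    | insert a s ha ih => rw [Finset.sum_insert ha, Finset.sum_insert ha, LS_add, Derivation.add_apply, ih, LS_smul, Derivation.smul_apply]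
  exact this _

lemma wspan_stab (m) (x : L) (u) (hu : u ∈ R.wspan (R.hv m)) : LS R.b x u ∈ R.wspan (R.hv m) := by
  have key : ∀ l : List (Fin R.n), (∀ i ∈ l, R.d i < 0) → ∀ x : L, LS R.b x (R.word (R.hv m) l) ∈ R.wspan (R.hv m) := by
    intro l
    induction l with
    | nil =>
      intro _ x
      rw [LS_sum]
      refine Submodule.sum_mem _ fun i _ => Submodule.smul_mem _ _ ?_
      have hv0 : R.hv m ∈ R.wspan (R.hv m) := Submodule.subset_span ⟨[], by simp, rfl⟩
      rcases lt_trichotomy (R.d i) 0 with hi | hi | hi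
      · exact R.wspan_low _ _ hi _ hv0
      · have := R.hv_T m ⟨R.b i, R.bT i hi⟩
        simp only [word]
        rw [this]
        exact Submodule.smul_mem _ _ hv0
      · simp only [word]; rw [R.hv_up m i hi]; exact Submodule.zero_mem _
    | cons j l ih =>
      intro hl x
      have h1 := LS_lie R.b x (R.b j) (R.word (R.hv m) l)
      simp only [word]
      rw [eq_comm, sub_eq_iff_eq_add] at h1
      rw [h1]
      have hl' : ∀ i ∈ l, R.d i < 0 := fun i hi => hl i (by simp [hi])
      exact Submodule.add_mem _ (ih hl' _) (R.wspan_low _ _ (hl j (by simp)) _ (ih hl' _))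
  induction hu using Submodule.span_induction with
  | mem u hu =>
    obtain ⟨l, hl, rfl⟩ := hu
    exact key l hl x
  | zero => simp
  | add x y _ _ hx hy => rw [map_add]; exact Submodule.add_mem _ hx hy
  | smul c x _ hx => rw [Derivation.map_smul]; exact Submodule.smul_mem _ _ hx

lemma word_T (m) (l : List (Fin R.n)) (x : R.T) :
    LS R.b x (R.word (R.hv m) l) = (R.lam m + (l.map R.wt).sum) x • R.word (R.hv m) l := by
  induction l with
  | nil => simp [word, hv_T]
  | cons j l ih =>
    have h1 := LS_lie R.b x (R.b j) (R.word (R.hv m) l)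
    simp only [word]
    rw [eq_comm, sub_eq_iff_eq_add] at h1
    rw [h1, ih, R.lieT, LS_smul, Derivation.smul_apply, Derivation.map_smul, ← add_smul]
    congr 1
    simp; ring

lemma wspan_fd (v) : FiniteDimensional ℂ (R.wspan v) := by
  obtain ⟨n, hn⟩ : ∃ n, v ∈ Fil (fun _ : Fin R.n × Fin R.n => (1:ℤ)) n := by
    refine ⟨∑ s ∈ v.support, |Finsupp.weight (fun _ : Fin R.n × Fin R.n => (1:ℤ)) s|, fun s hs => ?_⟩
    exact (le_abs_self _).trans (Finset.single_le_sum (f := fun s => |Finsupp.weight (fun _ : Fin R.n × Fin R.n => (1:ℤ)) s|) (fun _ _ => abs_nonneg _) hs)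
  have : FiniteDimensional ℂ (Fil (fun _ : Fin R.n × Fin R.n => (1:ℤ)) n) := Fil_fd n
  refine Submodule.finiteDimensional_of_le (S₂ := Fil (fun _ : Fin R.n × Fin R.n => (1:ℤ)) n) (Submodule.span_le.2 ?_)
  rintro u ⟨l, -, rfl⟩
  induction l with
  | nil => exact hn
  | cons i l ih => exact LS_Fil1 R.b _ ih

def Npos (φ : Module.Dual ℂ R.T) : Prop := ∃ c : Fin R.n → ℕ, (∀ i, c i ≠ 0 → R.d i = 1) ∧ φ = ∑ i, c i • R.wt i

lemma Npos_add {φ ψ} (h1 : R.Npos φ) (h2 : R.Npos ψ) : R.Npos (φ + ψ) := by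
  obtain ⟨c, hc, rfl⟩ := h1
  obtain ⟨c', hc', rfl⟩ := h2
  refine ⟨c + c', fun i hi => ?_, by simp [add_smul, Finset.sum_add_distrib]⟩
  by_contra hne
  have a1 : c i = 0 := by by_contra hh; exact hne (hc i hh)
  have a2 : c' i = 0 := by by_contra hh; exact hne (hc' i hh)
  simp [a1, a2] at hi

lemma Npos_simple (i) (hi : R.d i = 1) : R.Npos (R.wt i) :=
  ⟨Pi.single i 1, fun j hj => by
    by_cases hji : j = i
    · rw [hji, hi]
    · simp [Pi.single_eq_of_ne hji] at hj, by simp [Pi.single_apply]⟩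

lemma Npos_wt (n : ℕ) : ∀ i, R.d i = (n:ℤ) + 1 → R.Npos (R.wt i) := by
  induction n with
  | zero => intro i hi; exact R.Npos_simple i (by simpa using hi)
  | succ n ih =>
    intro i hi
    obtain ⟨j, k, hj, hk, he⟩ := R.decomp i (by push_cast at hi; omega)
    rw [he]
    exact R.Npos_add (R.Npos_simple j hj) (ih k (by push_cast at hi; omega))

lemma Npos_neg (i) (hi : R.d i < 0) : R.Npos (- R.wt i) := by
  obtain ⟨k, hk, hd⟩ := R.neg i
  rw [← hk]
  exact R.Npos_wt (- R.d i - 1).toNat k (by omega)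

/-- highest weight modules -/
theorem exists_V (m : Fin R.n → ℕ) : ∃ (N : ℕ) (ρ : L →ₗ[ℂ] Matrix (Fin N) (Fin N) ℂ) (ω : Fin N → Module.Dual ℂ R.T),
    (∀ x y, ρ ⁅x, y⁆ = ρ x * ρ y - ρ y * ρ x) ∧ (∀ x : R.T, (ρ x).charpoly = ∏ k, (Polynomial.X - Polynomial.C (ω k x))) ∧
    (∀ k, R.Npos (R.lam m - ω k)) ∧ ∃ k, ω k = R.lam m := by
  classical
  have := R.wspan_fd (R.hv m)
  let V := R.wspan (R.hv m)
  let S : Set V := {u | ∃ l : List (Fin R.n), (∀ i ∈ l, R.d i < 0) ∧ u.1 = R.word (R.hv m) l}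
  have hS : ⊤ ≤ Submodule.span ℂ S := by
    rw [← Submodule.map_le_map_iff_of_injective V.subtype_injective, Submodule.map_span, Submodule.map_subtype_top]
    refine Submodule.span_le.2 ?_
    rintro u ⟨l, hl, rfl⟩
    exact Submodule.subset_span ⟨⟨_, Submodule.subset_span ⟨l, hl, rfl⟩⟩, ⟨l, hl, rfl⟩, rfl⟩
  obtain ⟨N, B, hB⟩ : ∃ (N : ℕ) (B : Module.Basis (Fin N) ℂ V), ∀ k, ∃ l : List (Fin R.n), (∀ i ∈ l, R.d i < 0) ∧ (B k).1 = R.word (R.hv m) l := by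
    let B0 := Module.Basis.ofSpan hS
    have hB0 : ∀ k, ∃ l : List (Fin R.n), (∀ i ∈ l, R.d i < 0) ∧ (B0 k).1 = R.word (R.hv m) l := fun k =>
      Module.Basis.ofSpan_subset hS ⟨k, rfl⟩
    have : Finite _ := Module.Finite.finite_basis B0
    exact ⟨_, B0.reindex (Finite.equivFin _), fun k => by
      rw [Module.Basis.reindex_apply]; exact hB0 _⟩
  choose l hl hBl using hB
  let ω : _ → Module.Dual ℂ R.T := fun k => R.lam m + ((l k).map R.wt).sum
  let act : L → (V →ₗ[ℂ] V) := fun x => (LS R.b x).toLinearMap.restrict (fun u hu => R.wspan_stab m x u hu)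
  have hact : ∀ x (u : V), ((act x u : V) : MvPolynomial (Fin R.n × Fin R.n) ℂ) = LS R.b x u.1 := fun x u => rfl
  have hω : ∀ k (x : R.T), act x (B k) = ω k x • B k := by
    intro k x
    apply Subtype.ext
    rw [hact, hBl, R.word_T, Submodule.coe_smul, hBl]
  let actL : L →ₗ[ℂ] (V →ₗ[ℂ] V) :=
    { toFun := act
      map_add' := fun x y => by ext1 u; apply Subtype.ext; simp [hact, LS_add]
      map_smul' := fun c y => by ext1 u; apply Subtype.ext; simp [hact, LS_smul] }
  refine ⟨_, (LinearMap.toMatrix B B).toLinearMap ∘ₗ actL, ω, ?_, ?_, ?_, ?_⟩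
  · intro x y
    simp only [LinearMap.comp_apply, LinearEquiv.coe_coe]
    rw [← LinearMap.toMatrix_mul, ← LinearMap.toMatrix_mul, ← map_sub]
    congr 1
    ext1 u
    apply Subtype.ext
    exact LS_lie R.b x y u.1
  · intro x
    have : ((LinearMap.toMatrix B B).toLinearMap ∘ₗ actL) x = Matrix.diagonal fun k => ω k x := by
      ext i j
      change LinearMap.toMatrix B B (act x) i j = _
      rw [LinearMap.toMatrix_apply, hω, map_smul, Module.Basis.repr_self, Matrix.diagonal_apply]
      by_cases hij : i = j
      · subst hij; rw [if_pos rfl, Finsupp.smul_apply, Finsupp.single_eq_same, smul_eq_mul, mul_one]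
      · rw [if_neg hij, Finsupp.smul_apply, Finsupp.single_eq_of_ne hij, smul_zero]
    rw [this, Matrix.charpoly_diagonal]
  · intro k
    have : R.lam m - ω k = ((l k).map fun i => - R.wt i).sum := by
      simp only [ω]
      rw [sub_add_cancel_left]
      induction l k with
      | nil => simp
      | cons a t ih => simp only [List.map_cons, List.sum_cons, neg_add, ih]
    rw [this]
    have hk := hl k
    clear this
    revert hk
    induction l k with
    | nil => intro _; exact ⟨0, by simp, by simp⟩
    | cons a t ih =>
      intro hk
      rw [List.map_cons, List.sum_cons]
      exact R.Npos_add (R.Npos_neg a (hk a (by simp))) (ih (fun i hi => hk i (by simp [hi])))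
  · let v : V := ⟨R.hv m, Submodule.subset_span ⟨[], by simp, rfl⟩⟩
    have hv0 : v ≠ 0 := fun h0 => R.hv_ne m (congrArg Subtype.val h0)
    obtain ⟨k, hk⟩ : ∃ k, B.repr v k ≠ 0 := by
      by_contra hc
      push Not at hc
      apply hv0
      rw [← B.repr.map_eq_zero_iff]
      ext k; exact hc k
    refine ⟨k, ?_⟩
    ext x
    have h1 : act x v = R.lam m x • v := Subtype.ext (R.hv_T m x)
    have h2 : act x v = ∑ j, B.repr v j • ω j x • B j := by
      conv_lhs => rw [← B.sum_repr v]
      rw [map_sum]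
      exact Finset.sum_congr rfl fun j _ => by rw [map_smul, hω]
    have h3 := congrArg (fun u => B.repr u k) (h1.symm.trans h2)
    simp only [map_smul, map_sum, Finsupp.coe_finsetSum, Finset.sum_apply, Finsupp.smul_apply, Module.Basis.repr_self, smul_eq_mul] at h3
    rw [Finset.sum_eq_single k, Finsupp.single_eq_same, mul_one] at h3
    · exact (mul_right_cancel₀ hk (h3.trans (mul_comm _ _))).symm
    · intro j _ hj
      rw [Finsupp.single_eq_of_ne hj.symm]; ring
    · simp
end RD
end Kos

namespace Kos
open MvPolynomial
namespace RD
variable {L : Type*} [LieRing L] [LieAlgebra ℂ L] [FiniteDimensional ℂ L] [LieAlgebra.IsKilling ℂ L]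
variable {e h : L} (R : RD L e h)

def G : Subgroup (R.T ≃ₗ[ℂ] R.T) where
  carrier := {g | ∀ p ∈ Inv R.b, ∀ x : R.T, evp R.b (g x : R.T) p = evp R.b (x : L) p}
  one_mem' := fun _ _ _ => rfl
  mul_mem' := by
    intro g g' hg hg' p hp x
    rw [LinearEquiv.mul_apply, hg p hp, hg' p hp]
  inv_mem' := by
    intro g hg p hp x
    rw [← hg p hp (g⁻¹ x)]
    have : g (g⁻¹ x) = x := LinearEquiv.apply_symm_apply g x
    rw [this]

lemma G_perm {N : ℕ} (ρ : L →ₗ[ℂ] Matrix (Fin N) (Fin N) ℂ) (ω : Fin N → Module.Dual ℂ R.T)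
    (hρ : ∀ x y, ρ ⁅x, y⁆ = ρ x * ρ y - ρ y * ρ x)
    (hω : ∀ x : R.T, (ρ x).charpoly = ∏ k, (Polynomial.X - Polynomial.C (ω k x)))
    (g : R.T ≃ₗ[ℂ] R.T) (hg : g ∈ R.G) (k : Fin N) : ∃ j, ω k ∘ₗ g.toLinearMap = ω j := by
  have h1 : ∀ x : R.T, (ρ (g x : R.T)).charpoly = (ρ x).charpoly := by
    intro x
    ext c
    obtain ⟨p, hp, hpe⟩ := exists_inv R.b ρ hρ c
    rw [← hpe, ← hpe, hg p hp]
  have h2 : ∀ x : R.T, ∃ j, ω k (g x) = ω j x := by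
    intro x
    have h3 := h1 x
    rw [hω, hω] at h3
    have h4 := congrArg (Polynomial.eval (ω k (g x))) h3
    rw [Polynomial.eval_prod, Polynomial.eval_prod, Finset.prod_eq_zero (Finset.mem_univ k) (by simp), eq_comm, Finset.prod_eq_zero_iff] at h4
    obtain ⟨j, -, hj⟩ := h4
    exact ⟨j, by simpa [sub_eq_zero] using hj⟩
  obtain ⟨j, hj⟩ := Subspace.exists_eq_top_of_iUnion_eq_univ (k := ℂ) (p := fun j => LinearMap.ker (ω k ∘ₗ g.toLinearMap - ω j)) (by
    rw [Set.eq_univ_iff_forall]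
    intro x
    obtain ⟨j, hj⟩ := h2 x
    exact Set.mem_iUnion.2 ⟨j, by simp [hj]⟩)
  refine ⟨j, ?_⟩
  rwa [LinearMap.ker_eq_top, sub_eq_zero] at hj

lemma ad_charpoly (x : R.T) : (adM R.b x).charpoly = ∏ k, (Polynomial.X - Polynomial.C (R.wt k x)) := by
  have : adM R.b x = Matrix.diagonal fun k => R.wt k x := by
    ext i j
    rw [adM_b, R.lieT, map_smul, Module.Basis.repr_self, Matrix.diagonal_apply]
    by_cases hij : i = j
    · subst hij; rw [if_pos rfl, Finsupp.smul_apply, Finsupp.single_eq_same, smul_eq_mul, mul_one]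
    · rw [if_neg hij, Finsupp.smul_apply, Finsupp.single_eq_of_ne hij, smul_zero]
  rw [this, Matrix.charpoly_diagonal]

lemma G_wt (g : R.T ≃ₗ[ℂ] R.T) (hg : g ∈ R.G) (k) : ∃ j, R.wt k ∘ₗ g.toLinearMap = R.wt j :=
  R.G_perm (adM R.b) R.wt (adM_lie R.b) R.ad_charpoly g hg k

lemma ext_wt (g g' : R.T ≃ₗ[ℂ] R.T) (hgg : ∀ k x, R.wt k (g x) = R.wt k (g' x)) : g = g' := by
  ext x
  have := R.sep (g x - g' x) (fun i => by rw [map_sub, hgg, sub_self])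
  rw [sub_eq_zero] at this
  rw [this]

instance G_fin : Finite R.G := by
  choose f hf using fun (g : R.G) k => R.G_wt g.1 g.2 k
  refine Finite.of_injective f ?_
  intro g g' hfg
  apply Subtype.ext
  apply R.ext_wt
  intro k x
  have h1 := LinearMap.congr_fun (hf g k) x
  have h2 := LinearMap.congr_fun (hf g' k) x
  rw [hfg] at h1
  exact h1.trans h2.symm

lemma exists_cor (i) (hi : R.d i = 1) : ∃ c : R.T, R.wt i c = 2 ∧
    (∀ s, R.KilledOn s → ∀ x : R.T, evp R.b (e + x) s = evp R.b (e + (x - R.wt i x • c : R.T)) s) := R.refl_inv i hi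

open Classical in
noncomputable def cor (i : Fin R.n) : R.T := if hi : R.d i = 1 then (R.exists_cor i hi).choose else 0

lemma cor_2 {i} (hi : R.d i = 1) : R.wt i (R.cor i) = 2 := by
  rw [cor, dif_pos hi]; exact (R.exists_cor i hi).choose_spec.1

lemma cor_inv {i} (hi : R.d i = 1) (s) (hs : R.KilledOn s) (x : R.T) :
    evp R.b (e + x) s = evp R.b (e + (x - R.wt i x • R.cor i : R.T)) s := by
  rw [cor, dif_pos hi]; exact (R.exists_cor i hi).choose_spec.2 s hs x

noncomputable def sr (i : Fin R.n) (hi : R.d i = 1) : R.T ≃ₗ[ℂ] R.T :=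
  Module.reflection (R.cor_2 hi)

lemma sr_apply (i) (hi : R.d i = 1) (x : R.T) : R.sr i hi x = x - R.wt i x • R.cor i := by
  rw [sr, Module.reflection_apply]

lemma sr_mem (i) (hi : R.d i = 1) : R.sr i hi ∈ R.G := by
  intro p hp x
  rw [sr_apply, ← R.inv_shift p hp _ (Subtype.mem _), ← R.cor_inv hi p (R.inv_killed p hp), R.inv_shift p hp _ x.2]

def W2 : Subgroup (R.T ≃ₗ[ℂ] R.T) := Subgroup.closure {g | ∃ i hi, g = R.sr i hi}

lemma W2_le : R.W2 ≤ R.G := (Subgroup.closure_le _).2 (by rintro g ⟨i, hi, rfl⟩; exact R.sr_mem i hi)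

lemma La_apply (q : Fin R.n) (x) : R.La q x = ∑ i ∈ Finset.univ.filter (fun i : Fin R.n => i.1 ≤ q.1), R.wt i x := by
  rw [La, LinearMap.sum_apply]
  symm
  exact Finset.sum_subtype (p := fun i : Fin R.n => i ≤ q) (Finset.univ.filter fun i : Fin R.n => i.1 ≤ q.1) (fun i => Iff.trans Finset.mem_filter ⟨fun h => h.2, fun h => ⟨Finset.mem_univ _, h⟩⟩) (fun i => R.wt i x)

lemma La_span (g : R.T ≃ₗ[ℂ] R.T) (hg : ∀ q x, R.La q (g x) = R.La q x) : g = 1 := by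
  apply R.ext_wt
  intro k x
  have split : ∀ (f : Fin R.n → ℂ), f k = ∑ i ∈ Finset.univ.filter (fun i : Fin R.n => i.1 ≤ k.1), f i -
      ∑ i ∈ Finset.univ.filter (fun i : Fin R.n => i.1 < k.1), f i := by
    intro f
    rw [eq_sub_iff_add_eq, ← Finset.sum_insert (by simp)]
    congr 1
    ext i
    simp [le_iff_lt_or_eq, Fin.ext_iff, or_comm]
  change R.wt k (g x) = R.wt k x
  rw [split (fun i => R.wt i (g x)), split (fun i => R.wt i x), ← La_apply, ← La_apply, hg]
  congr 1
  obtain ⟨kv, hk⟩ := k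
  cases kv with
  | zero => simp only [Nat.not_lt_zero, Finset.filter_false, Finset.sum_empty]
  | succ m =>
    have h1 := hg ⟨m, by omega⟩ x
    rw [La_apply, La_apply] at h1
    simpa only [Nat.lt_succ_iff] using h1

lemma exists_gen : ∃ m : Fin R.n → ℕ, ∀ g ∈ R.G, R.lam m ∘ₗ g.toLinearMap = R.lam m → g = 1 := by
  classical
  have := Fintype.ofFinite R.G
  have h1 : ∀ g : R.G, g.1 ≠ 1 → ∃ (x : R.T), ∑ j : Fin R.n, Polynomial.C (R.La j (g.1 x) - R.La j x) * Polynomial.X ^ (j : ℕ) ≠ 0 := by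
    intro g hg
    by_contra hc
    push Not at hc
    refine hg (R.La_span g.1 fun q x => ?_)
    have := congrArg (fun p => Polynomial.coeff p q) (hc x)
    simp only [Polynomial.finsetSum_coeff, Polynomial.coeff_C_mul, Polynomial.coeff_X_pow, Polynomial.coeff_zero] at this
    rw [Finset.sum_eq_single q] at this
    · rwa [if_pos rfl, mul_one, sub_eq_zero] at this
    · intro j _ hj
      rw [if_neg (fun hh => hj (Fin.ext hh.symm)), mul_zero]
    · simp
  choose! x hP using h1
  let P : R.G → Polynomial ℂ := fun g => ∑ j : Fin R.n, Polynomial.C (R.La j (g.1 (x g)) - R.La j (x g)) * Polynomial.X ^ (j : ℕ)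
  let PP : Polynomial ℂ := ∏ g : R.G, if g.1 = 1 then 1 else P g
  have hPP : PP ≠ 0 := Finset.prod_ne_zero_iff.2 fun g _ => by
    split_ifs with hg
    · exact one_ne_zero
    · exact hP g hg
  obtain ⟨t, ht⟩ : ∃ t : ℕ, PP.eval (t : ℂ) ≠ 0 := by
    by_contra hc
    push Not at hc
    apply hPP
    apply Polynomial.eq_zero_of_infinite_isRoot
    exact (Set.infinite_range_of_injective (f := fun t : ℕ => (t : ℂ)) Nat.cast_injective).mono (by rintro _ ⟨t, rfl⟩; exact hc t)
  refine ⟨fun j => t ^ (j : ℕ), fun g hg hgl => ?_⟩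
  by_contra hne
  apply ht
  rw [Polynomial.eval_prod]
  refine Finset.prod_eq_zero (Finset.mem_univ ⟨g, hg⟩) ?_
  rw [if_neg hne]
  have h2 := LinearMap.congr_fun hgl (x ⟨g, hg⟩)
  simp only [lam, LinearMap.comp_apply, LinearMap.sum_apply, LinearMap.smul_apply, smul_eq_mul, LinearEquiv.coe_coe] at h2
  simp only [P, Polynomial.eval_finsetSum, Polynomial.eval_mul, Polynomial.eval_C, Polynomial.eval_pow, Polynomial.eval_X, sub_mul, Finset.sum_sub_distrib]
  rw [sub_eq_zero]
  push_cast at h2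
  simpa [mul_comm] using h2


lemma G_W2 (γ : R.T ≃ₗ[ℂ] R.T) (hγ : γ ∈ R.G) : γ ∈ R.W2 := by
  classical
  have := Fintype.ofFinite R.G
  obtain ⟨m, hm⟩ := R.exists_gen
  obtain ⟨N, ρ, ω, hρ, hω, hpos, k0, hk0⟩ := R.exists_V m
  set lm := R.lam m with hlm
  let h' : R.T := ⟨h, R.hT⟩
  have hc : ∀ g : R.G, ∃ c : Fin R.n → ℕ, (∀ i, c i ≠ 0 → R.d i = 1) ∧ ∀ x, lm (g.1 x) = lm x - ∑ i, (c i : ℂ) * R.wt i x := by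
    intro g
    obtain ⟨j, hj⟩ := R.G_perm ρ ω hρ hω g.1 g.2 k0
    obtain ⟨c, hc, hcj⟩ := hpos j
    refine ⟨c, hc, fun x => ?_⟩
    have h1 := LinearMap.congr_fun hj x
    have h2 := LinearMap.congr_fun hcj x
    rw [hk0] at h1
    simp only [LinearMap.sub_apply, LinearMap.sum_apply, LinearMap.smul_apply, nsmul_eq_mul] at h2
    rw [← h2, ← h1]
    simp
  choose c hc1 hc2 using hc
  have hh : ∀ g : R.G, lm (g.1 h') = lm h' - 2 * ((∑ i, c g i : ℕ) : ℂ) := by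
    intro g
    rw [hc2]
    congr 1
    push_cast
    rw [Finset.mul_sum]
    refine Finset.sum_congr rfl fun i _ => ?_
    rw [R.wth]
    by_cases h0 : c g i = 0
    · simp [h0]
    · rw [hc1 g i h0]; push_cast; ring
  -- reflections
  have hs : ∀ (g : R.G) (i) (hi : R.d i = 1), ((∑ j, c (g * ⟨_, R.sr_mem i hi⟩) j : ℕ) : ℂ) = ((∑ j, c g j : ℕ) : ℂ) + lm (g.1 (R.cor i)) := by
    intro g i hi
    have h1 := hh (g * ⟨_, R.sr_mem i hi⟩)
    have h2 := hh g
    have h3 : (g * ⟨_, R.sr_mem i hi⟩ : R.G).1 h' = g.1 h' - (2:ℂ) • g.1 (R.cor i) := by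
      change g.1 (R.sr i hi h') = _
      rw [sr_apply, map_sub, map_smul, R.wth, hi]; simp
    rw [h3, map_sub, map_smul, h2, smul_eq_mul] at h1
    linear_combination (1/2 : ℂ) * h1
  -- minimal element
  obtain ⟨w, hw⟩ : ∃ w : R.W2, ∀ w' : R.W2, ∑ j, c (⟨γ, hγ⟩ * ⟨w.1, R.W2_le w.2⟩) j ≤ ∑ j, c (⟨γ, hγ⟩ * ⟨w'.1, R.W2_le w'.2⟩) j := by
    have hne : (Set.range fun w : R.W2 => ∑ j, c (⟨γ, hγ⟩ * ⟨w.1, R.W2_le w.2⟩) j).Nonempty := Set.range_nonempty _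
    obtain ⟨_, ⟨w, rfl⟩, hw⟩ := Nat.lt_wfRel.wf.has_min _ hne
    exact ⟨w, fun w' => not_lt.1 (hw _ ⟨w', rfl⟩)⟩
  set g : R.G := ⟨γ, hγ⟩ * ⟨w.1, R.W2_le w.2⟩ with hg
  have hmu : ∀ i, R.d i = 1 → ∃ a : ℕ, lm (g.1 (R.cor i)) = a := by
    intro i hi
    have h1 := hs g i hi
    have h2 := hw (w * ⟨_, Subgroup.subset_closure ⟨i, hi, rfl⟩⟩)
    have h3 : (⟨γ, hγ⟩ * ⟨(w * ⟨R.sr i hi, Subgroup.subset_closure ⟨i, hi, rfl⟩⟩ : R.W2).1, R.W2_le (Subtype.mem _)⟩ : R.G) = g * ⟨_, R.sr_mem i hi⟩ := by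
      rw [hg, mul_assoc]; rfl
    rw [h3] at h2
    obtain ⟨a, ha⟩ := Nat.exists_eq_add_of_le h2
    refine ⟨a, ?_⟩
    rw [ha] at h1
    push_cast at h1
    linear_combination -h1
  have hla : ∀ i, R.d i = 1 → ∃ a : ℕ, lm (R.cor i) = a ∧ 0 < a := by
    intro i hi
    have h1 := hs 1 i hi
    have h0 : ∑ j, c 1 j = 0 := by
      have := hh 1
      have h2 : (1 : R.G).1 h' = h' := rfl
      rw [h2] at this
      have h3 : ((∑ j, c 1 j : ℕ) : ℂ) = 0 := by linear_combination (1/2:ℂ) * this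
      exact_mod_cast h3
    rw [h0, one_mul] at h1
    have h2 : (1 : R.G).1 (R.cor i) = R.cor i := rfl
    rw [h2] at h1
    refine ⟨∑ j, c ⟨_, R.sr_mem i hi⟩ j, by rw [h1]; simp, ?_⟩
    rw [Nat.pos_iff_ne_zero]
    intro hz
    rw [hz] at h1
    have hlz : lm (R.cor i) = 0 := by push_cast at h1; linear_combination -h1
    have := hm _ (R.sr_mem i hi) (by
      ext x
      change lm (R.sr i hi x) = lm x
      rw [sr_apply, map_sub, map_smul, hlz, smul_zero, sub_zero])
    have h4 := congrArg (fun t : R.T ≃ₗ[ℂ] R.T => R.wt i (t (R.cor i))) this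
    simp only [sr_apply, map_sub, map_smul, R.cor_2 hi, smul_eq_mul] at h4
    change _ = R.wt i (R.cor i) at h4
    rw [R.cor_2 hi] at h4
    norm_num at h4
  let Bf : Module.Dual ℂ R.T → Module.Dual ℂ R.T → ℂ := fun φ ψ => ∑ x : R.G, φ (x.1 h') * ψ (x.1 h')
  have hBinv : ∀ φ ψ (t : R.G), Bf (φ ∘ₗ t.1.toLinearMap) (ψ ∘ₗ t.1.toLinearMap) = Bf φ ψ := by
    intro φ ψ t
    exact Fintype.sum_equiv (Equiv.mulLeft t) _ _ (fun x => rfl)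
  have hBadd : ∀ φ ψ ν, Bf φ (ψ + ν) = Bf φ ψ + Bf φ ν := by
    intro φ ψ ν; simp [Bf, mul_add, Finset.sum_add_distrib]
  have hBnn : ∀ i, R.d i = 1 → ∃ a : ℕ, Bf (R.wt i) (R.wt i) = a ∧ 0 < a := by
    intro i hi
    choose j hj using fun t : R.G => R.G_wt t.1 t.2 i
    have hj' : ∀ t : R.G, R.wt i (t.1 h') = 2 * (R.d (j t) : ℂ) := by
      intro t; rw [← R.wth, ← hj]; rfl
    refine ⟨(∑ t : R.G, 4 * (R.d (j t))^2).toNat, ?_, ?_⟩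
    · have : 0 ≤ ∑ t : R.G, 4 * (R.d (j t))^2 := Finset.sum_nonneg fun _ _ => by positivity
      have h5 : (((∑ t : R.G, 4 * (R.d (j t))^2).toNat : ℤ) : ℂ) = ((∑ t : R.G, 4 * (R.d (j t))^2 : ℤ) : ℂ) := by rw [Int.toNat_of_nonneg this]
      rw [Int.cast_natCast] at h5
      rw [h5]
      push_cast
      refine Finset.sum_congr rfl fun t _ => ?_
      rw [hj']; ring
    · rw [Int.lt_toNat]
      refine Finset.sum_pos' (fun _ _ => by positivity) ⟨1, Finset.mem_univ _, ?_⟩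
      have h1 := hj' 1
      have h2 : (1 : R.G).1 h' = h' := rfl
      rw [h2, R.wth, hi] at h1
      have : R.d (j 1) = 1 := by
        have h3 : (R.d (j 1) : ℂ) = 1 := by push_cast at h1; linear_combination (-1/2:ℂ) * h1
        exact_mod_cast h3
      rw [this]; norm_num
  have hBr : ∀ i (_ : R.d i = 1) ν, 2 * Bf (R.wt i) ν = ν (R.cor i) * Bf (R.wt i) (R.wt i) := by
    intro i hi ν
    have h1 := hBinv (R.wt i) ν ⟨_, R.sr_mem i hi⟩
    have h2 : R.wt i ∘ₗ (R.sr i hi).toLinearMap = (-1 : ℂ) • R.wt i := by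
      ext x; simp [sr_apply, R.cor_2 hi]; ring
    have h3 : ν ∘ₗ (R.sr i hi).toLinearMap = ν - ν (R.cor i) • R.wt i := by
      ext x; simp [sr_apply]; ring
    simp only [h2, h3] at h1
    have h4 : Bf ((-1 : ℂ) • R.wt i) (ν - ν (R.cor i) • R.wt i) = - Bf (R.wt i) ν + ν (R.cor i) * Bf (R.wt i) (R.wt i) := by
      simp only [Bf, Finset.mul_sum, ← Finset.sum_neg_distrib, ← Finset.sum_add_distrib]
      refine Finset.sum_congr rfl fun x _ => ?_
      simp; ring
    rw [h4] at h1
    linear_combination - h1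
  let mu := lm ∘ₗ g.1.toLinearMap
  have h0 : Bf (lm - mu) (lm + mu) = 0 := by
    have h1 := hBinv lm lm g
    have h2 : Bf (lm - mu) (lm + mu) = Bf lm lm - Bf mu mu := by
      simp only [Bf, ← Finset.sum_sub_distrib]
      refine Finset.sum_congr rfl fun x _ => ?_
      simp; ring
    rw [h2, sub_eq_zero]; exact h1.symm
  have hlmu : ∀ x, (lm - mu) x = ∑ i, (c g i : ℂ) * R.wt i x := by
    intro x
    change lm x - lm (g.1 x) = _
    rw [hc2]; ring
  have h1 : Bf (lm - mu) (lm + mu) = ∑ i, (c g i : ℂ) * Bf (R.wt i) (lm + mu) := by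
    simp only [Bf, hlmu, Finset.mul_sum, Finset.sum_mul]
    rw [Finset.sum_comm]
    exact Finset.sum_congr rfl fun _ _ => Finset.sum_congr rfl fun _ _ => by ring
  have hterm : ∀ i, ∃ a : ℕ, 2 * ((c g i : ℂ) * Bf (R.wt i) (lm + mu)) = a ∧ (a = 0 → c g i = 0) := by
    intro i
    by_cases hz : c g i = 0
    · exact ⟨0, by simp [hz], fun _ => hz⟩
    · have hi := hc1 g i hz
      obtain ⟨a, ha⟩ := hmu i hi
      obtain ⟨a', ha', hp⟩ := hla i hi
      obtain ⟨a'', ha'', hp''⟩ := hBnn i hi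
      refine ⟨c g i * ((a' + a) * a''), ?_, fun h => ?_⟩
      · have := hBr i hi (lm + mu)
        have h5 : (lm + mu) (R.cor i) = a' + a := by
          rw [← ha', ← ha]; rfl
        rw [h5, ha''] at this
        push_cast
        rw [← this]; ring
      · have : 0 < c g i * ((a' + a) * a'') := by positivity
        omega
  choose a ha ha0 using hterm
  have hsum : ∑ i, a i = 0 := by
    have : ((∑ i, a i : ℕ) : ℂ) = 0 := by
      push_cast
      simp only [← ha]
      rw [← Finset.mul_sum, ← h1, h0, mul_zero]
    exact_mod_cast this
  have hcz : ∀ i, c g i = 0 := fun i => ha0 i (by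
    have := Finset.sum_eq_zero_iff.1 hsum i (Finset.mem_univ i)
    exact this)
  have hg1 : g.1 = 1 := hm g.1 g.2 (by
    ext x
    change lm (g.1 x) = lm x
    rw [hc2]; simp [hcz])
  have : γ * w.1 = 1 := hg1
  rw [eq_inv_of_mul_eq_one_left this]
  exact R.W2.inv_mem w.2

end RD
end Kos

namespace Kos
open MvPolynomial

section gal
variable {τ : Type*} (A : Subalgebra ℂ (MvPolynomial τ ℂ)) {n : ℕ}
  (ℓ : Fin n → MvPolynomial τ ℂ)

lemma gal_int (hX : ∀ j, X j ∈ Submodule.span ℂ (Set.range ℓ))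
    (hA : ∀ k, (∏ i, (Polynomial.X - Polynomial.C (ℓ i))).coeff k ∈ A) (p : MvPolynomial τ ℂ) : IsIntegral A p := by
  have h1 : ∀ i, IsIntegral A (ℓ i) := by
    intro i
    have hl : (∏ i, (Polynomial.X - Polynomial.C (ℓ i))) ∈ Polynomial.lifts (algebraMap A (MvPolynomial τ ℂ)) := by
      rw [Polynomial.lifts_iff_coeff_lifts]
      exact fun k => ⟨⟨_, hA k⟩, rfl⟩
    obtain ⟨q, hq, -, hm⟩ := Polynomial.lifts_and_natDegree_eq_and_monic hl (Polynomial.monic_prod_X_sub_C _ _)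
    refine ⟨q, hm, ?_⟩
    rw [← Polynomial.eval_map, hq, Polynomial.eval_prod]
    exact Finset.prod_eq_zero (Finset.mem_univ i) (by simp)
  have h2 : ∀ j, IsIntegral A (X j : MvPolynomial τ ℂ) := by
    intro j
    have : Submodule.span ℂ (Set.range ℓ) ≤ Subalgebra.toSubmodule ((integralClosure A (MvPolynomial τ ℂ)).restrictScalars ℂ) := by
      refine Submodule.span_le.2 ?_
      rintro _ ⟨i, rfl⟩
      exact h1 i
    exact this (hX j)
  induction p using MvPolynomial.induction_on with
  | C a => exact isIntegral_algebraMap (R := A) (x := algebraMap ℂ A a)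
  | add p q hp hq => exact hp.add hq
  | mul_X p i hp => exact hp.mul (h2 i)

theorem gal_frac (hℓ : ∀ i, ℓ i ∈ Submodule.span ℂ (Set.range X)) (hX : ∀ j, X j ∈ Submodule.span ℂ (Set.range ℓ))
    (hA : ∀ k, (∏ i, (Polynomial.X - Polynomial.C (ℓ i))).coeff k ∈ A) (p : MvPolynomial τ ℂ)
    (hp : ∀ σ : MvPolynomial τ ℂ →ₐ[ℂ] MvPolynomial τ ℂ, (∀ a ∈ A, σ a = a) →
      (∀ j, σ (X j) ∈ Submodule.span ℂ (Set.range X)) → σ p = p) :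
    ∃ a ∈ A, ∃ c ∈ A, c ≠ 0 ∧ c * p = a := by
  classical
  let Q := MvPolynomial τ ℂ
  let K := FractionRing Q
  let am : Q →ₐ[ℂ] K := IsScalarTower.toAlgHom ℂ Q K
  have hinj : Function.Injective am := IsFractionRing.injective Q K
  let F : IntermediateField ℂ K := IntermediateField.adjoin ℂ (A.map am : Set K)
  have hAF : ∀ a ∈ A, am a ∈ F := fun a ha => IntermediateField.subset_adjoin _ _ ⟨a, ha, rfl⟩
  let f : Polynomial K := ∏ i, (Polynomial.X - Polynomial.C (am (ℓ i)))
  have hf : f = (∏ i, (Polynomial.X - Polynomial.C (ℓ i))).map (am : Q →+* K) := by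
    simp [f, Polynomial.map_prod]
  obtain ⟨q, hq⟩ : ∃ q : Polynomial F, q.map (algebraMap F K) = f := by
    have hl : f ∈ Polynomial.lifts (algebraMap F K) := by
      rw [Polynomial.lifts_iff_coeff_lifts]
      intro k
      rw [hf, Polynomial.coeff_map]
      exact ⟨⟨_, hAF _ (hA k)⟩, rfl⟩
    exact (Polynomial.mem_lifts f).1 hl
  have hmon : f.Monic := Polynomial.monic_prod_X_sub_C _ _
  have hq0 : q ≠ 0 := by
    rintro rfl
    rw [Polynomial.map_zero] at hq
    exact hmon.ne_zero hq.symm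
  have hroot : ∀ x : K, Polynomial.aeval x q = 0 ↔ ∃ i, x = am (ℓ i) := by
    intro x
    rw [Polynomial.aeval_def, ← Polynomial.eval_map, hq, Polynomial.eval_prod, Finset.prod_eq_zero_iff]
    simp [sub_eq_zero]
  have hsp : q.IsSplittingField F K := by
    rw [isSplittingField_iff_intermediateField]
    constructor
    · rw [hq]
      exact Polynomial.Splits.prod fun i _ => Polynomial.Splits.X_sub_C _
    · rw [eq_top_iff]
      intro x _
      set F' := IntermediateField.adjoin F (q.rootSet K)
      have hs : ∀ y ∈ Submodule.span ℂ (Set.range ℓ), am y ∈ F' := by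
        intro y hy
        have : Submodule.span ℂ (Set.range ℓ) ≤ Submodule.comap am.toLinearMap (Subalgebra.toSubmodule (F'.toSubalgebra.restrictScalars ℂ)) := by
          refine Submodule.span_le.2 ?_
          rintro _ ⟨i, rfl⟩
          exact IntermediateField.subset_adjoin _ _ ((Polynomial.mem_rootSet').2 ⟨by rw [hq]; exact hmon.ne_zero, (hroot _).2 ⟨i, rfl⟩⟩)
        exact this hy
      have hall : ∀ y : Q, am y ∈ F' := by
        intro y
        induction y using MvPolynomial.induction_on with
        | C a => exact (F'.toSubalgebra.restrictScalars ℂ).algebraMap_mem a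
        | add p q hp hq => rw [map_add]; exact F'.add_mem hp hq
        | mul_X p i hp => rw [map_mul]; exact F'.mul_mem hp (hs _ (hX i))
      obtain ⟨y, z, -, rfl⟩ := IsFractionRing.div_surjective (A := Q) x
      exact F'.div_mem (hall y) (hall z)
  have hnorm : Normal F K := Normal.of_isSplittingField q
  have hfd : FiniteDimensional F K := Polynomial.IsSplittingField.finiteDimensional K q
  have hgal : IsGalois F K := isGalois_iff.2 ⟨inferInstance, hnorm⟩
  have hfix : ∀ γ : K ≃ₐ[F] K, γ (am p) = am p := by
    intro γ
    have hspan : ∀ y ∈ Submodule.span ℂ (Set.range ℓ), ∃ z ∈ Submodule.span ℂ (Set.range (X : τ → Q)), γ (am y) = am z := by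
      intro y hy
      have : Submodule.span ℂ (Set.range ℓ) ≤ Submodule.comap ((γ.restrictScalars ℂ).toLinearMap ∘ₗ am.toLinearMap) (Submodule.map am.toLinearMap (Submodule.span ℂ (Set.range (X : τ → Q)))) := by
        refine Submodule.span_le.2 ?_
        rintro _ ⟨i, rfl⟩
        have h1 : Polynomial.aeval (γ (am (ℓ i))) q = 0 := by
          have h2 := Polynomial.aeval_algHom_apply γ.toAlgHom (am (ℓ i)) q
          rw [(hroot _).2 ⟨i, rfl⟩, map_zero] at h2
          exact h2
        obtain ⟨j, hj⟩ := (hroot _).1 h1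
        exact ⟨ℓ j, hℓ j, hj.symm⟩
      obtain ⟨z, hz, hzz⟩ := this hy
      exact ⟨z, hz, hzz.symm⟩
    choose z hz hγ using fun j => hspan _ (hX j)
    let σ : Q →ₐ[ℂ] Q := aeval z
    have hσ : ∀ y, am (σ y) = γ (am y) := by
      have : am.comp σ = ((γ.restrictScalars ℂ).toAlgHom).comp am := by
        apply MvPolynomial.algHom_ext
        intro j
        simp only [AlgHom.comp_apply, σ, aeval_X]
        exact (hγ j).symm
      exact fun y => AlgHom.congr_fun this y
    rw [← hσ, hp σ]
    · intro a ha
      apply hinj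
      rw [hσ]
      exact γ.commutes ⟨am a, hAF a ha⟩
    · intro j
      simp only [σ, aeval_X]; exact hz j
  have hbot := (IsGalois.mem_bot_iff_fixed (F := F) (am p)).2 hfix
  obtain ⟨⟨y, hyF⟩, hy⟩ := IntermediateField.mem_bot.1 hbot
  change y = am p at hy
  rw [hy] at hyF
  obtain ⟨r, hr, s, hs, hrs⟩ := IntermediateField.mem_adjoin_iff_div.1 hyF
  rw [Algebra.adjoin_eq] at hr hs
  obtain ⟨a, ha, rfl⟩ := hr
  obtain ⟨c, hc, rfl⟩ := hs
  by_cases hc0 : c = 0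
  · refine ⟨0, A.zero_mem, 1, A.one_mem, one_ne_zero, ?_⟩
    apply hinj
    rw [one_mul, hrs, hc0]; simp
  · refine ⟨a, ha, c, hc, hc0, ?_⟩
    apply hinj
    rw [map_mul, hrs]
    exact mul_div_cancel₀ _ ((map_ne_zero_iff am hinj).2 hc0)

end gal
end Kos

namespace Kos
open MvPolynomial
namespace RD
variable {L : Type*} [LieRing L] [LieAlgebra ℂ L] [FiniteDimensional ℂ L] [LieAlgebra.IsKilling ℂ L]
  {e h : L} (R : RD L e h)

noncomputable abbrev rk := Module.finrank ℂ R.T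
noncomputable def bt : Module.Basis (Fin R.rk) ℂ R.T := Module.finBasis ℂ R.T

noncomputable def lf : Module.Dual ℂ R.T →ₗ[ℂ] MvPolynomial (Fin R.rk) ℂ where
  toFun φ := ∑ j, φ (R.bt j) • X j
  map_add' φ ψ := by simp [add_smul, Finset.sum_add_distrib]
  map_smul' c φ := by simp [mul_smul, Finset.smul_sum]

noncomputable def pt (x : Fin R.rk → ℂ) : R.T := ∑ j, x j • R.bt j

lemma pt_surj (y : R.T) : ∃ x, R.pt x = y := ⟨fun j => R.bt.repr y j, R.bt.sum_repr y⟩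

lemma eval_lf (φ) (x) : eval x (R.lf φ) = φ (R.pt x) := by
  simp [lf, pt, smul_eval, mul_comm]

lemma lf_coord (j) : R.lf (R.bt.coord j) = X j := by
  simp only [lf, LinearMap.coe_mk, AddHom.coe_mk, Module.Basis.coord_apply, Module.Basis.repr_self]
  rw [Finset.sum_eq_single j]
  · simp
  · intro k _ hk
    rw [Finsupp.single_eq_of_ne (Ne.symm hk), zero_smul]
  · simp

lemma lf_span (φ) : R.lf φ ∈ Submodule.span ℂ (Set.range (X : Fin R.rk → MvPolynomial (Fin R.rk) ℂ)) :=
  by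
  change ∑ j, φ (R.bt j) • X j ∈ _
  exact Submodule.sum_mem _ fun j _ => Submodule.smul_mem _ _ (Submodule.subset_span ⟨j, rfl⟩)

lemma span_lf {y} (hy : y ∈ Submodule.span ℂ (Set.range (X : Fin R.rk → MvPolynomial (Fin R.rk) ℂ))) :
    ∃ φ, y = R.lf φ := by
  have : Submodule.span ℂ (Set.range (X : Fin R.rk → MvPolynomial (Fin R.rk) ℂ)) ≤ LinearMap.range R.lf := by
    refine Submodule.span_le.2 ?_
    rintro _ ⟨j, rfl⟩
    exact ⟨_, R.lf_coord j⟩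
  obtain ⟨φ, hφ⟩ := this hy
  exact ⟨φ, hφ.symm⟩

lemma wt_span : Submodule.span ℂ (Set.range R.wt) = ⊤ := by
  rw [← Subspace.dualCoannihilator_dualAnnihilator_eq (W := Submodule.span ℂ (Set.range R.wt))]
  have : (Submodule.span ℂ (Set.range R.wt)).dualCoannihilator = ⊥ := by
    rw [eq_bot_iff]
    intro x hx
    rw [Submodule.mem_dualCoannihilator] at hx
    exact R.sep x fun i => hx _ (Submodule.subset_span ⟨i, rfl⟩)
  rw [this, Submodule.dualAnnihilator_bot]

noncomputable def res (v : L) : MvPolynomial (Fin R.n) ℂ →ₐ[ℂ] MvPolynomial (Fin R.rk) ℂ :=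
  aeval fun i => C (killingForm ℂ L (R.b i) v) + R.lf (killingForm ℂ L (R.b i) ∘ₗ R.T.toSubmodule.subtype)

lemma eval_res (v : L) (x) (p) : eval x (R.res v p) = evp R.b (v + R.pt x) p := by
  have : ((aeval x : _ →ₐ[ℂ] ℂ)).comp (R.res v) = evp R.b (v + R.pt x) := by
    apply MvPolynomial.algHom_ext
    intro i
    simp only [AlgHom.comp_apply, res, aeval_X, evp_X, map_add, aeval_C]
    congr 1
    exact R.eval_lf _ x
  exact AlgHom.congr_fun this p

lemma W2_inv (s) (hs : R.KilledOn s) (g) (hg : g ∈ R.W2) : ∀ x : R.T, evp R.b (e + (g x : R.T)) s = evp R.b (e + x) s := by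
  induction hg using Subgroup.closure_induction with
  | mem g hg =>
    obtain ⟨i, hi, rfl⟩ := hg
    intro x
    rw [sr_apply, ← R.cor_inv hi s hs x]
  | one => intro x; rfl
  | mul a b _ _ ha hb => intro x; exact (ha (b x)).trans (hb x)
  | inv a _ ha =>
    intro x
    have := ha (a⁻¹ x)
    rw [← this]
    congr 3
    exact congrArg Subtype.val (a.apply_symm_apply x)

theorem C2 (s) (hs : R.KilledOn s) : ∃ p ∈ Inv R.b, ∀ v ∈ R.E, evp R.b v p = evp R.b v s := by
  classical
  have hcart := R.cart
  set A := (Inv R.b).map (R.res 0) with hAdef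
  set ℓ := fun i => R.lf (R.wt i) with hℓdef
  have hinj : ∀ p ∈ Inv R.b, R.res 0 p = 0 → p = 0 := by
    intro p hp h0
    apply chev_inj R.b R.T p hp
    intro x hx
    obtain ⟨c, hc⟩ := R.pt_surj ⟨x, hx⟩
    have := R.eval_res 0 c p
    rw [h0, map_zero, hc, zero_add] at this
    exact this.symm
  have hX : ∀ j, X j ∈ Submodule.span ℂ (Set.range ℓ) := by
    intro j
    have : R.bt.coord j ∈ Submodule.span ℂ (Set.range R.wt) := by rw [R.wt_span]; trivial
    have := Submodule.mem_map_of_mem (f := R.lf) this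
    rw [lf_coord, Submodule.map_span, ← Set.range_comp] at this
    exact this
  have hA : ∀ k, (∏ i, (Polynomial.X - Polynomial.C (ℓ i))).coeff k ∈ A := by
    intro k
    obtain ⟨p, hp, hpv⟩ := exists_inv R.b (adM R.b) (adM_lie R.b) k
    refine ⟨p, hp, ?_⟩
    apply MvPolynomial.funext
    intro x
    change eval x (R.res 0 p) = _
    rw [eval_res, hpv, zero_add, ad_charpoly, ← Polynomial.coeff_map, Polynomial.map_prod]
    simp [ℓ, eval_lf]
  have hfix : ∀ σ : MvPolynomial (Fin R.rk) ℂ →ₐ[ℂ] MvPolynomial (Fin R.rk) ℂ, (∀ a ∈ A, σ a = a) →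
      (∀ j, σ (X j) ∈ Submodule.span ℂ (Set.range X)) → σ (R.res e s) = R.res e s := by
    intro σ hσ hσX
    choose φ hφ using fun j => R.span_lf (hσX j)
    let g : R.T →ₗ[ℂ] R.T := ∑ j, (φ j).smulRight (R.bt j)
    have hg : ∀ q x, eval x (σ q) = eval (fun j => φ j (R.pt x)) q := by
      intro q x
      have : ((aeval x : _ →ₐ[ℂ] ℂ)).comp σ = aeval (fun j => φ j (R.pt x)) := by
        apply MvPolynomial.algHom_ext
        intro j
        simp only [AlgHom.comp_apply, aeval_X, hφ]
        exact R.eval_lf _ x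
      exact AlgHom.congr_fun this q
    have hpt : ∀ x, R.pt (fun j => φ j (R.pt x)) = g (R.pt x) := by
      intro x
      simp only [g, LinearMap.sum_apply, LinearMap.smulRight_apply]
      rfl
    have hginv : ∀ p ∈ Inv R.b, ∀ x : R.T, evp R.b (g x : R.T) p = evp R.b (x : L) p := by
      intro p hp x
      obtain ⟨c, rfl⟩ := R.pt_surj x
      have h1 := congrArg (eval c) (hσ _ ⟨p, hp, rfl⟩)
      change eval c (σ (R.res 0 p)) = eval c (R.res 0 p) at h1
      rw [hg, eval_res, eval_res, hpt, zero_add, zero_add] at h1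
      exact h1
    have hginj : Function.Injective g := by
      rw [injective_iff_map_eq_zero]
      intro x hx
      apply R.sep
      intro i
      have hch : (adM R.b x).charpoly = (adM R.b (0 : R.T)).charpoly := by
        ext k
        obtain ⟨p, hp, hpv⟩ := exists_inv R.b (adM R.b) (adM_lie R.b) k
        rw [← hpv, ← hpv, ← hginv p hp x, hx]
      rw [ad_charpoly, ad_charpoly] at hch
      have := congrArg (Polynomial.eval (R.wt i x)) hch
      rw [Polynomial.eval_prod, Finset.prod_eq_zero (Finset.mem_univ i) (by simp)] at this
      simp only [map_zero, sub_zero, Finset.prod_const, Polynomial.eval_pow, Polynomial.eval_X] at this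
      exact eq_zero_of_pow_eq_zero this.symm
    let γ := LinearEquiv.ofInjectiveEndo g hginj
    have hγ : γ ∈ R.W2 := R.G_W2 γ hginv
    apply MvPolynomial.funext
    intro x
    rw [hg, eval_res, eval_res, hpt]
    exact R.W2_inv s hs γ hγ (R.pt x)
  obtain ⟨a, ⟨a', ha', haa⟩, c, ⟨c', hc', hcc⟩, hc0, hca⟩ := gal_frac A ℓ (fun i => R.lf_span _) hX hA _ hfix
  change R.res 0 a' = a at haa
  change R.res 0 c' = c at hcc
  have hc'0 : c' ≠ 0 := by rintro rfl; rw [map_zero] at hcc; exact hc0 hcc.symm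
  obtain ⟨q, hqm, hq⟩ := gal_int A ℓ hX hA (R.res e s)
  -- lift q to Inv
  let ρ : Inv R.b →ₐ[ℂ] A := ((R.res 0).comp (Inv R.b).val).codRestrict A fun p => ⟨p.1, p.2, rfl⟩
  have hρs : Function.Surjective ρ := by
    rintro ⟨_, p, hp, rfl⟩
    exact ⟨⟨p, hp⟩, rfl⟩
  have hρi : Function.Injective ρ := by
    rw [injective_iff_map_eq_zero]
    intro p hp
    exact Subtype.ext (hinj p.1 p.2 (congrArg Subtype.val hp))
  obtain ⟨q', hq', -, hq'm⟩ := Polynomial.lifts_and_natDegree_eq_and_monic (f := (ρ : Inv R.b →+* A)) (p := q)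
    (by rw [Polynomial.lifts_iff_coeff_lifts]; exact fun k => hρs _) hqm
  -- scaled polynomial vanishes at a'
  have hroot : Polynomial.eval₂ (algebraMap (Inv R.b) (MvPolynomial (Fin R.n) ℂ)) a' (Polynomial.scaleRoots q' ⟨c', hc'⟩) = 0 := by
    have h1 : Polynomial.eval₂ (algebraMap (Inv R.b) (MvPolynomial (Fin R.n) ℂ)) a' (Polynomial.scaleRoots q' ⟨c', hc'⟩) ∈ Inv R.b := by
      have := Polynomial.eval₂_at_apply (p := Polynomial.scaleRoots q' ⟨c', hc'⟩) (algebraMap (Inv R.b) (MvPolynomial (Fin R.n) ℂ)) ⟨a', ha'⟩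
      change Polynomial.eval₂ _ a' _ = _ at this
      rw [this]
      exact Subtype.mem _
    apply hinj _ h1
    have h2 := Polynomial.hom_eval₂ (Polynomial.scaleRoots q' ⟨c', hc'⟩) (algebraMap (Inv R.b) (MvPolynomial (Fin R.n) ℂ)) (R.res 0 : _ →+* MvPolynomial (Fin R.rk) ℂ) a'
    change R.res 0 _ = Polynomial.eval₂ _ (R.res 0 a') _ at h2
    rw [h2, haa, ← hca]
    have h3 := Polynomial.scaleRoots_eval₂_eq_zero (p := q') (s := ⟨c', hc'⟩) (r := R.res e s)
      ((R.res 0 : _ →+* MvPolynomial (Fin R.rk) ℂ).comp (algebraMap (Inv R.b) (MvPolynomial (Fin R.n) ℂ))) ?_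
    · change Polynomial.eval₂ _ (R.res 0 c' * _) _ = 0 at h3
      rwa [hcc] at h3
    · rw [← hq', Polynomial.eval₂_map] at hq
      exact hq
  have hdiv : ∃ z, c' * z = a' := by
    let am := algebraMap (MvPolynomial (Fin R.n) ℂ) (FractionRing (MvPolynomial (Fin R.n) ℂ))
    have hami : Function.Injective am := IsFractionRing.injective _ _
    have hc'1 : am c' ≠ 0 := (map_ne_zero_iff am hami).2 hc'0
    let x := am a' / am c'
    have h1 := congrArg am hroot
    rw [Polynomial.hom_eval₂, map_zero] at h1
    have h2 := Polynomial.scaleRoots_eval₂_mul (p := q') (am.comp (algebraMap (Inv R.b) (MvPolynomial (Fin R.n) ℂ))) x ⟨c', hc'⟩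
    change Polynomial.eval₂ _ (am c' * (am a' / am c')) _ = am c' ^ _ * _ at h2
    rw [mul_div_cancel₀ _ hc'1, h1] at h2
    have h3 := (mul_eq_zero.1 h2.symm).resolve_left (pow_ne_zero _ hc'1)
    have h4 : IsIntegral (MvPolynomial (Fin R.n) ℂ) x :=
      ⟨q'.map (algebraMap (Inv R.b) (MvPolynomial (Fin R.n) ℂ)), hq'm.map _, by rw [Polynomial.eval₂_map]; exact h3⟩
    obtain ⟨z, hz⟩ := IsIntegrallyClosed.isIntegral_iff.1 h4
    refine ⟨z, hami ?_⟩
    rw [map_mul]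
    change am c' * am z = _
    rw [show am z = x from hz]
    exact mul_div_cancel₀ _ hc'1
  obtain ⟨z, hz⟩ := hdiv
  have hzI : z ∈ Inv R.b := by
    intro x
    have h1 : DP R.b x (c' * z) = 0 := by rw [hz]; exact ha' x
    rw [Derivation.leibniz, hc' x, smul_zero, add_zero, smul_eq_mul] at h1
    exact (mul_eq_zero.1 h1).resolve_left hc'0
  have hzr : R.res 0 z = R.res e s := by
    apply mul_left_cancel₀ hc0
    rw [hca, ← haa, ← hz, map_mul, hcc]
  refine ⟨z, hzI, ?_⟩
  have hk : R.KilledOn (z - s) := by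
    intro a ha v hv
    rw [map_sub, map_sub, hzI a, hs a ha v hv]; simp
  have := R.miura (z - s) hk ?_
  · intro v hv
    have := this v hv
    rwa [map_sub, sub_eq_zero] at this
  · intro x hx
    obtain ⟨c, hc⟩ := R.pt_surj ⟨x, hx⟩
    have := congrArg (eval c) hzr
    rw [eval_res, eval_res, hc, zero_add] at this
    rw [map_sub, R.inv_shift z hzI x hx]
    exact sub_eq_zero.2 this
end RD
end Kos

namespace Kos
open MvPolynomial
namespace RD
variable {L : Type*} [LieRing L] [LieAlgebra ℂ L] [FiniteDimensional ℂ L] [LieAlgebra.IsKilling ℂ L]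
  {e h : L} (R : RD L e h)

abbrev PP := MvPolynomial (Fin R.n) ℂ
abbrev SS := MvPolynomial (Fin R.n × Fin R.n) ℂ
abbrev UU (_ : RD L e h) := UniversalEnvelopingAlgebra ℂ L

noncomputable def tr : R.SS := ∑ i, X (i, i)

attribute [local instance 100] LieRing.ofAssociativeRing

noncomputable def actL : L →ₗ⁅ℂ⁆ Module.End ℂ R.SS where
  toFun x := LinearMap.mulLeft ℂ (LS R.b x R.tr) + (LS R.b x).toLinearMap
  map_add' x y := by
    ext s
    simp [LS_add, add_mul]; ring
  map_smul' c x := by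
    ext s
    simp [LS_smul]
  map_lie' := by
    intro x y
    apply LinearMap.ext
    intro s
    rw [LieRing.of_associative_ring_bracket]
    simp only [LinearMap.add_apply, LinearMap.mulLeft_apply, Derivation.coeFn_coe,
      LinearMap.sub_apply, Module.End.mul_apply, LS_lie, Derivation.leibniz, map_add, smul_eq_mul]
    ring

noncomputable def act : R.UU →ₐ[ℂ] Module.End ℂ R.SS := UniversalEnvelopingAlgebra.lift ℂ R.actL

lemma act_ι (x : L) (s) : R.act (UniversalEnvelopingAlgebra.ι ℂ x) s = LS R.b x R.tr * s + LS R.b x s := by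
  rw [act, UniversalEnvelopingAlgebra.lift_ι_apply]; rfl

def kk (i : Fin R.n) : ℤ := R.d i + 1
def ww (q : Fin R.n × Fin R.n) : ℤ := R.d q.1 - R.d q.2 + 1
noncomputable def ch (i : Fin R.n) : ℂ := killingForm ℂ L (R.b i) e

lemma ch_ne {i} (hi : R.ch i ≠ 0) : R.d i = -1 := by
  by_contra hne
  apply hi
  refine R.kf_grx i (· = 1) e (R.mem_gr.2 fun j hj => R.repr_e j hj) ?_
  rintro a rfl; omega

noncomputable def Lam : R.PP →ₐ[ℂ] R.SS := aeval fun l => LS R.b (R.b l) R.tr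

lemma LS_b_X (l i j) : LS R.b (R.b l) (X (i,j)) = ∑ k, adM R.b (R.b l) k i • X (k, j) := LS_X _ _ _ _

lemma Lam_X (l) : R.Lam (X l) = ∑ i, ∑ k, adM R.b (R.b l) k i • X (k, i) := by
  simp [Lam, tr, LS_X]

lemma adM_ne {l k i} (hh : adM R.b (R.b l) k i ≠ 0) : R.d k = R.d l + R.d i := by
  rw [adM_b] at hh; exact R.repr_bb l i k hh

lemma Lam_X_wh (l) : IsWeightedHomogeneous R.ww (R.Lam (X l)) (R.kk l) := by
  rw [Lam_X]
  refine Submodule.sum_mem (weightedHomogeneousSubmodule ℂ R.ww (R.kk l)) fun i _ => Submodule.sum_mem _ fun k _ => ?_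
  by_cases h0 : adM R.b (R.b l) k i = 0
  · rw [h0, zero_smul]; exact Submodule.zero_mem _
  · refine Submodule.smul_mem _ _ ?_
    have := isWeightedHomogeneous_X ℂ R.ww (k, i)
    rw [show R.ww (k, i) = R.kk l by simp only [ww, kk]; rw [R.adM_ne h0]; ring] at this
    exact this

lemma wh_Fil {σ : Type*} (w : σ → ℤ) {p : MvPolynomial σ ℂ} {N : ℤ} (hp : IsWeightedHomogeneous w p N) : p ∈ Fil w N := by
  intro s hs
  exact (hp (mem_support_iff.1 hs)).le

lemma wh_zero {σ : Type*} (w : σ → ℤ) {p : MvPolynomial σ ℂ} {N M : ℤ} (hp : IsWeightedHomogeneous w p N) (hp' : p ∈ Fil w M)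
    (hMN : M < N) : p = 0 := by
  by_contra hne
  obtain ⟨s, hs⟩ := Finset.nonempty_iff_ne_empty.2 (mt support_eq_empty.1 hne)
  have h1 := hp (mem_support_iff.1 hs)
  have h2 := hp' s hs
  omega

lemma wh_aeval {σ τ : Type*} (w : σ → ℤ) (w' : τ → ℤ) (f : σ → MvPolynomial τ ℂ)
    (hf : ∀ i, IsWeightedHomogeneous w' (f i) (w i)) {p : MvPolynomial σ ℂ} {N : ℤ} (hp : IsWeightedHomogeneous w p N) :
    IsWeightedHomogeneous w' (aeval f p) N := by
  have key : ∀ s : σ →₀ ℕ, IsWeightedHomogeneous w' (aeval f (monomial s (1:ℂ))) (Finsupp.weight w s) := by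
    intro s
    induction s using fs_ind with
    | h0 => simpa using isWeightedHomogeneous_one ℂ w'
    | hs s i ih =>
      rw [mon_cons, weight_cons, map_mul, aeval_X]
      exact (hf i).mul ih
  rw [p.as_sum, map_sum]
  refine Submodule.sum_mem (weightedHomogeneousSubmodule ℂ w' N) fun s hs => ?_
  have : monomial s (coeff s p) = coeff s p • monomial s (1:ℂ) := by rw [smul_monomial]; simp
  rw [this, map_smul, ← hp (mem_support_iff.1 hs)]
  exact Submodule.smul_mem _ _ (key s)

lemma Lam_wh {p : R.PP} {N : ℤ} (hp : IsWeightedHomogeneous R.kk p N) : IsWeightedHomogeneous R.ww (R.Lam p) N := by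
  refine wh_aeval R.kk R.ww _ (fun l => ?_) hp
  have := R.Lam_X_wh l
  rwa [Lam, aeval_X] at this

lemma LS_Fil (l) {n : ℤ} {p} (hp : p ∈ Fil R.ww n) : LS R.b (R.b l) p ∈ Fil R.ww (n + R.d l) := by
  refine Fil_der R.ww (LS R.b (R.b l)) (R.d l) ?_ hp
  rintro ⟨i, j⟩
  rw [LS_X]
  refine Submodule.sum_mem _ fun k _ => ?_
  by_cases h0 : adM R.b (R.b l) k i = 0
  · rw [h0, zero_smul]; exact Submodule.zero_mem _
  · refine Submodule.smul_mem _ _ (Fil_le R.ww ?_ (Fil_X R.ww (k, j)))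
    simp only [ww]; rw [R.adM_ne h0]; omega

lemma Lam_inj : Function.Injective R.Lam := by
  have hinj : LinearMap.ker (adM R.b) = ⊥ := by
    rw [eq_bot_iff]
    intro x hx
    rw [LinearMap.mem_ker] at hx
    have h1 : LieAlgebra.ad ℂ L x = 0 := by
      have : LinearMap.toMatrix R.b R.b (LieAlgebra.ad ℂ L x) = 0 := hx
      exact (LinearEquiv.map_eq_zero_iff _).1 this
    rw [Submodule.mem_bot, ← R.b.repr.map_eq_zero_iff]
    have h2 : ∀ y, killingForm ℂ L x y = 0 := by
      intro y
      rw [killingForm_apply_apply, h1]; simp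
    have := (kf_nd (L := L)).1 x h2
    rw [this]; simp
  obtain ⟨r, hr⟩ := LinearMap.exists_leftInverse_of_injective (adM R.b) hinj
  let g : R.SS →ₐ[ℂ] R.PP := aeval fun q => linP R.b (r (Matrix.single q.1 q.2 1))
  have : g.comp R.Lam = AlgHom.id ℂ _ := by
    apply MvPolynomial.algHom_ext
    intro l
    rw [AlgHom.comp_apply, Lam_X]
    simp only [map_sum, map_smul, g, aeval_X, AlgHom.id_apply]
    simp only [← map_smul, ← map_sum]
    have h2 : ∑ i, ∑ k, adM R.b (R.b l) k i • Matrix.single k i (1:ℂ) = adM R.b (R.b l) := by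
      rw [Finset.sum_comm]
      conv_rhs => rw [Matrix.matrix_eq_sum_single (adM R.b (R.b l))]
      simp [Matrix.smul_single]
    rw [h2, show r (adM R.b (R.b l)) = R.b l from LinearMap.congr_fun hr _, linP_b]
  intro p q hpq
  have h1 := congrArg g hpq
  simp only [← AlgHom.comp_apply, this] at h1
  exact h1

end RD
end Kos

namespace Kos
open MvPolynomial
namespace RD
variable {L : Type*} [LieRing L] [LieAlgebra ℂ L] [FiniteDimensional ℂ L] [LieAlgebra.IsKilling ℂ L]
  {e h : L} (R : RD L e h)

attribute [local instance 100] LieRing.ofAssociativeRing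

noncomputable def io (x : L) : R.UU := UniversalEnvelopingAlgebra.ι ℂ x
lemma io_add (x y) : R.io (x + y) = R.io x + R.io y := map_add (UniversalEnvelopingAlgebra.ι ℂ) x y
lemma io_smul (c : ℂ) (x) : R.io (c • x) = c • R.io x := map_smul (UniversalEnvelopingAlgebra.ι ℂ) c x
lemma io_lie (x y) : R.io ⁅x, y⁆ = R.io x * R.io y - R.io y * R.io x := by
  rw [io, LieHom.map_lie, LieRing.of_associative_ring_bracket]; rfl
lemma io_repr (x) : R.io x = ∑ k, R.b.repr x k • R.io (R.b k) := by
  conv_lhs => rw [← R.b.sum_repr x]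
  simp only [io, map_sum, map_smul]

noncomputable def xx (i : Fin R.n) : R.UU := R.io (R.b i) - algebraMap ℂ R.UU (R.ch i)
noncomputable def XX (i : Fin R.n) : R.PP := X i - C (R.ch i)
def wl (l : List (Fin R.n)) : ℤ := (l.map R.kk).sum
noncomputable def pu (l : List (Fin R.n)) : R.UU := (l.map R.xx).prod
noncomputable def pp (l : List (Fin R.n)) : R.PP := (l.map R.XX).prod

@[simp] lemma wl_nil : R.wl [] = 0 := rfl
@[simp] lemma pu_nil : R.pu [] = 1 := rfl
@[simp] lemma pp_nil : R.pp [] = 1 := rfl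
@[simp] lemma wl_cons (i l) : R.wl (i :: l) = R.kk i + R.wl l := by simp [wl]
@[simp] lemma pu_cons (i l) : R.pu (i :: l) = R.xx i * R.pu l := by simp [pu]
@[simp] lemma pp_cons (i l) : R.pp (i :: l) = R.XX i * R.pp l := by simp [pp]
lemma wl_append (l l') : R.wl (l ++ l') = R.wl l + R.wl l' := by simp [wl]
lemma pu_append (l l') : R.pu (l ++ l') = R.pu l * R.pu l' := by simp [pu]
lemma wl_perm {l l'} (hl : l.Perm l') : R.wl l = R.wl l' := (hl.map R.kk).sum_eq
lemma pp_perm {l l'} (hl : l.Perm l') : R.pp l = R.pp l' := (hl.map R.XX).prod_eq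

lemma kf_ch (x : L) : killingForm ℂ L x e = ∑ k, R.b.repr x k * R.ch k := by
  conv_lhs => rw [← R.b.sum_repr x]
  rw [map_sum, LinearMap.sum_apply]
  simp only [map_smul, LinearMap.smul_apply, smul_eq_mul, ch]

lemma io_xx (x) : R.io x = ∑ k, R.b.repr x k • R.xx k + algebraMap ℂ R.UU (killingForm ℂ L x e) := by
  rw [io_repr, kf_ch, map_sum, ← Finset.sum_add_distrib]
  refine Finset.sum_congr rfl fun k _ => ?_
  rw [xx, smul_sub, map_mul, Algebra.smul_def _ (algebraMap ℂ R.UU (R.ch k))]; simp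

lemma kf_bb {i j} (hh : killingForm ℂ L ⁅R.b i, R.b j⁆ e ≠ 0) : R.d i + R.d j = -1 := by
  rw [kf_ch] at hh
  obtain ⟨k, -, hk⟩ := Finset.exists_ne_zero_of_sum_ne_zero hh
  have h1 := R.repr_bb i j k (left_ne_zero_of_mul hk)
  have h2 := R.ch_ne (right_ne_zero_of_mul hk)
  omega

lemma io_xx_comm (x j) : R.io x * R.xx j - R.xx j * R.io x = R.io ⁅x, R.b j⁆ := by
  rw [io_lie, xx, mul_sub, sub_mul, Algebra.commutes (R.ch j) (R.io x)]; abel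

lemma xx_comm (i j) : R.xx i * R.xx j - R.xx j * R.xx i =
    ∑ k, R.b.repr ⁅R.b i, R.b j⁆ k • R.xx k + algebraMap ℂ R.UU (killingForm ℂ L ⁅R.b i, R.b j⁆ e) := by
  rw [← io_xx, ← io_xx_comm]
  rw [show R.xx i = R.io (R.b i) - algebraMap ℂ R.UU (R.ch i) from rfl, mul_sub, sub_mul, Algebra.commutes (R.ch i) (R.xx j)]; abel

def WS (P : Fin R.n → Prop) (c : ℕ) (r w : ℤ) : Submodule ℂ R.UU :=
  Submodule.span ℂ {u | ∃ l : List (Fin R.n), (∀ a ∈ l, P a) ∧ c ≤ l.length ∧ (l.length : ℤ) ≤ r ∧ R.wl l ≤ w ∧ u = R.pu l}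

variable {R} in
lemma WS_le {P c r w r' w'} (hr : r ≤ r') (hw : w ≤ w') : R.WS P c r w ≤ R.WS P c r' w' := by
  refine Submodule.span_mono ?_
  rintro u ⟨l, h1, h2, h3, h4, h5⟩
  exact ⟨l, h1, h2, h3.trans hr, h4.trans hw, h5⟩

variable {R} in
lemma WS_mul {P c r w i} (hi : P i) {u} (hu : u ∈ R.WS P c r w) : R.xx i * u ∈ R.WS P c (r + 1) (w + R.kk i) := by
  have : R.WS P c r w ≤ (R.WS P c (r + 1) (w + R.kk i)).comap (LinearMap.mulLeft ℂ (R.xx i)) := by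
    refine Submodule.span_le.2 ?_
    rintro u ⟨l, h1, h2, h3, h4, rfl⟩
    refine Submodule.subset_span ⟨i :: l, ?_, ?_, ?_, ?_, ?_⟩
    · intro a ha
      rcases List.mem_cons.1 ha with rfl | ha
      · exact hi
      · exact h1 a ha
    · simp; omega
    · simp; omega
    · simp; omega
    · simp
  exact this hu

def CH (P : Fin R.n → Prop) (c : ℕ) : Prop := ∀ i j l, P i → P j → (∀ a ∈ l, P a) →
  (R.xx i * R.xx j - R.xx j * R.xx i) * R.pu l ∈ R.WS P c (l.length + 1) (R.kk i + R.kk j + R.wl l - 1)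

lemma CH_all : R.CH (fun _ => True) 0 := by
  intro i j l _ _ _
  rw [xx_comm, add_mul, Finset.sum_mul]
  refine Submodule.add_mem _ (Submodule.sum_mem _ fun k _ => ?_) ?_
  · by_cases h0 : R.b.repr ⁅R.b i, R.b j⁆ k = 0
    · rw [h0, zero_smul, zero_mul]; exact Submodule.zero_mem _
    · rw [smul_mul_assoc]
      refine Submodule.smul_mem _ _ (Submodule.subset_span ⟨k :: l, by simp, by simp, by simp, ?_, by simp⟩)
      have := R.repr_bb i j k h0
      simp [kk]; omega
  · by_cases h0 : killingForm ℂ L ⁅R.b i, R.b j⁆ e = 0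
    · rw [h0, map_zero, zero_mul]; exact Submodule.zero_mem _
    · rw [← Algebra.smul_def]
      refine Submodule.smul_mem _ _ (Submodule.subset_span ⟨l, by simp, by simp, by simp, ?_, by simp⟩)
      have := R.kf_bb h0
      simp [kk]; omega

lemma CH_m : R.CH (fun i => R.d i < 0) 1 := by
  intro i j l hi hj hl
  rw [xx_comm, add_mul, Finset.sum_mul]
  refine Submodule.add_mem _ (Submodule.sum_mem _ fun k _ => ?_) ?_
  · by_cases h0 : R.b.repr ⁅R.b i, R.b j⁆ k = 0
    · rw [h0, zero_smul, zero_mul]; exact Submodule.zero_mem _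
    · rw [smul_mul_assoc]
      have := R.repr_bb i j k h0
      refine Submodule.smul_mem _ _ (Submodule.subset_span ⟨k :: l, ?_, by simp, by simp, ?_, by simp⟩)
      · intro a ha
        rcases List.mem_cons.1 ha with rfl | ha
        · omega
        · exact hl a ha
      · simp [kk]; omega
  · by_cases h0 : killingForm ℂ L ⁅R.b i, R.b j⁆ e = 0
    · rw [h0, map_zero, zero_mul]; exact Submodule.zero_mem _
    · have := R.kf_bb h0
      omega

variable {R} in
lemma perm_WS {P c} (hc : R.CH P c) {l l' : List (Fin R.n)} (hp : l.Perm l') (hl : ∀ a ∈ l, P a) :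
    R.pu l - R.pu l' ∈ R.WS P c (l.length - 1) (R.wl l - 1) := by
  induction hp with
  | nil => simp
  | cons i hp ih =>
    have := WS_mul (hl i (by simp)) (ih fun a ha => hl a (by simp [ha]))
    rw [pu_cons, pu_cons, ← mul_sub]
    refine WS_le ?_ ?_ this
    · simp
    · simp; omega
  | swap i j l =>
    have := hc j i l (hl j (by simp)) (hl i (by simp)) (fun a ha => hl a (by simp [ha]))
    simp only [pu_cons, ← mul_assoc, ← sub_mul]
    refine WS_le ?_ ?_ this
    · simp
    · simp; omega
  | trans h1 h2 ih1 ih2 =>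
    have e1 := ih1 hl
    have e2 := ih2 (fun a ha => hl a (h1.mem_iff.2 ha))
    rw [← h1.length_eq, ← R.wl_perm h1] at e2
    have := Submodule.add_mem _ e1 e2
    simpa using this

def SO (P : Fin R.n → Prop) (c : ℕ) (w : ℤ) : Submodule ℂ R.UU :=
  Submodule.span ℂ {u | ∃ l : List (Fin R.n), l.Pairwise (· ≤ ·) ∧ (∀ a ∈ l, P a) ∧ c ≤ l.length ∧ R.wl l ≤ w ∧ u = R.pu l}

def so (l : List (Fin R.n)) : List (Fin R.n) := (l : Multiset (Fin R.n)).sort (· ≤ ·)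
lemma so_perm (l) : (R.so l).Perm l := by
  rw [← Multiset.coe_eq_coe, so, Multiset.sort_eq]
lemma so_sorted (l) : (R.so l).Pairwise (· ≤ ·) := Multiset.pairwise_sort _ _

variable {R} in
lemma WS_SO {P c} (hc : R.CH P c) (r : ℕ) (w) : R.WS P c (r - 1) w ≤ R.SO P c w := by
  induction r with
  | zero =>
    refine Submodule.span_le.2 ?_
    rintro u ⟨l, h1, h2, h3, h4, rfl⟩
    simp at h3
    omega
  | succ r ih =>
    refine Submodule.span_le.2 ?_
    rintro u ⟨l, h1, h2, h3, h4, rfl⟩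
    have e1 := perm_WS hc (R.so_perm l).symm h1
    have e2 := ih (WS_le (by push_cast at h3; omega) (by omega) e1)
    have e3 : R.pu (R.so l) ∈ R.SO P c w := by
      refine Submodule.subset_span ⟨_, R.so_sorted l, ?_, ?_, ?_, rfl⟩
      · exact fun a ha => h1 a ((R.so_perm l).mem_iff.1 ha)
      · rwa [(R.so_perm l).length_eq]
      · rwa [R.wl_perm (R.so_perm l)]
    have := Submodule.add_mem _ e2 e3
    simpa using this

variable {R} in
lemma pu_SO {P c} (hc : R.CH P c) (l) (hl : ∀ a ∈ l, P a) (hcl : c ≤ l.length) : R.pu l ∈ R.SO P c (R.wl l) :=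
  WS_SO hc (l.length + 1) _ (Submodule.subset_span ⟨l, hl, hcl, by simp, le_rfl, rfl⟩)

end RD
end Kos

namespace Kos
open MvPolynomial
namespace RD
variable {L : Type*} [LieRing L] [LieAlgebra ℂ L] [FiniteDimensional ℂ L] [LieAlgebra.IsKilling ℂ L]
  {e h : L} (R : RD L e h)

lemma XX_wh (i) : IsWeightedHomogeneous R.kk (R.XX i) (R.kk i) := by
  refine Submodule.sub_mem (weightedHomogeneousSubmodule ℂ R.kk (R.kk i)) (isWeightedHomogeneous_X ℂ R.kk i) ?_
  by_cases h0 : R.ch i = 0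
  · rw [h0, map_zero]; exact Submodule.zero_mem _
  · have := R.ch_ne h0
    have h1 : R.kk i = 0 := by simp [kk, this]
    rw [h1]
    exact isWeightedHomogeneous_C R.kk (R.ch i)

lemma pp_wh (l) : IsWeightedHomogeneous R.kk (R.pp l) (R.wl l) := by
  induction l with
  | nil => simpa using isWeightedHomogeneous_one ℂ R.kk
  | cons i l ih => rw [pp_cons, wl_cons]; exact (R.XX_wh i).mul ih

lemma psi_pu (l) : R.act (R.pu l) 1 - R.Lam (R.pp l) ∈ Fil R.ww (R.wl l - 1) := by
  induction l with
  | nil => simp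
  | cons i l ih =>
    have hL : R.Lam (R.pp l) ∈ Fil R.ww (R.wl l) := wh_Fil _ (R.Lam_wh (R.pp_wh l))
    have hu : R.act (R.pu l) 1 ∈ Fil R.ww (R.wl l) := by
      have := Submodule.add_mem _ (Fil_le R.ww (by omega) ih) hL
      simpa using this
    have h1 : R.act (R.pu (i :: l)) 1 - R.Lam (R.pp (i :: l)) =
        R.Lam (X i) * (R.act (R.pu l) 1 - R.Lam (R.pp l)) + LS R.b (R.b i) (R.act (R.pu l) 1)
        - R.ch i • (R.act (R.pu l) 1 - R.Lam (R.pp l)) := by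
      rw [pu_cons, map_mul, Module.End.mul_apply, xx, map_sub, LinearMap.sub_apply, io, act_ι, AlgHom.commutes,
        Module.algebraMap_end_apply, pp_cons, map_mul, XX, map_sub]
      have h2 : R.Lam (X i) = LS R.b (R.b i) R.tr := by rw [Lam, aeval_X]
      have h3 : R.Lam (C (R.ch i)) = C (R.ch i) := by rw [← algebraMap_eq, ← algebraMap_eq, AlgHom.commutes]
      rw [h2, h3, smul_sub, smul_eq_C_mul, smul_eq_C_mul]
      ring
    rw [h1, wl_cons]
    refine Submodule.sub_mem _ (Submodule.add_mem _ ?_ ?_) ?_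
    · rw [add_sub_assoc]
      exact Fil_mul R.ww (wh_Fil _ (R.Lam_X_wh i)) ih
    · refine Fil_le R.ww ?_ (R.LS_Fil i hu)
      simp [kk]; omega
    · by_cases h0 : R.ch i = 0
      · rw [h0, zero_smul]; exact Submodule.zero_mem _
      · have := R.ch_ne h0
        refine Submodule.smul_mem _ _ (Fil_le R.ww ?_ ih)
        simp [kk, this]

def FU (N : ℤ) : Submodule ℂ R.UU := Submodule.span ℂ {u | ∃ l, R.wl l ≤ N ∧ u = R.pu l}
noncomputable def QQ (N : ℤ) : Submodule ℂ (R.UU × R.PP) :=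
  Submodule.span ℂ {z | (∃ l, R.wl l = N ∧ z = (R.pu l, R.pp l)) ∨ ∃ l, R.wl l < N ∧ z = (R.pu l, 0)}

variable {R}
lemma pu_FU {l} {N : ℤ} (hl : R.wl l ≤ N) : R.pu l ∈ R.FU N := Submodule.subset_span ⟨l, hl, rfl⟩
lemma pu_QQ (l) : (R.pu l, R.pp l) ∈ R.QQ (R.wl l) := Submodule.subset_span (Or.inl ⟨l, rfl, rfl⟩)
lemma FU_le {M N : ℤ} (hMN : M ≤ N) : R.FU M ≤ R.FU N :=
  Submodule.span_mono (by rintro u ⟨l, h1, h2⟩; exact ⟨l, h1.trans hMN, h2⟩)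

lemma QQ_ind {N : ℤ} (M : Submodule ℂ (R.UU × R.PP)) (h1 : ∀ l, R.wl l = N → (R.pu l, R.pp l) ∈ M)
    (h2 : ∀ l, R.wl l < N → (R.pu l, 0) ∈ M) : R.QQ N ≤ M := by
  refine Submodule.span_le.2 ?_
  rintro _ (⟨l, hl, rfl⟩ | ⟨l, hl, rfl⟩)
  · exact h1 l hl
  · exact h2 l hl

lemma FU_QQ {N M : ℤ} (hMN : M < N) {u} (hu : u ∈ R.FU M) : (u, 0) ∈ R.QQ N := by
  have : R.FU M ≤ (R.QQ N).comap (LinearMap.inl ℂ R.UU R.PP) := by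
    refine Submodule.span_le.2 ?_
    rintro _ ⟨l, hl, rfl⟩
    exact Submodule.subset_span (Or.inr ⟨l, by omega, rfl⟩)
  exact this hu

lemma QQ_FU {N u p} (hz : (u, p) ∈ R.QQ N) : u ∈ R.FU N := by
  have : R.QQ N ≤ (R.FU N).comap (LinearMap.fst ℂ R.UU R.PP) :=
    QQ_ind _ (fun l hl => pu_FU hl.le) (fun l hl => pu_FU hl.le)
  exact this hz

lemma QQ_wh {N u p} (hz : (u, p) ∈ R.QQ N) : IsWeightedHomogeneous R.kk p N := by
  have : R.QQ N ≤ (weightedHomogeneousSubmodule ℂ R.kk N).comap (LinearMap.snd ℂ R.UU R.PP) :=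
    QQ_ind _ (fun l hl => by rw [← hl]; exact R.pp_wh l) (fun l hl => Submodule.zero_mem (weightedHomogeneousSubmodule ℂ R.kk N))
  exact this hz

lemma QQ_psi_aux (N : ℤ) (z : R.UU × R.PP) (hz : z ∈ R.QQ N) : R.act z.1 1 - R.Lam z.2 ∈ Fil R.ww (N - 1) := by
  induction hz using Submodule.span_induction with
  | mem z hz =>
    rcases hz with ⟨l, hl, rfl⟩ | ⟨l, hl, rfl⟩
    · rw [← hl]; exact R.psi_pu l
    · have h1 := Fil_le R.ww (by omega : R.wl l - 1 ≤ N - 1) (R.psi_pu l)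
      have h2 := Fil_le R.ww (by omega : R.wl l ≤ N - 1) (wh_Fil _ (R.Lam_wh (R.pp_wh l)))
      have h3 := Submodule.add_mem _ h1 h2
      rw [sub_add_cancel] at h3
      have h4 : R.act (R.pu l, (0 : R.PP)).1 1 - R.Lam (R.pu l, (0 : R.PP)).2 = R.act (R.pu l) 1 := by
        rw [map_zero, sub_zero]
      rw [h4]; exact h3
  | zero =>
    have h4 : R.act (0 : R.UU × R.PP).1 1 - R.Lam (0 : R.UU × R.PP).2 = 0 := by
      rw [Prod.fst_zero, Prod.snd_zero, map_zero, map_zero, LinearMap.zero_apply, sub_zero]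
    rw [h4]; exact Submodule.zero_mem _
  | add x y _ _ hx hy =>
    have h4 : R.act (x + y).1 1 - R.Lam (x + y).2 = (R.act x.1 1 - R.Lam x.2) + (R.act y.1 1 - R.Lam y.2) := by
      rw [Prod.fst_add, Prod.snd_add, map_add, map_add, LinearMap.add_apply]; ring
    rw [h4]; exact Submodule.add_mem _ hx hy
  | smul c x _ hx =>
    have h4 : R.act (c • x).1 1 - R.Lam (c • x).2 = c • (R.act x.1 1 - R.Lam x.2) := by
      rw [Prod.smul_fst, Prod.smul_snd, map_smul, map_smul, LinearMap.smul_apply, smul_sub]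
    rw [h4]; exact Submodule.smul_mem _ _ hx

lemma QQ_psi {N : ℤ} {u : R.UU} {p : R.PP} (hz : (u, p) ∈ R.QQ N) : R.act u 1 - R.Lam p ∈ Fil R.ww (N - 1) :=
  QQ_psi_aux N (u, p) hz

lemma QQ_zero {N M : ℤ} (hMN : M < N) {u p} (hz : (u, p) ∈ R.QQ N) (hu : u ∈ R.FU M) : p = 0 := by
  have h1 : ((0 : R.UU), p) ∈ R.QQ N := by
    have := Submodule.sub_mem _ hz (FU_QQ hMN hu)
    simpa using this
  have h2 := QQ_psi h1
  rw [map_zero, LinearMap.zero_apply, zero_sub] at h2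
  have h3 := wh_zero _ (R.Lam_wh (QQ_wh h1)) ((Submodule.neg_mem_iff _).1 h2) (by omega)
  exact R.Lam_inj (by rw [h3, map_zero])

lemma exists_QQ {N u} (hu : u ∈ R.FU N) : ∃ p, (u, p) ∈ R.QQ N := by
  have : R.FU N ≤ (R.QQ N).map (LinearMap.fst ℂ R.UU R.PP) := by
    refine Submodule.span_le.2 ?_
    rintro _ ⟨l, hl, rfl⟩
    rcases hl.lt_or_eq with hl | rfl
    · exact ⟨_, FU_QQ hl (pu_FU le_rfl), rfl⟩
    · exact ⟨_, pu_QQ l, rfl⟩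
  obtain ⟨⟨u', p⟩, hz, rfl⟩ := this hu
  exact ⟨p, hz⟩

lemma XX_QQ {N u p} (i) (hz : (u, p) ∈ R.QQ N) : (R.xx i * u, R.XX i * p) ∈ R.QQ (R.kk i + N) := by
  have : R.QQ N ≤ (R.QQ (R.kk i + N)).comap ((LinearMap.mulLeft ℂ (R.xx i)).prodMap (LinearMap.mulLeft ℂ (R.XX i))) := by
    refine QQ_ind _ (fun l hl => ?_) (fun l hl => ?_)
    · have := pu_QQ (R := R) (i :: l)
      rw [wl_cons, pu_cons, pp_cons, hl] at this
      exact this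
    · change (R.xx i * R.pu l, R.XX i * 0) ∈ R.QQ (R.kk i + N)
      rw [mul_zero, ← pu_cons]
      exact FU_QQ (by rw [wl_cons]; omega) (pu_FU (le_refl (R.wl (i :: l))))
  exact this hz

lemma X_QQ {N u p} (i) (hz : (u, p) ∈ R.QQ N) : (R.io (R.b i) * u, X i * p) ∈ R.QQ (R.kk i + N) := by
  have h1 := XX_QQ i hz
  have h2 : R.ch i • (u, p) ∈ R.QQ (R.kk i + N) := by
    by_cases h0 : R.ch i = 0
    · rw [h0, zero_smul]; exact Submodule.zero_mem _
    · have := R.ch_ne h0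
      rw [show R.kk i = 0 by simp [kk, this], zero_add]
      exact Submodule.smul_mem _ _ hz
  have := Submodule.add_mem _ h1 h2
  rw [Prod.smul_mk, Prod.mk_add_mk] at this
  convert this using 2
  · rw [xx, sub_mul, Algebra.smul_def]; abel
  · rw [XX, sub_mul, smul_eq_C_mul]; ring

lemma lie_pu (i) (l) : (R.io (R.b i) * R.pu l - R.pu l * R.io (R.b i), DP R.b (R.b i) (R.pp l)) ∈ R.QQ (R.wl l + R.d i) := by
  induction l with
  | nil =>
    have : ((0 : R.UU), (0 : R.PP)) ∈ R.QQ (R.d i) := Submodule.zero_mem _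
    simpa using this
  | cons j l ih =>
    have h1 := XX_QQ j ih
    have h2 : (R.io ⁅R.b i, R.b j⁆ * R.pu l, linP R.b ⁅R.b i, R.b j⁆ * R.pp l) ∈ R.QQ (R.kk j + (R.wl l + R.d i)) := by
      have : (R.io ⁅R.b i, R.b j⁆ * R.pu l, linP R.b ⁅R.b i, R.b j⁆ * R.pp l) =
          ∑ k, R.b.repr ⁅R.b i, R.b j⁆ k • (R.io (R.b k) * R.pu l, X k * R.pp l) := by
        ext1
        · rw [Prod.fst_sum, io_repr, Finset.sum_mul]; simp
        · rw [Prod.snd_sum]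
          conv_lhs => rw [← R.b.sum_repr ⁅R.b i, R.b j⁆]
          rw [map_sum, Finset.sum_mul]; simp [linP_b]
      rw [this]
      refine Submodule.sum_mem _ fun k _ => ?_
      by_cases h0 : R.b.repr ⁅R.b i, R.b j⁆ k = 0
      · rw [h0, zero_smul]; exact Submodule.zero_mem _
      · have h3 := R.repr_bb i j k h0
        have := X_QQ k (pu_QQ (R := R) l)
        rw [show R.kk k + R.wl l = R.kk j + (R.wl l + R.d i) by simp [kk, h3]; ring] at this
        exact Submodule.smul_mem _ _ this
    have h3 := Submodule.add_mem _ h1 h2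
    rw [wl_cons, add_assoc]
    convert h3 using 1
    rw [Prod.mk_add_mk, ← io_xx_comm, pu_cons, pp_cons, Derivation.leibniz]
    ext1
    · simp only [mul_sub, sub_mul, mul_assoc]; abel
    · simp only [XX, map_sub, DP_X, smul_eq_mul]
      rw [show DP R.b (R.b i) (C (R.ch j)) = 0 from Derivation.map_algebraMap _ _]
      ring

lemma lie_QQ (i) {N u p} (hz : (u, p) ∈ R.QQ N) :
    (R.io (R.b i) * u - u * R.io (R.b i), DP R.b (R.b i) p) ∈ R.QQ (N + R.d i) := by
  have : R.QQ N ≤ (R.QQ (N + R.d i)).comap ((LinearMap.mulLeft ℂ (R.io (R.b i)) - LinearMap.mulRight ℂ (R.io (R.b i))).prodMap (DP R.b (R.b i)).toLinearMap) := by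
    refine QQ_ind _ (fun l hl => ?_) (fun l hl => ?_)
    · rw [← hl]; exact lie_pu i l
    · change (R.io (R.b i) * R.pu l - R.pu l * R.io (R.b i), DP R.b (R.b i) 0) ∈ R.QQ (N + R.d i)
      rw [map_zero]
      exact FU_QQ (by omega) (QQ_FU (lie_pu (R := R) i l))
  exact this hz

end RD
end Kos

namespace Kos
open MvPolynomial

lemma wh_ind {σ : Type*} (w : σ → ℤ) {N : ℤ} {p : MvPolynomial σ ℂ} (hp : IsWeightedHomogeneous w p N)
    (M : Submodule ℂ (MvPolynomial σ ℂ)) (h : ∀ s : σ →₀ ℕ, Finsupp.weight w s = N → monomial s (1:ℂ) ∈ M) : p ∈ M := by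
  rw [p.as_sum]
  refine Submodule.sum_mem _ fun s hs => ?_
  have : monomial s (coeff s p) = coeff s p • monomial s (1:ℂ) := by rw [smul_monomial]; simp
  rw [this]
  exact Submodule.smul_mem _ _ (h s (hp (mem_support_iff.1 hs)))

lemma whc_Fil {σ : Type*} (w : σ → ℤ) {N : ℤ} {p : MvPolynomial σ ℂ} (hp : p ∈ Fil w N) :
    p - weightedHomogeneousComponent w N p ∈ Fil w (N - 1) := by
  classical
  intro s hs
  rw [mem_support_iff, coeff_sub, coeff_weightedHomogeneousComponent] at hs
  by_cases h1 : Finsupp.weight w s = N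
  · simp [h1] at hs
  · rw [if_neg h1, sub_zero] at hs
    have := hp s (mem_support_iff.2 hs)
    omega

lemma wh_top {σ : Type*} (w : σ → ℤ) {p : MvPolynomial σ ℂ} (hp : p ≠ 0) :
    ∃ M, p ∈ Fil w M ∧ weightedHomogeneousComponent w M p ≠ 0 := by
  classical
  obtain ⟨s, hs, hmax⟩ := Finset.exists_max_image p.support (Finsupp.weight w) (support_nonempty.2 hp)
  refine ⟨Finsupp.weight w s, hmax, fun h0 => ?_⟩
  have : coeff s (weightedHomogeneousComponent w (Finsupp.weight w s) p) = 0 := by rw [h0, coeff_zero]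
  rw [coeff_weightedHomogeneousComponent, if_pos rfl] at this
  exact mem_support_iff.1 hs this

lemma wh_comm {σ : Type*} (w : σ → ℤ) (f : MvPolynomial σ ℂ →ₗ[ℂ] MvPolynomial σ ℂ) (c : ℤ)
    (hf : ∀ M p, IsWeightedHomogeneous w p M → IsWeightedHomogeneous w (f p) (M + c)) (N : ℤ) (p) :
    weightedHomogeneousComponent w (N + c) (f p) = f (weightedHomogeneousComponent w N p) := by
  classical
  induction p using MvPolynomial.induction_on' with
  | monomial s a =>
    have h1 : IsWeightedHomogeneous w (monomial s a : MvPolynomial σ ℂ) _ := isWeightedHomogeneous_monomial w s a rfl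
    rw [weightedHomogeneousComponent_of_mem h1, weightedHomogeneousComponent_of_mem (hf _ _ h1)]
    by_cases h2 : N = Finsupp.weight w s
    · rw [if_pos (by omega), if_pos (by omega)]
    · rw [if_neg (by omega), if_neg (by omega), map_zero]
  | add p q hp hq => rw [map_add, map_add, map_add, map_add, hp, hq]

namespace RD
variable {L : Type*} [LieRing L] [LieAlgebra ℂ L] [FiniteDimensional ℂ L] [LieAlgebra.IsKilling ℂ L]
  {e h : L} (R : RD L e h)

noncomputable def ml (s : Fin R.n →₀ ℕ) : List (Fin R.n) := (Finsupp.toMultiset s).sort (· ≤ ·)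
lemma ml_coe (s) : ((R.ml s : List (Fin R.n)) : Multiset (Fin R.n)) = Finsupp.toMultiset s := Multiset.sort_eq _ _
lemma ml_sorted (s) : (R.ml s).Pairwise (· ≤ ·) := Multiset.pairwise_sort _ _
lemma ml_mem {s i} : i ∈ R.ml s ↔ s i ≠ 0 := by
  rw [← Multiset.mem_coe, ml_coe, Finsupp.mem_toMultiset, Finsupp.mem_support_iff]
lemma ml_ex {l : List (Fin R.n)} (hl : l.Pairwise (· ≤ ·)) : ∃ s, R.ml s = l := by
  refine ⟨Multiset.toFinsupp (l : Multiset (Fin R.n)), ?_⟩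
  have h1 : (R.ml (Multiset.toFinsupp (l : Multiset (Fin R.n)))).Perm l := by
    rw [← Multiset.coe_eq_coe, ml_coe, Multiset.toFinsupp_toMultiset]
  exact h1.eq_of_pairwise (fun a b _ _ h1 h2 => le_antisymm h1 h2) (R.ml_sorted _) hl
lemma ml_zero : R.ml 0 = [] := by simp [ml]
lemma ml_cons (s i) : (R.ml (Finsupp.single i 1 + s)).Perm (i :: R.ml s) := by
  rw [← Multiset.coe_eq_coe, ml_coe, ← Multiset.cons_coe, ml_coe, map_add, Finsupp.toMultiset_single]
  simp
lemma weight_ml (s) : Finsupp.weight R.kk s = R.wl (R.ml s) := by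
  induction s using fs_ind with
  | h0 => simp [ml_zero]
  | hs s i ih => rw [weight_cons, R.wl_perm (R.ml_cons s i), wl_cons, ih]

noncomputable def tau : R.PP →ₐ[ℂ] R.PP := aeval R.XX
noncomputable def tauI : R.PP →ₐ[ℂ] R.PP := aeval (fun i => X i + C (R.ch i))
lemma tauI_tau (p) : R.tauI (R.tau p) = p := by
  have : R.tauI.comp R.tau = AlgHom.id ℂ _ := by
    ext1 i
    simp only [AlgHom.comp_apply, tau, aeval_X, XX, map_sub, tauI, ← algebraMap_eq, AlgHom.commutes]
    simp
  exact DFunLike.congr_fun this p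
lemma tau_inj {p} (hp : R.tau p = 0) : p = 0 := by rw [← R.tauI_tau p, hp, map_zero]
lemma tau_mon (s) : R.tau (monomial s 1) = R.pp (R.ml s) := by
  induction s using fs_ind with
  | h0 => rw [ml_zero, pp_nil]; exact map_one _
  | hs s i ih => rw [mon_cons, map_mul, ih, R.pp_perm (R.ml_cons s i), pp_cons, tau, aeval_X]

noncomputable def Th : R.PP →ₗ[ℂ] R.UU := (basisMonomials (Fin R.n) ℂ).constr ℂ (fun s => R.pu (R.ml s))
lemma Th_mon (s) : R.Th (monomial s 1) = R.pu (R.ml s) := by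
  have := (basisMonomials (Fin R.n) ℂ).constr_basis ℂ (fun s => R.pu (R.ml s)) s
  rwa [coe_basisMonomials] at this

variable {R}

lemma Th_FU {N q} (hq : q ∈ Fil R.kk N) : R.Th q ∈ R.FU N := by
  refine (Fil_ind R.kk ((R.FU N).comap R.Th) fun s hs => ?_) hq
  rw [Submodule.mem_comap, Th_mon]
  exact pu_FU (by rwa [← weight_ml])

lemma FU_Th {N u} (hu : u ∈ R.FU N) : ∃ q ∈ Fil R.kk N, R.Th q = u := by
  have : R.FU N ≤ (Fil R.kk N).map R.Th := by
    refine Submodule.span_le.2 ?_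
    rintro _ ⟨l, hl, rfl⟩
    have h1 := pu_SO R.CH_all l (by simp) (by simp)
    refine (Submodule.span_le.2 ?_ : R.SO _ _ (R.wl l) ≤ (Fil R.kk N).map R.Th) h1
    rintro _ ⟨l', h2, -, -, h3, rfl⟩
    obtain ⟨s, rfl⟩ := R.ml_ex h2
    refine ⟨monomial s 1, Fil_monomial _ _ ?_, R.Th_mon s⟩
    rw [weight_ml]; omega
  exact this hu

lemma Th_QQ0 {N q} (hq : IsWeightedHomogeneous R.kk q N) : (R.Th q, R.tau q) ∈ R.QQ N := by
  have := wh_ind R.kk hq ((R.QQ N).comap (R.Th.prod R.tau.toLinearMap)) (fun s hs => ?_)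
  · exact this
  · change (R.Th (monomial s 1), R.tau (monomial s 1)) ∈ R.QQ N
    rw [Th_mon, tau_mon, ← hs, weight_ml]
    exact pu_QQ _

lemma Th_QQ {N q} (hq : q ∈ Fil R.kk N) : (R.Th q, R.tau (weightedHomogeneousComponent R.kk N q)) ∈ R.QQ N := by
  have h1 := Th_QQ0 (R := R) (weightedHomogeneousComponent_isWeightedHomogeneous N q (w := R.kk))
  have h2 := FU_QQ (N := N) (by omega) (Th_FU (whc_Fil R.kk hq))
  have := Submodule.add_mem _ h1 h2
  rw [Prod.mk_add_mk, ← map_add, add_sub_cancel, add_zero] at this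
  exact this

lemma Th_inj {q} (hq : R.Th q = 0) : q = 0 := by
  by_contra h0
  obtain ⟨M, h1, h2⟩ := wh_top R.kk h0
  have := Th_QQ h1
  rw [hq] at this
  exact h2 (R.tau_inj (QQ_zero (M := M - 1) (by omega) this (Submodule.zero_mem _)))

lemma QQ_uniq {N u p p'} (h1 : (u, p) ∈ R.QQ N) (h2 : (u, p') ∈ R.QQ N) : p = p' := by
  have := Submodule.sub_mem _ h1 h2
  rw [Prod.mk_sub_mk, sub_self] at this
  exact sub_eq_zero.1 (QQ_zero (M := N - 1) (by omega) this (Submodule.zero_mem _))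

lemma QQ_Th {N u p} (h1 : (u, p) ∈ R.QQ N) :
    ∃ q ∈ Fil R.kk N, R.Th q = u ∧ R.tau (weightedHomogeneousComponent R.kk N q) = p := by
  obtain ⟨q, hq, rfl⟩ := FU_Th (QQ_FU h1)
  exact ⟨q, hq, rfl, QQ_uniq (Th_QQ hq) h1⟩

end RD
end Kos

namespace Kos
open MvPolynomial
namespace RD
variable {L : Type*} [LieRing L] [LieAlgebra ℂ L] [FiniteDimensional ℂ L] [LieAlgebra.IsKilling ℂ L]
  {e h : L} (R : RD L e h)

attribute [local instance 100] LieRing.ofAssociativeRing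

lemma UU_gen (A : Subalgebra ℂ R.UU) (hA : ∀ x, R.io x ∈ A) (u : R.UU) : u ∈ A := by
  let g0 : L →ₗ⁅ℂ⁆ A :=
    { toFun := fun x => ⟨R.io x, hA x⟩
      map_add' := fun x y => Subtype.ext (R.io_add x y)
      map_smul' := fun c x => Subtype.ext (R.io_smul c x)
      map_lie' := fun {x y} => Subtype.ext (R.io_lie x y) }
  have h1 : A.val.comp (UniversalEnvelopingAlgebra.lift ℂ g0) = AlgHom.id ℂ R.UU := by
    apply UniversalEnvelopingAlgebra.hom_ext
    ext x
    change A.val (UniversalEnvelopingAlgebra.lift ℂ g0 (UniversalEnvelopingAlgebra.ι ℂ x)) = R.io x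
    rw [UniversalEnvelopingAlgebra.lift_ι_apply]
    rfl
  have h2 : ((UniversalEnvelopingAlgebra.lift ℂ g0 u : A) : R.UU) = u := DFunLike.congr_fun h1 u
  rw [← h2]
  exact Subtype.property _

def WW : Submodule ℂ R.UU := Submodule.span ℂ (Set.range R.pu)

lemma WW_mul {u v} (hu : u ∈ R.WW) (hv : v ∈ R.WW) : u * v ∈ R.WW := by
  induction hu, hv using Submodule.span_induction₂ with
  | mem_mem x y hx hy =>
    obtain ⟨l, rfl⟩ := hx
    obtain ⟨l', rfl⟩ := hy
    exact Submodule.subset_span ⟨l ++ l', R.pu_append l l'⟩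
  | zero_left y hy => rw [zero_mul]; exact Submodule.zero_mem _
  | zero_right x hx => rw [mul_zero]; exact Submodule.zero_mem _
  | add_left x y z _ _ _ h1 h2 => rw [add_mul]; exact Submodule.add_mem _ h1 h2
  | add_right x y z _ _ _ h1 h2 => rw [mul_add]; exact Submodule.add_mem _ h1 h2
  | smul_left r x y _ _ h1 => rw [smul_mul_assoc]; exact Submodule.smul_mem _ _ h1
  | smul_right r x y _ _ h1 => rw [mul_smul_comm]; exact Submodule.smul_mem _ _ h1

lemma one_WW : (1 : R.UU) ∈ R.WW := Submodule.subset_span ⟨[], rfl⟩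
lemma WW_all (u : R.UU) : u ∈ R.WW := by
  refine R.UU_gen (Submodule.toSubalgebra R.WW R.one_WW (fun _ _ => R.WW_mul)) (fun x => ?_) u
  rw [Submodule.mem_toSubalgebra, io_xx]
  refine Submodule.add_mem _ (Submodule.sum_mem _ fun k _ => Submodule.smul_mem _ _ (Submodule.subset_span ⟨[k], by simp⟩)) ?_
  rw [Algebra.algebraMap_eq_smul_one]
  exact Submodule.smul_mem _ _ R.one_WW

lemma FU_all (u : R.UU) : ∃ N, u ∈ R.FU N := by
  have := R.WW_all u
  induction this using Submodule.span_induction with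
  | mem x hx => obtain ⟨l, rfl⟩ := hx; exact ⟨_, pu_FU le_rfl⟩
  | zero => exact ⟨0, Submodule.zero_mem _⟩
  | add x y _ _ hx hy =>
    obtain ⟨N, hN⟩ := hx
    obtain ⟨M, hM⟩ := hy
    exact ⟨max N M, Submodule.add_mem _ (FU_le (le_max_left _ _) hN) (FU_le (le_max_right _ _) hM)⟩
  | smul c x _ hx => obtain ⟨N, hN⟩ := hx; exact ⟨N, Submodule.smul_mem _ _ hN⟩

lemma Th_surj (u : R.UU) : ∃ q, R.Th q = u := by
  obtain ⟨N, hN⟩ := R.FU_all u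
  obtain ⟨q, -, hq⟩ := FU_Th hN
  exact ⟨q, hq⟩

lemma center_of {z : R.UU} (hz : ∀ x, R.io x * z - z * R.io x = 0) : z ∈ Subalgebra.center ℂ R.UU := by
  rw [Subalgebra.mem_center_iff]
  intro u
  have := R.UU_gen (Subalgebra.centralizer ℂ {z}) (fun x => by
    rw [Subalgebra.mem_centralizer_iff]
    intro g hg
    rw [Set.mem_singleton_iff.1 hg]
    exact (sub_eq_zero.1 (hz x)).symm) u
  rw [Subalgebra.mem_centralizer_iff] at this
  exact (this z rfl).symm

noncomputable def JJ : Submodule R.UU R.UU := Submodule.span R.UU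
  {x : R.UU | ∃ a ∈ R.mm, x = R.io a - algebraMap ℂ R.UU (killingForm ℂ L a e)}
noncomputable def J : Submodule ℂ R.UU := R.JJ.restrictScalars ℂ
noncomputable def Im : Ideal R.PP := Ideal.span (X '' {i | R.d i < 0})

lemma mem_Im {q} : q ∈ R.Im ↔ ∀ s ∈ q.support, ∃ i, R.d i < 0 ∧ s i ≠ 0 := by
  rw [Im, mem_ideal_span_X_image]; rfl

lemma J_mul (u) {v : R.UU} (hv : v ∈ R.J) : u * v ∈ R.J := R.JJ.smul_mem u hv
lemma xx_J {i} (hi : R.d i < 0) : R.xx i ∈ R.J := Submodule.subset_span ⟨R.b i, R.b_mem_gr hi, rfl⟩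

lemma neg_J (l : List (Fin R.n)) (hl : l.Pairwise (· ≤ ·)) (hn : ∃ a ∈ l, R.d a < 0) : R.pu l ∈ R.J := by
  induction l with
  | nil => simp at hn
  | cons i l ih =>
    rw [pu_cons]
    rw [List.pairwise_cons] at hl
    by_cases h1 : ∃ a ∈ l, R.d a < 0
    · exact R.J_mul _ (ih hl.2 h1)
    · push Not at h1
      obtain ⟨a, ha, h2⟩ := hn
      rcases List.mem_cons.1 ha with rfl | ha
      · have : l = [] := by
          rw [List.eq_nil_iff_forall_not_mem]
          intro c hc
          have := R.anti (hl.1 c hc)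
          have := h1 c hc
          omega
        rw [this, pu_nil, mul_one]
        exact R.xx_J h2
      · have := h1 a ha
        omega

lemma Th_J {q} (hq : q ∈ R.Im) : R.Th q ∈ R.J := by
  rw [mem_Im] at hq
  rw [q.as_sum, map_sum]
  refine Submodule.sum_mem _ fun s hs => ?_
  have : monomial s (coeff s q) = coeff s q • monomial s (1:ℂ) := by rw [smul_monomial]; simp
  rw [this, map_smul, Th_mon]
  obtain ⟨i, hi, h1⟩ := hq s hs
  exact Submodule.smul_mem _ _ (R.neg_J _ (R.ml_sorted s) ⟨i, R.ml_mem.2 h1, hi⟩)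

def NS (l : List (Fin R.n)) : Submodule ℂ R.UU :=
  Submodule.span ℂ {u | ∃ l' : List (Fin R.n), l'.Pairwise (· ≤ ·) ∧ (∃ a ∈ l', R.d a < 0) ∧ (∀ a ∈ l', R.d a < 0 ∨ a ∈ l) ∧ u = R.pu l'}

lemma neg_word (l : List (Fin R.n)) (hl : l.Pairwise (· ≤ ·)) {j} (hj : R.d j < 0) : R.pu l * R.xx j ∈ R.NS l := by
  induction l with
  | nil => exact Submodule.subset_span ⟨[j], by simp, by simp [hj], by simp [hj], by simp⟩
  | cons i l ih =>
    rw [List.pairwise_cons] at hl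
    by_cases h1 : R.d i < 0
    · have h2 : ∀ a ∈ (i :: l) ++ [j], R.d a < 0 := by
        intro a ha
        simp only [List.cons_append, List.mem_cons, List.mem_append, List.not_mem_nil, or_false] at ha
        rcases ha with rfl | ha | rfl
        · exact h1
        · have := R.anti (hl.1 a ha); omega
        · exact hj
      have h3 := pu_SO R.CH_m _ h2 (by simp)
      rw [pu_append] at h3
      rw [show R.xx j = R.pu [j] by simp]
      refine (Submodule.span_mono ?_) h3
      rintro _ ⟨l', h4, h5, h6, -, rfl⟩
      refine ⟨l', h4, ?_, fun a ha => Or.inl (h5 a ha), rfl⟩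
      obtain ⟨a, ha⟩ := List.exists_mem_of_length_pos (by omega : 0 < l'.length)
      exact ⟨a, ha, h5 a ha⟩
    · rw [pu_cons, mul_assoc]
      have h2 : R.NS l ≤ (R.NS (i :: l)).comap (LinearMap.mulLeft ℂ (R.xx i)) := by
        refine Submodule.span_le.2 ?_
        rintro _ ⟨l', h4, ⟨a, ha, ha'⟩, h6, rfl⟩
        refine Submodule.subset_span ⟨i :: l', ?_, ⟨a, by simp [ha], ha'⟩, ?_, by simp⟩
        · rw [List.pairwise_cons]
          refine ⟨fun c hc => ?_, h4⟩
          rcases h6 c hc with h7 | h7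
          · by_contra h8
            have := R.anti (not_le.1 h8).le
            omega
          · exact hl.1 c h7
        · intro c hc
          rcases List.mem_cons.1 hc with rfl | hc
          · right; simp
          · rcases h6 c hc with h7 | h7
            · exact Or.inl h7
            · right; simp [h7]
      exact h2 (ih hl.2)

noncomputable def KK : Submodule ℂ R.UU := (R.Im.restrictScalars ℂ).map R.Th

lemma NS_KK (l) : R.NS l ≤ R.KK := by
  classical
  refine Submodule.span_le.2 ?_
  rintro _ ⟨l', h1, ⟨a, ha, ha'⟩, -, rfl⟩
  obtain ⟨s, rfl⟩ := R.ml_ex h1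
  refine ⟨monomial s 1, ?_, R.Th_mon s⟩
  change monomial s 1 ∈ R.Im
  rw [mem_Im]
  intro t ht
  have := support_monomial_subset ht
  rw [Finset.mem_singleton] at this
  rw [this]
  exact ⟨a, ha', R.ml_mem.1 ha⟩

lemma mul_xx_KK (u) {j} (hj : R.d j < 0) : u * R.xx j ∈ R.KK := by
  obtain ⟨q, rfl⟩ := R.Th_surj u
  rw [q.as_sum, map_sum, Finset.sum_mul]
  refine Submodule.sum_mem _ fun s hs => ?_
  have : monomial s (coeff s q) = coeff s q • monomial s (1:ℂ) := by rw [smul_monomial]; simp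
  rw [this, map_smul, Th_mon, smul_mul_assoc]
  exact Submodule.smul_mem _ _ (R.NS_KK _ (R.neg_word _ (R.ml_sorted s) hj))

lemma J_KK {u : R.UU} (hu : u ∈ R.J) : ∃ q ∈ R.Im, R.Th q = u := by
  have key : ∀ v : R.UU, v * u ∈ R.KK := by
    change u ∈ R.JJ at hu
    induction hu using Submodule.span_induction with
    | mem x hx =>
      obtain ⟨a, ha, rfl⟩ := hx
      intro v
      rw [io_xx, add_sub_cancel_right, Finset.mul_sum]
      refine Submodule.sum_mem _ fun k _ => ?_
      by_cases h0 : R.b.repr a k = 0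
      · rw [h0, zero_smul, mul_zero]; exact Submodule.zero_mem _
      · rw [mul_smul_comm]
        exact Submodule.smul_mem _ _ (R.mul_xx_KK v (R.mem_gr.1 ha k h0))
    | zero => intro v; rw [mul_zero]; exact Submodule.zero_mem _
    | add x y _ _ hx hy => intro v; rw [mul_add]; exact Submodule.add_mem _ (hx v) (hy v)
    | smul c x _ hx => intro v; rw [smul_eq_mul, ← mul_assoc]; exact hx _
  have := key 1
  rw [one_mul] at this
  obtain ⟨q, h1, h2⟩ := this
  exact ⟨q, h1, h2⟩

lemma J_FU : R.FU (-1) ≤ R.J := by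
  intro u hu
  obtain ⟨q, hq, rfl⟩ := FU_Th hu
  refine R.Th_J ?_
  rw [mem_Im]
  intro s hs
  have h1 := hq s hs
  by_contra! h2
  have : 0 ≤ Finsupp.weight R.kk s := by
    rw [Finsupp.weight_apply, Finsupp.sum]
    refine Finset.sum_nonneg fun i hi => ?_
    have : 0 ≤ R.d i := by
      by_contra h3
      exact Finsupp.mem_support_iff.1 hi (h2 i (by omega))
    simp only [kk]
    positivity
  omega

lemma J_ad {a u} (ha : a ∈ R.mm) (hu : u ∈ R.J) : R.io a * u - u * R.io a ∈ R.J := by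
  refine Submodule.sub_mem _ (R.J_mul _ hu) ?_
  have h1 : u * R.io a = u * (R.io a - algebraMap ℂ R.UU (killingForm ℂ L a e)) + killingForm ℂ L a e • u := by
    rw [mul_sub, Algebra.smul_def, Algebra.commutes]; abel
  rw [h1]
  exact Submodule.add_mem _ (R.J_mul _ (Submodule.subset_span ⟨a, ha, rfl⟩)) (Submodule.smul_mem _ _ hu)

lemma Im_E {q v} (hq : q ∈ R.Im) (hv : v ∈ R.E) : evp R.b v (R.tau q) = 0 := by
  have : R.Im ≤ RingHom.ker ((evp R.b v).comp R.tau) := by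
    refine Ideal.span_le.2 ?_
    rintro _ ⟨i, hi, rfl⟩
    change evp R.b v (R.tau (X i)) = 0
    rw [tau, aeval_X, XX, map_sub, evp_X, R.mem_E.1 hv i hi, ← algebraMap_eq, AlgHom.commutes, ch]
    simp
  exact this hq

variable {R}
lemma lemS {N u p f} (hz : (u, p) ∈ R.QQ N) (hf : f ∈ R.FU (N - 1)) (hu : u - f ∈ R.J) {v} (hv : v ∈ R.E) :
    evp R.b v p = 0 := by
  have h1 := Submodule.sub_mem _ hz (FU_QQ (N := N) (by omega) hf)
  rw [Prod.mk_sub_mk, sub_zero] at h1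
  obtain ⟨q, h2, h3, rfl⟩ := QQ_Th h1
  obtain ⟨q', h4, h5⟩ := R.J_KK hu
  have h6 : q' = q := sub_eq_zero.1 (Th_inj (R := R) (by rw [map_sub, h5, h3, sub_self]))
  subst h6
  refine R.Im_E ?_ hv
  rw [mem_Im] at h4 ⊢
  intro s hs
  refine h4 s ?_
  classical
  rw [mem_support_iff, coeff_weightedHomogeneousComponent] at hs
  rw [mem_support_iff]
  intro h7
  simp [h7] at hs

variable (R) in
lemma ex_E (v : L) : ∃ v' ∈ R.E, ∀ i, ¬ R.d i < 0 → killingForm ℂ L (R.b i) v' = killingForm ℂ L (R.b i) v := by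
  obtain ⟨v', hv⟩ := kf_surj (R.b.constr ℂ fun i => if R.d i < 0 then R.ch i else killingForm ℂ L (R.b i) v)
  have h1 : ∀ i, killingForm ℂ L (R.b i) v' = if R.d i < 0 then R.ch i else killingForm ℂ L (R.b i) v := by
    intro i; rw [kf_comm, hv, Module.Basis.constr_basis]
  refine ⟨v', R.mem_E.2 fun i hi => ?_, fun i hi => ?_⟩
  · rw [h1, if_pos hi]; rfl
  · rw [h1, if_neg hi]

variable (R) in
noncomputable def ev0 : R.PP →ₐ[ℂ] R.PP := aeval (fun i => if R.d i < 0 then 0 else X i)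
variable (R) in
noncomputable def evE : R.PP →ₐ[ℂ] R.PP := aeval (fun i => if R.d i < 0 then C (R.ch i) else X i)

lemma ev0_Im (q) : q - R.ev0 q ∈ R.Im := by
  have : (Ideal.Quotient.mkₐ ℂ R.Im).comp R.ev0 = Ideal.Quotient.mkₐ ℂ R.Im := by
    ext1 i
    rw [AlgHom.comp_apply, ev0, aeval_X]
    by_cases h1 : R.d i < 0
    · rw [if_pos h1, map_zero]
      have h2 : X i ∈ R.Im := Ideal.subset_span ⟨i, h1, rfl⟩
      exact (Ideal.Quotient.eq_zero_iff_mem.2 h2).symm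
    · rw [if_neg h1]
  have h1 := DFunLike.congr_fun this q
  exact Ideal.Quotient.eq.1 h1.symm

lemma lemR {N u p} (hz : (u, p) ∈ R.QQ N) (hp : ∀ v ∈ R.E, evp R.b v p = 0) :
    ∃ f ∈ R.FU (N - 1), u - f ∈ R.J := by
  obtain ⟨q, h2, rfl, rfl⟩ := QQ_Th hz
  set r := weightedHomogeneousComponent R.kk N q with hr
  have h0 : R.ev0 r = 0 := by
    apply evp_ext R.b
    intro v
    obtain ⟨v', h3, h4⟩ := R.ex_E v
    have h5 : (evp R.b v).comp R.ev0 = (evp R.b v').comp R.tau := by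
      ext1 i
      rw [AlgHom.comp_apply, AlgHom.comp_apply, ev0, tau, aeval_X, aeval_X, XX, map_sub, evp_X, ← algebraMap_eq, AlgHom.commutes]
      by_cases h1 : R.d i < 0
      · rw [if_pos h1, map_zero, R.mem_E.1 h3 i h1, ch]; simp
      · rw [if_neg h1, evp_X, h4 i h1]
        have : R.ch i = 0 := by
          by_contra h6
          have := R.ch_ne h6
          omega
        rw [this]; simp
    have := DFunLike.congr_fun h5 r
    rw [AlgHom.comp_apply, AlgHom.comp_apply] at this
    rw [this]
    exact hp v' h3
  have h1 : r ∈ R.Im := by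
    have := ev0_Im (R := R) r
    rwa [h0, sub_zero] at this
  refine ⟨R.Th (q - r), Th_FU (whc_Fil R.kk h2), ?_⟩
  rw [← map_sub, sub_sub_cancel]
  exact R.Th_J h1

lemma evE_wh (M : ℤ) (p : R.PP) (hp : IsWeightedHomogeneous R.kk p M) : IsWeightedHomogeneous R.kk (R.evE p) (M + 0) := by
  rw [add_zero]
  refine wh_aeval R.kk R.kk _ (fun i => ?_) hp
  by_cases h1 : R.d i < 0
  · rw [if_pos h1]
    by_cases h2 : R.ch i = 0
    · rw [h2, map_zero]; exact isWeightedHomogeneous_zero _ _ _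
    · have := R.ch_ne h2
      rw [show R.kk i = 0 by simp [kk, this]]
      exact isWeightedHomogeneous_C R.kk (R.ch i)
  · rw [if_neg h1]; exact isWeightedHomogeneous_X ℂ R.kk i

lemma evE_E {v} (hv : v ∈ R.E) (p) : evp R.b v (R.evE p) = evp R.b v p := by
  have : (evp R.b v).comp R.evE = evp R.b v := by
    ext1 i
    rw [AlgHom.comp_apply, evE, aeval_X]
    by_cases h1 : R.d i < 0
    · rw [if_pos h1, evp_X, R.mem_E.1 hv i h1, ← algebraMap_eq, AlgHom.commutes]; rfl
    · rw [if_neg h1]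
  exact DFunLike.congr_fun this p

lemma evE_ext {p} (hp : ∀ v ∈ R.E, evp R.b v p = 0) : R.evE p = 0 := by
  apply evp_ext R.b
  intro v
  obtain ⟨v', h3, h4⟩ := R.ex_E v
  have h5 : (evp R.b v).comp R.evE = evp R.b v' := by
    ext1 i
    rw [AlgHom.comp_apply, evE, aeval_X]
    by_cases h1 : R.d i < 0
    · rw [if_pos h1, evp_X, R.mem_E.1 h3 i h1, ← algebraMap_eq, AlgHom.commutes]; rfl
    · rw [if_neg h1, evp_X, evp_X, h4 i h1]
  rw [← AlgHom.comp_apply, h5]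
  exact hp v' h3

lemma whc_E {p p0 : R.PP} {N} (hp : IsWeightedHomogeneous R.kk p N) (h1 : ∀ v ∈ R.E, evp R.b v p0 = evp R.b v p) {v} (hv : v ∈ R.E) :
    evp R.b v (weightedHomogeneousComponent R.kk N p0) = evp R.b v p := by
  have h2 : R.evE (p0 - p) = 0 := evE_ext fun v hv => by rw [map_sub, h1 v hv, sub_self]
  have h3 := wh_comm R.kk R.evE.toLinearMap 0 (fun M p => evE_wh M p) N (p0 - p)
  rw [AlgHom.toLinearMap_apply, AlgHom.toLinearMap_apply, h2, map_zero] at h3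
  have h4 := evE_E hv (weightedHomogeneousComponent R.kk N (p0 - p))
  rw [← h3, map_zero, map_sub, hp.weightedHomogeneousComponent_same, map_sub] at h4
  exact (sub_eq_zero.1 h4.symm)

end RD
end Kos

namespace Kos
open MvPolynomial
namespace RD
variable {L : Type*} [LieRing L] [LieAlgebra ℂ L] [FiniteDimensional ℂ L] [LieAlgebra.IsKilling ℂ L]
  {e h : L} (R : RD L e h)

noncomputable def sym : ℕ → R.PP →ₗ[ℂ] R.UU
  | 0 => Algebra.linearMap ℂ R.UU ∘ₗ (aeval (fun _ => (0 : ℂ)) : R.PP →ₐ[ℂ] ℂ).toLinearMap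
  | n + 1 => ((n : ℂ) + 1)⁻¹ • ∑ i, LinearMap.mulLeft ℂ (R.io (R.b i)) ∘ₗ sym n ∘ₗ (pderiv i).toLinearMap

lemma sym_zero (s) : R.sym 0 s = algebraMap ℂ R.UU (aeval (fun _ => (0 : ℂ)) s) := rfl
lemma sym_succ (n s) : R.sym (n + 1) s = ((n : ℂ) + 1)⁻¹ • ∑ i, R.io (R.b i) * R.sym n (pderiv i s) := by
  simp [sym]

lemma lin_repr (y : L) : linP R.b y = ∑ k, R.b.repr y k • X k := by
  conv_lhs => rw [← R.b.sum_repr y]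
  simp only [map_sum, map_smul, linP_b]

lemma DP_const (x) (s : R.PP) : aeval (fun _ => (0 : ℂ)) (DP R.b x s) = 0 := by
  induction s using MvPolynomial.induction_on with
  | C a => rw [show DP R.b x (C a) = 0 from Derivation.map_algebraMap _ _, map_zero]
  | add p q hp hq => rw [map_add, map_add, hp, hq, add_zero]
  | mul_X p i hp =>
    rw [Derivation.leibniz, map_add, smul_eq_mul, smul_eq_mul, map_mul, map_mul, hp, DP_X, lin_repr, map_sum]
    simp

lemma der_sum (D : Fin R.n → Derivation ℂ R.PP R.PP) (s) : (∑ k, D k) s = ∑ k, D k s := by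
  have := map_sum (Derivation.coeFnAddMonoidHom (R := ℂ) (A := R.PP) (M := R.PP)) D Finset.univ
  have h2 := congrFun this s
  rw [Finset.sum_apply] at h2
  exact h2

lemma pd_DP (i) (x) (s : R.PP) : pderiv i (DP R.b x s) = DP R.b x (pderiv i s) + ∑ k, R.b.repr ⁅x, R.b k⁆ i • pderiv k s := by
  have h1 : ⁅(pderiv i : Derivation ℂ R.PP R.PP), DP R.b x⁆ = ∑ k, R.b.repr ⁅x, R.b k⁆ i • (pderiv k : Derivation ℂ R.PP R.PP) := by
    apply MvPolynomial.derivation_ext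
    intro j
    have h0 : DP R.b x (pderiv i (X j : R.PP)) = 0 := by
      by_cases hij : j = i
      · subst hij; rw [pderiv_X_self]; exact Derivation.map_one_eq_zero _
      · rw [pderiv_X_of_ne hij, map_zero]
    rw [Derivation.commutator_apply, h0, DP_X, lin_repr, map_sum, der_sum]
    simp only [Derivation.map_smul, pderiv_X, Derivation.smul_apply, Pi.single_apply]
    simp
  have h2 := DFunLike.congr_fun h1 s
  rw [Derivation.commutator_apply, der_sum] at h2
  simp only [Derivation.smul_apply] at h2
  rw [← h2]; ring

lemma sym_eq (n) (x) (s) : R.io x * R.sym n s - R.sym n s * R.io x = R.sym n (DP R.b x s) := by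
  induction n generalizing s with
  | zero =>
    rw [sym_zero, sym_zero, DP_const, map_zero, Algebra.commutes, sub_self]
  | succ n ih =>
    rw [sym_succ, sym_succ, mul_smul_comm, smul_mul_assoc, ← smul_sub, Finset.mul_sum, Finset.sum_mul, ← Finset.sum_sub_distrib]
    congr 1
    have h1 : ∀ i, R.io x * (R.io (R.b i) * R.sym n (pderiv i s)) - R.io (R.b i) * R.sym n (pderiv i s) * R.io x =
        ∑ k, R.b.repr ⁅x, R.b i⁆ k • (R.io (R.b k) * R.sym n (pderiv i s)) + R.io (R.b i) * R.sym n (DP R.b x (pderiv i s)) := by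
      intro i
      have : ∑ k, R.b.repr ⁅x, R.b i⁆ k • (R.io (R.b k) * R.sym n (pderiv i s)) = R.io ⁅x, R.b i⁆ * R.sym n (pderiv i s) := by
        rw [R.io_repr ⁅x, R.b i⁆, Finset.sum_mul]
        simp only [smul_mul_assoc]
      rw [this, ← ih, io_lie]
      simp only [mul_sub, sub_mul, mul_assoc]; abel
    rw [Finset.sum_congr rfl fun i _ => h1 i, Finset.sum_add_distrib, Finset.sum_comm, ← Finset.sum_add_distrib]
    refine Finset.sum_congr rfl fun i _ => ?_
    rw [pd_DP, map_add, mul_add, add_comm, map_sum, Finset.mul_sum]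
    simp only [map_smul, mul_smul_comm]

lemma sym_QQ (n : ℕ) (N : ℤ) (s : R.PP) (h1 : s.IsHomogeneous n) (h2 : IsWeightedHomogeneous R.kk s N) : (R.sym n s, s) ∈ R.QQ N := by
  induction n generalizing N s with
  | zero =>
    obtain ⟨c, rfl⟩ : ∃ c, s = C c := ⟨_, totalDegree_eq_zero_iff_eq_C.1 ((totalDegree_zero_iff_isHomogeneous _).2 h1)⟩
    by_cases hc : c = 0
    · subst hc
      rw [map_zero, map_zero]; exact Submodule.zero_mem _
    · have h3 : N = 0 := by
        have h4 : (C c : R.PP) ≠ 0 := by simpa using hc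
        exact IsWeightedHomogeneous.inj_right h4 h2 (isWeightedHomogeneous_C R.kk c)
      have h5 := Submodule.smul_mem _ c (pu_QQ (R := R) [])
      rw [h3, sym_zero]
      rw [Prod.smul_mk, pu_nil, pp_nil, wl_nil] at h5
      convert h5 using 2
      · rw [← algebraMap_eq, AlgHom.commutes, Algebra.algebraMap_eq_smul_one]; rfl
      · rw [smul_eq_C_mul, mul_one]
  | succ n ih =>
    have h3 : ∀ i, (R.io (R.b i) * R.sym n (pderiv i s), X i * pderiv i s) ∈ R.QQ N := by
      intro i
      have := X_QQ i (ih (N - R.kk i) (pderiv i s) (by simpa using h1.pderiv) (h2.pderiv (by ring)))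
      rwa [add_sub_cancel] at this
    have h4 := Submodule.smul_mem _ ((n : ℂ) + 1)⁻¹ (Submodule.sum_mem (R.QQ N) (t := Finset.univ) fun i _ => h3 i)
    convert h4 using 1
    ext1
    · rw [Prod.smul_fst, Prod.fst_sum, sym_succ]
    · rw [Prod.smul_snd, Prod.snd_sum, h1.sum_X_mul_pderiv, ← Nat.cast_smul_eq_nsmul ℂ, smul_smul]
      have : ((n : ℂ) + 1) ≠ 0 := by exact_mod_cast Nat.succ_ne_zero n
      push_cast
      rw [inv_mul_cancel₀ this, one_smul]

variable {R}
lemma DP_wh (i) (M : ℤ) (p : R.PP) (hp : IsWeightedHomogeneous R.kk p M) :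
    IsWeightedHomogeneous R.kk (DP R.b (R.b i) p) (M + R.d i) := by
  have h0 : ∀ j, IsWeightedHomogeneous R.kk (DP R.b (R.b i) (X j)) (R.kk j + R.d i) := by
    intro j
    rw [DP_X, lin_repr]
    refine Submodule.sum_mem (weightedHomogeneousSubmodule ℂ R.kk (R.kk j + R.d i)) fun k _ => ?_
    by_cases h0 : R.b.repr ⁅R.b i, R.b j⁆ k = 0
    · rw [h0, zero_smul]; exact Submodule.zero_mem _
    · have h3 := R.repr_bb i j k h0
      refine Submodule.smul_mem _ _ ?_
      rw [show R.kk j + R.d i = R.kk k by simp [kk, h3]; ring]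
      exact isWeightedHomogeneous_X ℂ R.kk k
  have := wh_ind R.kk hp ((weightedHomogeneousSubmodule ℂ R.kk (M + R.d i)).comap (DP R.b (R.b i)).toLinearMap) (fun s hs => ?_)
  · exact this
  · rw [← hs]
    change IsWeightedHomogeneous R.kk (DP R.b (R.b i) (monomial s 1)) (Finsupp.weight R.kk s + R.d i)
    clear hs
    induction s using fs_ind with
    | h0 =>
      rw [show DP R.b (R.b i) (monomial 0 1) = 0 from Derivation.map_algebraMap _ 1]
      exact isWeightedHomogeneous_zero _ _ _
    | hs s j ih =>
      rw [mon_cons, weight_cons, Derivation.leibniz, smul_eq_mul, smul_eq_mul]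
      refine IsWeightedHomogeneous.add ?_ ?_
      · rw [add_assoc]; exact (isWeightedHomogeneous_X ℂ R.kk j).mul ih
      · rw [show R.kk j + Finsupp.weight R.kk s + R.d i = Finsupp.weight R.kk s + (R.kk j + R.d i) by ring]
        exact (isWeightedHomogeneous_monomial R.kk s 1 rfl).mul (h0 j)

lemma DP_repr (x) (p : R.PP) : DP R.b x p = ∑ i, R.b.repr x i • DP R.b (R.b i) p := by
  let F : L →ₗ[ℂ] R.PP :=
    { toFun := fun x => DP R.b x p
      map_add' := fun x y => by rw [DP_add]; rfl
      map_smul' := fun c x => by rw [DP_smul]; rfl }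
  have : F x = ∑ i, R.b.repr x i • F (R.b i) := by
    conv_lhs => rw [← R.b.sum_repr x]
    simp only [map_sum, map_smul]
  exact this

lemma Inv_of_b {p : R.PP} (hp : ∀ i, DP R.b (R.b i) p = 0) : p ∈ Inv R.b := by
  rw [mem_Inv]
  intro x
  rw [DP_repr]
  simp [hp]

lemma whc_Inv {p : R.PP} (hp : p ∈ Inv R.b) (N) : weightedHomogeneousComponent R.kk N p ∈ Inv R.b := by
  refine Inv_of_b fun i => ?_
  have := wh_comm R.kk (DP R.b (R.b i)).toLinearMap (R.d i) (DP_wh i) N p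
  have h2 : (DP R.b (R.b i)).toLinearMap p = 0 := hp (R.b i)
  rw [h2, map_zero] at this
  exact this.symm

lemma DP_h (s) : DP R.b h (monomial s (1:ℂ)) = (2 * (Finsupp.weight R.d s : ℂ)) • monomial s 1 := by
  induction s using fs_ind with
  | h0 =>
    rw [show DP R.b h (monomial 0 1) = 0 from Derivation.map_algebraMap _ 1]; simp
  | hs s i ih =>
    rw [mon_cons, weight_cons, Derivation.leibniz, ih, DP_X, lieh, map_smul, linP_b]
    push_cast
    simp only [smul_eq_mul, mul_smul_comm, smul_eq_C_mul, map_mul, map_add]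
    ring

lemma Inv_wt {p : R.PP} (hp : p ∈ Inv R.b) (s) (hs : s ∈ p.support) : Finsupp.weight R.d s = 0 := by
  have h1 : ∀ q : R.PP, coeff s (DP R.b h q) = (2 * (Finsupp.weight R.d s : ℂ)) * coeff s q := by
    intro q
    induction q using MvPolynomial.induction_on' with
    | monomial t a =>
      have : monomial t a = a • monomial t (1:ℂ) := by rw [smul_monomial]; simp
      rw [this, Derivation.map_smul, DP_h, coeff_smul, coeff_smul, coeff_smul, coeff_monomial]
      split_ifs with h2
      · subst h2; simp; ring
      · simp
    | add p q hp hq => rw [map_add, coeff_add, hp, hq, coeff_add, mul_add]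
  have h2 := h1 p
  rw [hp h, coeff_zero] at h2
  have h3 := (mul_eq_zero.1 h2.symm).resolve_right (mem_support_iff.1 hs)
  simpa using h3

lemma weight_kk (s : Fin R.n →₀ ℕ) : Finsupp.weight R.kk s = Finsupp.weight R.d s + (s.degree : ℤ) := by
  induction s using fs_ind with
  | h0 => simp
  | hs s i ih => rw [weight_cons, weight_cons, ih, map_add, Finsupp.degree_single, kk]; push_cast; ring

lemma Inv_hom {p : R.PP} (hp : p ∈ Inv R.b) {N} (hN : IsWeightedHomogeneous R.kk p N) : p.IsHomogeneous N.toNat := by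
  intro s hs
  have h1 := hN hs
  have h2 := Inv_wt hp s (mem_support_iff.2 hs)
  rw [weight_kk, h2, zero_add] at h1
  have : s.degree = N.toNat := by omega
  rw [← this]
  exact (DFunLike.congr_fun Finsupp.degree_eq_weight_one s).symm

lemma main2 (N : ℕ) (y : R.UU) (hy : y ∈ R.FU ((N : ℤ) - 1)) (hJ : ∀ a ∈ R.mm, R.io a * y - y * R.io a ∈ R.J) :
    ∃ z ∈ Subalgebra.center ℂ R.UU, y - z ∈ R.J := by
  induction N generalizing y with
  | zero => exact ⟨0, Subalgebra.zero_mem _, by rw [sub_zero]; exact R.J_FU (by simpa using hy)⟩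
  | succ N ih =>
    have hy' : y ∈ R.FU N := by simpa using hy
    obtain ⟨p, hp⟩ := exists_QQ hy'
    have hk : R.KilledOn p := by
      intro a ha v hv
      rw [DP_repr, map_sum]
      refine Finset.sum_eq_zero fun i _ => ?_
      by_cases h0 : R.b.repr a i = 0
      · rw [h0, zero_smul, map_zero]
      · have hi : R.d i < 0 := R.mem_gr.1 ha i h0
        rw [map_smul, lemS (lie_QQ i hp) (Submodule.zero_mem _) (by rw [sub_zero]; exact hJ _ (R.b_mem_gr hi)) hv, smul_zero]
    obtain ⟨p0, h0, h1⟩ := R.C2 p hk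
    set p1 := weightedHomogeneousComponent R.kk (N : ℤ) p0 with hp1
    have h2 : p1 ∈ Inv R.b := whc_Inv h0 _
    have h3 : IsWeightedHomogeneous R.kk p1 N := weightedHomogeneousComponent_isWeightedHomogeneous _ _
    have h4 := R.sym_QQ _ N p1 (Inv_hom h2 h3) h3
    set z := R.sym ((N : ℤ).toNat) p1 with hz
    have h5 : ∀ x, R.io x * z - z * R.io x = 0 := fun x => by rw [hz, sym_eq, h2 x, map_zero]
    have h6 := Submodule.sub_mem _ hp h4
    rw [Prod.mk_sub_mk] at h6
    obtain ⟨f, hf, hf'⟩ := lemR h6 (fun v hv => by rw [map_sub, whc_E (QQ_wh hp) h1 hv, sub_self])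
    obtain ⟨z', hz', h7⟩ := ih f hf (fun a ha => by
      have h8 := R.J_ad ha hf'
      have h9 := Submodule.sub_mem _ (hJ a ha) h8
      have h10 : R.io a * f - f * R.io a = (R.io a * y - y * R.io a) - (R.io a * (y - z - f) - (y - z - f) * R.io a)
          - (R.io a * z - z * R.io a) := by
        simp only [mul_sub, sub_mul]; abel
      rw [h10, h5, sub_zero]; exact h9)
    refine ⟨z + z', Subalgebra.add_mem _ (R.center_of h5) hz', ?_⟩
    have := Submodule.add_mem _ hf' h7
    convert this using 1
    abel

lemma main1 (z : R.UU) (hz : z ∈ Subalgebra.center ℂ R.UU) (hJ : z ∈ R.J) : z = 0 := by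
  obtain ⟨q, rfl⟩ := R.Th_surj z
  by_contra h0
  have hq : q ≠ 0 := by rintro rfl; exact h0 (map_zero _)
  obtain ⟨M, h1, h2⟩ := wh_top R.kk hq
  have h3 := Th_QQ h1
  set p := R.tau (weightedHomogeneousComponent R.kk M q) with hp
  have h4 : p ∈ Inv R.b := by
    refine Inv_of_b fun i => ?_
    refine QQ_zero (N := M + R.d i) (M := M + R.d i - 1) (by omega) (lie_QQ i h3) ?_
    rw [Subalgebra.mem_center_iff.1 hz, sub_self]
    exact Submodule.zero_mem _
  have h5 : p = 0 := R.C1 p h4 fun v hv => lemS h3 (Submodule.zero_mem _) (by rwa [sub_zero]) hv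
  exact h2 (R.tau_inj h5)

end RD
end Kos

namespace Kos
namespace RD
variable {L : Type*} [LieRing L] [LieAlgebra ℂ L] [FiniteDimensional ℂ L] [LieAlgebra.IsKilling ℂ L]
  {e h : L} (R : RD L e h)

lemma mm_eq : (⨆ j : ℕ, Module.End.eigenspace (LieAlgebra.ad ℂ L h) ((-(j : ℤ) - 2 : ℤ) : ℂ)) = R.mm := by
  apply le_antisymm
  · refine iSup_le fun j x hx => ?_
    rw [Module.End.mem_eigenspace_iff, LieAlgebra.ad_apply] at hx
    refine R.mem_gr.2 fun i hi => ?_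
    have := R.reprT ⟨h, R.hT⟩ x i
    simp only at this
    rw [hx] at this
    simp only [map_smul, Finsupp.smul_apply, smul_eq_mul, wth] at this
    have h2 := mul_right_cancel₀ hi this
    have h3 : -(j : ℤ) - 2 = 2 * R.d i := by exact_mod_cast h2
    omega
  · refine Submodule.span_le.2 ?_
    rintro _ ⟨i, hi, rfl⟩
    refine Submodule.mem_iSup_of_mem (-2 * R.d i - 2).toNat ?_
    rw [Module.End.mem_eigenspace_iff, LieAlgebra.ad_apply, lieh]
    congr 1
    have : -(((-2 * R.d i - 2).toNat : ℕ) : ℤ) - 2 = 2 * R.d i := by omega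
    rw [this]; push_cast; rfl

end RD

theorem final {L : Type*} [LieRing L] [LieAlgebra ℂ L] [FiniteDimensional ℂ L] [LieAlgebra.IsKilling ℂ L]
    {e h : L} (R : RD L e h) :
    Set.InjOn R.J.mkQ (Subalgebra.center ℂ (UniversalEnvelopingAlgebra ℂ L)) ∧
    R.J.mkQ '' (Subalgebra.center ℂ (UniversalEnvelopingAlgebra ℂ L) : Set _)
      = {q | ∃ y : UniversalEnvelopingAlgebra ℂ L, R.J.mkQ y = q ∧
          ∀ a ∈ R.mm, UniversalEnvelopingAlgebra.ι ℂ a * y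
            - y * UniversalEnvelopingAlgebra.ι ℂ a ∈ R.J} := by
  constructor
  · intro x hx y hy hxy
    have h1 : x - y ∈ R.J := (Submodule.Quotient.eq R.J).1 hxy
    exact sub_eq_zero.1 (RD.main1 (x - y) (Subalgebra.sub_mem _ hx hy) h1)
  · ext q
    constructor
    · rintro ⟨z, hz, rfl⟩
      refine ⟨z, rfl, fun a _ => ?_⟩
      rw [Subalgebra.mem_center_iff.1 hz, sub_self]
      exact Submodule.zero_mem _
    · rintro ⟨y, rfl, hy⟩
      obtain ⟨N, hN⟩ := R.FU_all y
      obtain ⟨z, hz, h1⟩ := RD.main2 (R := R) (N + 1).toNat y (RD.FU_le (by omega) hN) hy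
      exact ⟨z, hz, ((Submodule.Quotient.eq R.J).2 h1).symm⟩
end Kos



/-- **Kostant.** Let `(e,h,f)` be an `sl₂`-triple in a finite-dimensional semisimple
complex Lie algebra with `e` regular nilpotent (`dim 𝔤^e` equals the rank, the dimension
of a Cartan subalgebra).  With `𝔪 = ⊕_{j ≤ −2} 𝔤_j`, `χ(x) = κ(x,e)`, `I_χ` the left
ideal of `U(𝔤)` generated by `{a − χ(a)·1 : a ∈ 𝔪}` and `π : U(𝔤) → U(𝔤)/I_χ` the
quotient map of vector spaces: (1) `π` is injective on the center `Z(U(𝔤))`, and (2)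
`π(Z(U(𝔤))) = {π(y) : a·y − y·a ∈ I_χ for all a ∈ 𝔪}`; i.e. the finite `W`-algebra of a
regular nilpotent element is isomorphic to the center of `U(𝔤)`. -/
theorem kostant_W_algebra_eq_center
    {L : Type*} [LieRing L] [LieAlgebra ℂ L] [FiniteDimensional ℂ L]
    [LieAlgebra.IsSemisimple ℂ L]
    (e h f : L) (he : e ≠ 0) (hh : h ≠ 0) (hf : f ≠ 0)
    (hhe : ⁅h, e⁆ = (2 : ℂ) • e) (hhf : ⁅h, f⁆ = -((2 : ℂ) • f)) (hef : ⁅e, f⁆ = h)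
    (hnil : IsNilpotent (LieAlgebra.ad ℂ L e))
    (H : LieSubalgebra ℂ L) (hH : H.IsCartanSubalgebra)
    (hreg : Module.finrank ℂ (LinearMap.ker (LieAlgebra.ad ℂ L e)) = Module.finrank ℂ H)
    (m : Submodule ℂ L)
    (hm : m = ⨆ j : ℕ,
      Module.End.eigenspace (LieAlgebra.ad ℂ L h) ((-(j : ℤ) - 2 : ℤ) : ℂ))
    (Iχ : Submodule ℂ (UniversalEnvelopingAlgebra ℂ L))
    (hIχ : Iχ = Submodule.restrictScalars ℂ
      (Submodule.span (UniversalEnvelopingAlgebra ℂ L)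
        {x : UniversalEnvelopingAlgebra ℂ L | ∃ a ∈ m,
          x = UniversalEnvelopingAlgebra.ι ℂ a
            - algebraMap ℂ (UniversalEnvelopingAlgebra ℂ L) (killingForm ℂ L a e)})) :
    Set.InjOn Iχ.mkQ (Subalgebra.center ℂ (UniversalEnvelopingAlgebra ℂ L)) ∧
    Iχ.mkQ '' (Subalgebra.center ℂ (UniversalEnvelopingAlgebra ℂ L) : Set _)
      = {q | ∃ y : UniversalEnvelopingAlgebra ℂ L, Iχ.mkQ y = q ∧
          ∀ a ∈ m, UniversalEnvelopingAlgebra.ι ℂ a * y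
            - y * UniversalEnvelopingAlgebra.ι ℂ a ∈ Iχ} := by
  have t : IsSl2Triple h e f := by
    refine ⟨hh, hef, ?_, ?_⟩
    · rw [hhe, two_smul, two_smul]
    · rw [hhf, two_smul, two_smul]
  haveI := hH
  obtain ⟨hc, h1⟩ := Kos.reg_cartan hhe H hreg
  obtain ⟨R⟩ := Kos.exists_RD t hnil hc h1
  rw [R.mm_eq] at hm
  subst hm
  have hJ : Iχ = R.J := hIχ
  subst hJ
  exact Kos.final R
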